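/- Let n ≥ 2, Ω a bounded domain with B₁ ⋐ Ω, and let f : Ω × ℝⁿ → ℝ be a Carathéodory function, convex in the second variable for a.e. x, satisfying for some 1 ≤ L < ∞, μ ≥ 0 and nonnegative g ∈ L^{p/(p−1)}(Ω): |z|^p − g(x)^{p/(p−1)} ≤ f(x,z) ≤ L|z|^q + g(x)^{p/(p−1)} and f(x,2z) ≤ μ + L·f(x,z), where 1 ≤ p < q < ∞ and ε := min{1/q + 1/(n−1), 1} − 1/p ≥ 0. Let u ∈ W^{1,1}_loc(Ω) be a Q-minimizer of F[u,A] = ∫_A f(x,∇u) dx. Then there exists c = c(n,p,q,Q) ∈ [1,∞) such that for every k ≥ 0 and every 1/2 ≤ ρ < σ ≤ 1: ‖∇(u−k)₊‖_{L^p(B_ρ)}^p ≤ c ( ω(|A_{k,σ}|) + L |A_{k,σ}|^{qε} (σ−ρ)^{−γ} ‖(u−k)₊‖_{W^{1,p}(B_σ)}^q ), where γ := q − 1 + q·min{1/q + 1/(n−1), 1}, A_{k,σ} := B_σ ∩ {u > k}, and ω(t) := ∫_0^t ((g^{1/(p−1)}·χ_{B₁})*(s))^p ds with h* the nonincreasing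 rearrangement. -/

import Mathlib

open MeasureTheory Metric Set
open scoped ENNReal NNReal Topology

noncomputable section

/-- `du` is the weak gradient of `u` on the open set `Ω ⊆ ℝⁿ`, in the sense of
integration by parts against smooth compactly supported test functions. -/
def IsWeakGradOn (n : ℕ) (Ω : Set (EuclideanSpace ℝ (Fin n)))
    (u : EuclideanSpace ℝ (Fin n) → ℝ)
    (du : EuclideanSpace ℝ (Fin n) → EuclideanSpace ℝ (Fin n)) : Prop :=
  ∀ φ : EuclideanSpace ℝ (Fin n) → ℝ,
    ContDiff ℝ (⊤ : ℕ∞) φ → HasCompactSupport φ → tsupport φ ⊆ Ω →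
    ∀ i : Fin n,
      (∫ x in Ω, u x * (fderiv ℝ φ x (EuclideanSpace.single i (1 : ℝ))))
        = - ∫ x in Ω, du x i * φ x

/-- `u ∈ W^{1,1}_loc(Ω)` (with weak gradient `du`) is a `Q`-minimizer of the functional
`F[v,A] = ∫_A f(x, ∇v(x)) dx`: for every `φ ∈ W^{1,1}(Ω)` (with weak gradient `dφ`)
whose support is compactly contained in `Ω`, `F[u, supp φ] < ∞` (encoded as
integrability of `x ↦ f x (du x)` on `supp φ`) and
`F[u, supp φ] ≤ Q · F[u + φ, supp φ]`. -/
def IsQMinimizer (n : ℕ) (Ω : Set (EuclideanSpace ℝ (Fin n)))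
    (f : EuclideanSpace ℝ (Fin n) → EuclideanSpace ℝ (Fin n) → ℝ) (Q : ℝ)
    (u : EuclideanSpace ℝ (Fin n) → ℝ)
    (du : EuclideanSpace ℝ (Fin n) → EuclideanSpace ℝ (Fin n)) : Prop :=
  IsWeakGradOn n Ω u du ∧ LocallyIntegrableOn u Ω ∧ LocallyIntegrableOn du Ω ∧
  ∀ (φ : EuclideanSpace ℝ (Fin n) → ℝ)
    (dφ : EuclideanSpace ℝ (Fin n) → EuclideanSpace ℝ (Fin n)),
    IsWeakGradOn n Ω φ dφ → IntegrableOn φ Ω → IntegrableOn dφ Ω →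
    IsCompact (tsupport φ) → tsupport φ ⊆ Ω →
    IntegrableOn (fun x => f x (du x)) (tsupport φ) ∧
    (IntegrableOn (fun x => f x (du x + dφ x)) (tsupport φ) →
      (∫ x in tsupport φ, f x (du x)) ≤ Q * ∫ x in tsupport φ, f x (du x + dφ x))

/-- The nonincreasing rearrangement `h*(t) = inf {σ > 0 : |{|h| > σ}| ≤ t}`. -/
def rearr (n : ℕ) (h : EuclideanSpace ℝ (Fin n) → ℝ) (t : ℝ) : ℝ :=
  sInf {σ : ℝ | 0 < σ ∧ volume {x | σ < |h x|} ≤ ENNReal.ofReal t}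

/-- `ω(t) := ∫_0^t ((g^{1/(p−1)} χ_{B₁})*(s))^p ds`. -/
def omegaFn (n : ℕ) (p : ℝ) (g : EuclideanSpace ℝ (Fin n) → ℝ) (t : ℝ) : ℝ :=
  ∫ s in Ioo (0 : ℝ) t,
    (rearr n ((ball (0 : EuclideanSpace ℝ (Fin n)) 1).indicator
      fun x => g x ^ (1 / (p - 1))) s) ^ p

/-! ### Nonincreasing rearrangement -/

lemma rearr_nonneg (n : ℕ) (h : EuclideanSpace ℝ (Fin n) → ℝ) (t : ℝ) : 0 ≤ rearr n h t :=
  Real.sInf_nonneg fun _ hσ => hσ.1.le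

lemma bddBelow_rearr (n : ℕ) (h : EuclideanSpace ℝ (Fin n) → ℝ) (t : ℝ) :
    BddBelow {σ : ℝ | 0 < σ ∧ volume {x | σ < |h x|} ≤ ENNReal.ofReal t} :=
  ⟨0, fun _ hσ => hσ.1.le⟩

lemma rearr_le_of_measure_le {n : ℕ} {h : EuclideanSpace ℝ (Fin n) → ℝ} {s t : ℝ} (hs : 0 < s)
    (ht : volume {x | s < |h x|} ≤ ENNReal.ofReal t) : rearr n h t ≤ s :=
  csInf_le (bddBelow_rearr n h t) ⟨hs, ht⟩

lemma le_rearr_of_lt_measure {n : ℕ} {h : EuclideanSpace ℝ (Fin n) → ℝ} {s t : ℝ}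
    (hne : ∃ σ : ℝ, 0 < σ ∧ volume {x | σ < |h x|} ≤ ENNReal.ofReal t)
    (ht : ENNReal.ofReal t < volume {x | s < |h x|}) : s ≤ rearr n h t := by
  refine le_csInf hne fun σ hσ => ?_
  by_contra hlt
  push Not at hlt
  exact absurd (ht.trans_le (measure_mono fun x (hx : s < |h x|) => hlt.trans hx))
    (not_lt.2 hσ.2)

lemma antitoneOn_rearr {n : ℕ} {h : EuclideanSpace ℝ (Fin n) → ℝ}
    (hne : ∀ t : ℝ, 0 < t → ∃ σ : ℝ, 0 < σ ∧ volume {x | σ < |h x|} ≤ ENNReal.ofReal t) :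
    AntitoneOn (rearr n h) (Ioi 0) := by
  intro a ha b _ hab
  exact csInf_le_csInf (bddBelow_rearr n h b) (hne a ha)
    fun σ hσ => ⟨hσ.1, hσ.2.trans (ENNReal.ofReal_le_ofReal hab)⟩

lemma aemeasurable_rearr {n : ℕ} {h : EuclideanSpace ℝ (Fin n) → ℝ}
    (hne : ∀ t : ℝ, 0 < t → ∃ σ : ℝ, 0 < σ ∧ volume {x | σ < |h x|} ≤ ENNReal.ofReal t)
    (T : ℝ) : AEMeasurable (rearr n h) (volume.restrict (Ioo 0 T)) :=
  aemeasurable_restrict_of_antitoneOn measurableSet_Ioo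
    ((antitoneOn_rearr hne).mono fun _ hx => hx.1)

lemma lintegral_rpow_le_lintegral_rearr {n : ℕ} {h : EuclideanSpace ℝ (Fin n) → ℝ} {p : ℝ}
    (hp : 0 < p) (hm : AEMeasurable h)
    (hne : ∀ t : ℝ, 0 < t → ∃ σ : ℝ, 0 < σ ∧ volume {x | σ < |h x|} ≤ ENNReal.ofReal t)
    {A : Set (EuclideanSpace ℝ (Fin n))} (hA : volume A ≠ ∞) :
    ∫⁻ x in A, ENNReal.ofReal (|h x| ^ p) ≤
      ∫⁻ s in Ioo 0 (volume A).toReal, ENNReal.ofReal (rearr n h s ^ p) := by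
  rw [lintegral_rpow_eq_lintegral_meas_lt_mul _ (Filter.Eventually.of_forall fun _ => abs_nonneg _)
      (by exact hm.restrict.abs) hp,
    lintegral_rpow_eq_lintegral_meas_le_mul _ (Filter.Eventually.of_forall (rearr_nonneg n h))
      (aemeasurable_rearr hne _) hp]
  gcongr with s
  set d := volume {x | s < |h x|} with hd
  have h1 : volume.restrict A {a | s < |h a|} ≤ min (volume A) d := by
    refine le_min ?_ (Measure.restrict_apply_le _ _)
    calc volume.restrict A {a | s < |h a|} ≤ volume.restrict A univ := measure_mono (subset_univ _)
      _ = volume A := by simp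
  have hfin : min (volume A) d ≠ ∞ := ne_top_of_le_ne_top hA (min_le_left _ _)
  have h2 : Ioo 0 (min (volume A) d).toReal ⊆
      {a | s ≤ rearr n h a} ∩ Ioo 0 (volume A).toReal := by
    intro t ht
    have h3 : ENNReal.ofReal t < min (volume A) d := (ENNReal.ofReal_lt_iff_lt_toReal ht.1.le hfin).2 ht.2
    exact ⟨le_rearr_of_lt_measure (hne t ht.1) (h3.trans_le (min_le_right _ _)), ht.1,
      (ENNReal.ofReal_lt_iff_lt_toReal ht.1.le hA).1 (h3.trans_le (min_le_left _ _))⟩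
  calc _ ≤ min (volume A) d := h1
    _ = volume (Ioo 0 (min (volume A) d).toReal) := by
      rw [Real.volume_Ioo, sub_zero, ENNReal.ofReal_toReal hfin]
    _ ≤ _ := by
      rw [Measure.restrict_apply' measurableSet_Ioo]
      exact measure_mono h2

lemma lintegral_rearr_le {n : ℕ} {h : EuclideanSpace ℝ (Fin n) → ℝ} {p : ℝ}
    (hp : 0 < p) (hm : AEMeasurable h)
    (hne : ∀ t : ℝ, 0 < t → ∃ σ : ℝ, 0 < σ ∧ volume {x | σ < |h x|} ≤ ENNReal.ofReal t)
    (T : ℝ) :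
    ∫⁻ s in Ioo 0 T, ENNReal.ofReal (rearr n h s ^ p) ≤ ∫⁻ x, ENNReal.ofReal (|h x| ^ p) := by
  rw [lintegral_rpow_eq_lintegral_meas_lt_mul _ (Filter.Eventually.of_forall fun _ => abs_nonneg _)
      (by exact hm.abs) hp,
    lintegral_rpow_eq_lintegral_meas_lt_mul _ (Filter.Eventually.of_forall (rearr_nonneg n h))
      (aemeasurable_rearr hne _) hp]
  refine mul_le_mul_right (setLIntegral_mono' measurableSet_Ioi fun s (hs : 0 < s) => ?_) _
  refine mul_le_mul_left ?_ _
  set d := volume {x | s < |h x|} with hd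
  rw [Measure.restrict_apply' measurableSet_Ioo]
  by_cases hdt : d = ∞
  · rw [hdt]; exact le_top
  have h2 : {a | s < rearr n h a} ∩ Ioo 0 T ⊆ Ioo 0 d.toReal := by
    rintro t ⟨ht, ht0, -⟩
    refine ⟨ht0, (ENNReal.ofReal_lt_iff_lt_toReal ht0.le hdt).1 ?_⟩
    by_contra hcon
    push Not at hcon
    exact absurd (rearr_le_of_measure_le hs hcon) (not_le.2 ht)
  calc _ ≤ volume (Ioo 0 d.toReal) := measure_mono h2
    _ = d := by rw [Real.volume_Ioo, sub_zero, ENNReal.ofReal_toReal hdt]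

/-- Hardy–Littlewood type bound of `∫_A g^{p/(p-1)}` by `ω(|A|)`. -/
lemma setIntegral_le_omegaFn {n : ℕ} {p : ℝ} (hp : 1 ≤ p) {g : EuclideanSpace ℝ (Fin n) → ℝ}
    {Ω : Set (EuclideanSpace ℝ (Fin n))} (hΩ : closedBall 0 1 ⊆ Ω)
    (hg0 : ∀ᵐ x ∂volume.restrict Ω, 0 ≤ g x) (hgm : AEMeasurable g (volume.restrict Ω))
    (hgi : IntegrableOn (fun x => g x ^ (p / (p - 1))) Ω)
    {A : Set (EuclideanSpace ℝ (Fin n))} (hA : A ⊆ ball 0 1) :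
    ∫ x in A, g x ^ (p / (p - 1)) ≤ omegaFn n p g (volume A).toReal := by
  have hp0 : 0 < p := by linarith
  have hB : ball (0 : EuclideanSpace ℝ (Fin n)) 1 ⊆ Ω := ball_subset_closedBall.trans hΩ
  set h : EuclideanSpace ℝ (Fin n) → ℝ :=
    (ball (0 : EuclideanSpace ℝ (Fin n)) 1).indicator fun x => g x ^ (1 / (p - 1)) with hh
  have hm : AEMeasurable h :=
    (aemeasurable_indicator_iff measurableSet_ball).2
      ((hgm.mono_measure (Measure.restrict_mono hB le_rfl)).pow_const _)
  have hpow : ∀ᵐ x ∂volume.restrict (ball (0 : EuclideanSpace ℝ (Fin n)) 1),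
      |h x| ^ p = g x ^ (p / (p - 1)) := by
    filter_upwards [ae_restrict_of_ae_restrict_of_subset hB hg0, ae_restrict_mem measurableSet_ball]
      with x hx hxB
    rw [hh, indicator_of_mem hxB, abs_of_nonneg (by positivity), ← Real.rpow_mul hx]
    congr 1; ring
  have htot : ∫⁻ x, ENNReal.ofReal (|h x| ^ p) ≠ ∞ := by
    have e1 : (fun x => ENNReal.ofReal (|h x| ^ p)) =
        (ball (0 : EuclideanSpace ℝ (Fin n)) 1).indicator fun x => ENNReal.ofReal (|h x| ^ p) := by
      ext x
      by_cases hx : x ∈ ball (0 : EuclideanSpace ℝ (Fin n)) 1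
      · rw [indicator_of_mem hx]
      · rw [indicator_of_notMem hx, hh, indicator_of_notMem hx]; simp [hp0.ne']
    rw [e1, lintegral_indicator measurableSet_ball]
    rw [lintegral_congr_ae (g := fun x => ENNReal.ofReal (g x ^ (p / (p - 1))))
      (hpow.mono fun x hx => by simp only [hx])]
    exact ((hgi.mono_set hB).lintegral_lt_top).ne
  have hne : ∀ t : ℝ, 0 < t → ∃ σ : ℝ, 0 < σ ∧ volume {x | σ < |h x|} ≤ ENNReal.ofReal t := by
    intro t ht
    set I := ∫⁻ x, ENNReal.ofReal (|h x| ^ p) with hI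
    set σ : ℝ := ((I.toReal + 1) / t) ^ (1 / p) with hσ
    have hσ0 : 0 < σ := by positivity
    have hσp : σ ^ p = (I.toReal + 1) / t := by
      rw [hσ, ← Real.rpow_mul (by positivity), one_div_mul_cancel hp0.ne', Real.rpow_one]
    refine ⟨σ, hσ0, ?_⟩
    have h1 : ENNReal.ofReal (σ ^ p) * volume {x | σ < |h x|} ≤ I := by
      refine le_trans ?_ (mul_meas_ge_le_lintegral₀ (hm.abs.pow_const p).ennreal_ofReal
        (ENNReal.ofReal (σ ^ p)))
      refine mul_le_mul_right (measure_mono fun x hx => ?_) _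
      exact ENNReal.ofReal_le_ofReal (Real.rpow_le_rpow hσ0.le (le_of_lt hx) hp0.le)
    rw [hσp] at h1
    have h2 : volume {x | σ < |h x|} ≤ I / ENNReal.ofReal ((I.toReal + 1) / t) := by
      rw [ENNReal.le_div_iff_mul_le (Or.inl (by simp; positivity)) (Or.inl ENNReal.ofReal_ne_top),
        mul_comm]
      exact h1
    refine h2.trans ?_
    rw [ENNReal.div_le_iff (by simp; positivity) ENNReal.ofReal_ne_top, ← ENNReal.ofReal_mul ht.le,
      mul_div_cancel₀ _ ht.ne']
    exact (ENNReal.ofReal_toReal htot).ge.trans (ENNReal.ofReal_le_ofReal (by linarith))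
  have hAfin : volume A ≠ ∞ := ne_top_of_le_ne_top measure_ball_lt_top.ne (measure_mono hA)
  have hpA := ae_restrict_of_ae_restrict_of_subset hA hpow
  have hintA : ∫ x in A, g x ^ (p / (p - 1)) = ∫ x in A, |h x| ^ p :=
    integral_congr_ae (hpA.mono fun x hx => hx.symm)
  rw [hintA, integral_eq_lintegral_of_nonneg_ae
    (Filter.Eventually.of_forall fun x => by positivity) (hm.restrict.abs.pow_const p).aestronglyMeasurable]
  rw [omegaFn, integral_eq_lintegral_of_nonneg_ae
    (Filter.Eventually.of_forall fun x => by exact Real.rpow_nonneg (rearr_nonneg n h x) p)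
    (by exact ((aemeasurable_rearr hne _).pow_const p).aestronglyMeasurable)]
  refine ENNReal.toReal_mono ?_ (lintegral_rpow_le_lintegral_rearr hp0 hm hne hAfin)
  exact ne_top_of_le_ne_top htot (lintegral_rearr_le hp0 hm hne _)

/-! ### Hölder and Jensen inequalities for lower integrals -/

lemma lintegral_rpow_le_measure_rpow_mul {α : Type*} [MeasurableSpace α] {ν : Measure α}
    {f : α → ℝ≥0∞} (hf : AEMeasurable f ν) {s p : ℝ} (hs : 0 < s) (hsp : s ≤ p) :
    ∫⁻ x, f x ^ s ∂ν ≤ ν univ ^ (1 - s / p) * (∫⁻ x, f x ^ p ∂ν) ^ (s / p) := by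
  have h := eLpNorm'_le_eLpNorm'_mul_rpow_measure_univ hs hsp hf.aestronglyMeasurable
  simp only [eLpNorm', enorm_eq_self] at h
  have h2 := ENNReal.rpow_le_rpow h hs.le
  rw [ENNReal.mul_rpow_of_nonneg _ _ hs.le, ← ENNReal.rpow_mul, ← ENNReal.rpow_mul,
    ← ENNReal.rpow_mul, one_div_mul_cancel hs.ne', ENNReal.rpow_one, mul_comm] at h2
  convert h2 using 3
  · field_simp
  · ring

lemma lintegral_rpow_le_of_isProbabilityMeasure {α : Type*} [MeasurableSpace α] {ν : Measure α}
    [IsProbabilityMeasure ν] {f : α → ℝ≥0∞} (hf : AEMeasurable f ν) {s : ℝ} (hs : 1 ≤ s) :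
    (∫⁻ x, f x ∂ν) ^ s ≤ ∫⁻ x, f x ^ s ∂ν := by
  have h := lintegral_rpow_le_measure_rpow_mul hf one_pos hs
  simp only [ENNReal.rpow_one, measure_univ, ENNReal.one_rpow, one_mul] at h
  have h2 := ENNReal.rpow_le_rpow h (by linarith : (0 : ℝ) ≤ s)
  rwa [← ENNReal.rpow_mul, one_div_mul_cancel (by linarith), ENNReal.rpow_one] at h2

/-! ### Mollification -/

open scoped Convolution in
/-- A standard bump function supported in the ball of radius `1 / (j + 1)`. -/
def stdBump (n j : ℕ) : ContDiffBump (0 : EuclideanSpace ℝ (Fin n)) :=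
  ⟨1 / (2 * ((j : ℝ) + 1)), 1 / ((j : ℝ) + 1), by positivity, by
    apply one_div_lt_one_div_of_lt <;> linarith [(Nat.cast_nonneg j : (0 : ℝ) ≤ j)]⟩

open scoped Convolution in
/-- Mollification at scale `1 / (j + 1)`. -/
def mollify {n : ℕ} {F : Type*} [NormedAddCommGroup F] [NormedSpace ℝ F] (j : ℕ)
    (g : EuclideanSpace ℝ (Fin n) → F) : EuclideanSpace ℝ (Fin n) → F :=
  (stdBump n j).normed volume ⋆[ContinuousLinearMap.lsmul ℝ ℝ, volume] g

section mollify

variable {n : ℕ} {F : Type*} [NormedAddCommGroup F] [NormedSpace ℝ F]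

lemma mollify_apply (j : ℕ) (g : EuclideanSpace ℝ (Fin n) → F) (x : EuclideanSpace ℝ (Fin n)) :
    mollify j g x = ∫ t, (stdBump n j).normed volume t • g (x - t) := rfl

lemma mollify_apply_swap (j : ℕ) (g : EuclideanSpace ℝ (Fin n) → F)
    (x : EuclideanSpace ℝ (Fin n)) :
    mollify j g x = ∫ t, (stdBump n j).normed volume (x - t) • g t := by
  rw [mollify, convolution_eq_swap]; rfl

lemma contDiff_mollify [CompleteSpace F] (j : ℕ) {g : EuclideanSpace ℝ (Fin n) → F}
    (hg : LocallyIntegrable g) : ContDiff ℝ (⊤ : ℕ∞) (mollify j g) :=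
  (stdBump n j).hasCompactSupport_normed.contDiff_convolution_left _
    (stdBump n j).contDiff_normed hg

lemma ae_tendsto_mollify [CompleteSpace F] {g : EuclideanSpace ℝ (Fin n) → F}
    (hg : LocallyIntegrable g) :
    ∀ᵐ x, Filter.Tendsto (fun j => mollify j g x) Filter.atTop (𝓝 (g x)) := by
  refine ContDiffBump.ae_convolution_tendsto_right_of_locallyIntegrable (K := 2)
    (φ := fun j => stdBump n j) ?_ ?_ hg
  · exact tendsto_one_div_add_atTop_nhds_zero_nat
  · refine Filter.Eventually.of_forall fun j => le_of_eq ?_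
    simp only [stdBump]
    field_simp

lemma setLIntegral_enorm_mollify_rpow_le {j : ℕ} {g : EuclideanSpace ℝ (Fin n) → F}
    (hg : AEStronglyMeasurable g) {s : ℝ} (hs : 1 ≤ s) {K O : Set (EuclideanSpace ℝ (Fin n))}
    (hK : MeasurableSet K) (hO : MeasurableSet O)
    (hKO : ∀ x ∈ K, ball x (1 / ((j : ℝ) + 1)) ⊆ O) :
    ∫⁻ x in K, ‖mollify j g x‖ₑ ^ s ≤ ∫⁻ x in O, ‖g x‖ₑ ^ s := by
  set φ := (stdBump n j).normed (volume : Measure (EuclideanSpace ℝ (Fin n))) with hφ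
  have hφc : Continuous φ := (stdBump n j).continuous_normed
  set ν : Measure (EuclideanSpace ℝ (Fin n)) := volume.withDensity fun t => ‖φ t‖ₑ with hν
  have hνp : IsProbabilityMeasure ν := by
    refine ⟨?_⟩
    rw [hν, withDensity_apply _ MeasurableSet.univ, setLIntegral_univ]
    have h1 : ∀ t, ‖φ t‖ₑ = ENNReal.ofReal (φ t) := fun t =>
      Real.enorm_eq_ofReal ((stdBump n j).nonneg_normed t)
    simp only [h1]
    rw [← ofReal_integral_eq_lintegral_ofReal (stdBump n j).integrable_normed
      (Filter.Eventually.of_forall (stdBump n j).nonneg_normed), (stdBump n j).integral_normed]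
    simp
  have hac : ν ≪ volume := withDensity_absolutelyContinuous _ _
  have hs0 : 0 < s := by linarith
  have hmeas : AEMeasurable (O.indicator fun x => ‖g x‖ₑ ^ s) :=
    (hg.enorm.pow_const s).indicator hO
  have hprod : AEMeasurable (fun z : EuclideanSpace ℝ (Fin n) × EuclideanSpace ℝ (Fin n) =>
      (O.indicator fun x => ‖g x‖ₑ ^ s) (z.1 - z.2)) (volume.prod ν) := by
    refine hmeas.comp_quasiMeasurePreserving ?_
    exact (quasiMeasurePreserving_sub_of_right_invariant volume volume).mono
      (Measure.AbsolutelyContinuous.rfl.prod hac) Measure.AbsolutelyContinuous.rfl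
  calc ∫⁻ x in K, ‖mollify j g x‖ₑ ^ s
      ≤ ∫⁻ x in K, ∫⁻ t, (O.indicator fun x => ‖g x‖ₑ ^ s) (x - t) ∂ν := by
        refine setLIntegral_mono' hK fun x hx => ?_
        have hgx : AEStronglyMeasurable (fun t => g (x - t)) :=
          hg.comp_quasiMeasurePreserving (Measure.measurePreserving_sub_left volume x).quasiMeasurePreserving
        calc ‖mollify j g x‖ₑ ^ s ≤ (∫⁻ t, ‖g (x - t)‖ₑ ∂ν) ^ s := by
              refine ENNReal.rpow_le_rpow ?_ hs0.le
              rw [mollify_apply, hν, lintegral_withDensity_eq_lintegral_mul₀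
                hφc.enorm.measurable.aemeasurable hgx.enorm]
              refine (enorm_integral_le_lintegral_enorm _).trans (le_of_eq ?_)
              simp only [enorm_smul, hφ, Pi.mul_apply]
          _ ≤ ∫⁻ t, ‖g (x - t)‖ₑ ^ s ∂ν :=
              lintegral_rpow_le_of_isProbabilityMeasure (hgx.enorm.mono_ac hac) hs
          _ ≤ _ := by
              refine lintegral_mono_ae ?_
              rw [hν, ae_withDensity_iff hφc.enorm.measurable]
              refine Filter.Eventually.of_forall fun t ht => ?_
              have ht1 : t ∈ Function.support φ := fun h0 => ht (by rw [h0]; simp)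
              rw [hφ, (stdBump n j).support_normed_eq] at ht1
              rw [indicator_of_mem]
              refine hKO x hx ?_
              simpa [stdBump, dist_eq_norm] using ht1
    _ ≤ ∫⁻ x, ∫⁻ t, (O.indicator fun x => ‖g x‖ₑ ^ s) (x - t) ∂ν := setLIntegral_le_lintegral _ _
    _ = ∫⁻ t, (∫⁻ x, (O.indicator fun x => ‖g x‖ₑ ^ s) (x - t)) ∂ν :=
        lintegral_lintegral_swap hprod
    _ = ∫⁻ t, (∫⁻ x, (O.indicator fun x => ‖g x‖ₑ ^ s) x) ∂ν := by
        congr 1; ext t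
        exact lintegral_sub_right_eq_self _ t
    _ = ∫⁻ x in O, ‖g x‖ₑ ^ s := by
        rw [lintegral_const, measure_univ, mul_one, lintegral_indicator hO]

lemma tendsto_lintegral_enorm_sub_of_le {α : Type*} [MeasurableSpace α] {ν : Measure α}
    {F : Type*} [NormedAddCommGroup F]
    {f : ℕ → α → F} {g : α → F} (hf : ∀ j, AEStronglyMeasurable (f j) ν) (hg : Integrable g ν)
    (hlim : ∀ᵐ x ∂ν, Filter.Tendsto (fun j => f j x) Filter.atTop (𝓝 (g x)))
    (hle : ∀ j, ∫⁻ x, ‖f j x‖ₑ ∂ν ≤ ∫⁻ x, ‖g x‖ₑ ∂ν) :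
    Filter.Tendsto (fun j => ∫⁻ x, ‖f j x - g x‖ₑ ∂ν) Filter.atTop (𝓝 0) := by
  set I := ∫⁻ x, ‖g x‖ₑ ∂ν with hI
  have hIfin : I ≠ ∞ := hg.2.ne
  have hfatou : ∫⁻ x, 2 * ‖g x‖ₑ ∂ν ≤ Filter.liminf (fun j =>
      ∫⁻ x, ((‖f j x‖ₑ + ‖g x‖ₑ) - ‖f j x - g x‖ₑ) ∂ν) Filter.atTop := by
    refine le_trans ?_ (lintegral_liminf_le' fun j =>
      (((hf j).enorm.add hg.1.enorm).sub ((hf j).sub hg.1).enorm))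
    refine lintegral_mono_ae (hlim.mono fun x hx => le_of_eq ?_)
    have h1 : Filter.Tendsto (fun j => (‖f j x‖ₑ + ‖g x‖ₑ) - ‖f j x - g x‖ₑ) Filter.atTop
        (𝓝 ((‖g x‖ₑ + ‖g x‖ₑ) - ‖g x - g x‖ₑ)) :=
      ENNReal.Tendsto.sub (hx.enorm.add tendsto_const_nhds) (hx.sub_const _).enorm
        (Or.inl (by simp))
    rw [h1.liminf_eq]
    simp [two_mul]
  rw [lintegral_const_mul'' _ hg.1.enorm] at hfatou
  have hd : ∀ j, ∫⁻ x, ‖f j x - g x‖ₑ ∂ν ≤ 2 * I := fun j => by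
    calc ∫⁻ x, ‖f j x - g x‖ₑ ∂ν ≤ ∫⁻ x, (‖f j x‖ₑ + ‖g x‖ₑ) ∂ν :=
          lintegral_mono fun x => enorm_sub_le
      _ = ∫⁻ x, ‖f j x‖ₑ ∂ν + I := lintegral_add_left' (hf j).enorm _
      _ ≤ 2 * I := by rw [two_mul]; gcongr; exact hle j
  have hle2 : ∀ j, ∫⁻ x, ((‖f j x‖ₑ + ‖g x‖ₑ) - ‖f j x - g x‖ₑ) ∂ν ≤
      2 * I - ∫⁻ x, ‖f j x - g x‖ₑ ∂ν := fun j => by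
    have hm : AEMeasurable (fun x => ‖f j x - g x‖ₑ) ν := ((hf j).sub hg.1).enorm
    rw [lintegral_sub' hm (ne_top_of_le_ne_top (by finiteness) (hd j))
      (Filter.Eventually.of_forall fun x => enorm_sub_le)]
    refine tsub_le_tsub_right ?_ _
    rw [lintegral_add_left' (hf j).enorm, two_mul]
    gcongr; exact hle j
  rw [ENNReal.tendsto_atTop_zero]
  intro ε hε
  by_contra hcon
  push Not at hcon
  have h2I : 2 * I ≠ ∞ := by finiteness
  have hfreq : ∃ᶠ j in Filter.atTop, ε < ∫⁻ x, ‖f j x - g x‖ₑ ∂ν :=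
    Filter.frequently_atTop.2 fun N => hcon N
  have h3 : Filter.liminf (fun j =>
      ∫⁻ x, ((‖f j x‖ₑ + ‖g x‖ₑ) - ‖f j x - g x‖ₑ) ∂ν) Filter.atTop ≤ 2 * I - ε :=
    Filter.liminf_le_of_frequently_le' (hfreq.mono fun j hj =>
      (hle2 j).trans (tsub_le_tsub_left hj.le _))
  have h4 : 2 * I ≤ 2 * I - ε := hfatou.trans h3
  obtain ⟨j, hj⟩ := hfreq.exists
  have h5 : ε ≤ 2 * I := hj.le.trans (hd j)
  have h6 : 2 * I - ε < 2 * I := ENNReal.sub_lt_self h2I (hε.trans_le h5).ne' hε.ne'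
  exact absurd h4 (not_le.2 h6)

lemma tendsto_lintegral_mollify_sub [CompleteSpace F] {g : EuclideanSpace ℝ (Fin n) → F}
    (hg : Integrable g) :
    Filter.Tendsto (fun j => ∫⁻ x, ‖mollify j g x - g x‖ₑ) Filter.atTop (𝓝 0) := by
  refine tendsto_lintegral_enorm_sub_of_le
    (fun j => (contDiff_mollify j hg.locallyIntegrable).continuous.aestronglyMeasurable) hg
    (ae_tendsto_mollify hg.locallyIntegrable) fun j => ?_
  simpa using setLIntegral_enorm_mollify_rpow_le (j := j) hg.1 le_rfl MeasurableSet.univ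
    MeasurableSet.univ fun x _ => subset_univ _

end mollify

/-! ### Weak gradients -/

lemma eq_innerSL_of_forall_single {n : ℕ} {T : EuclideanSpace ℝ (Fin n) →L[ℝ] ℝ}
    {a : EuclideanSpace ℝ (Fin n)} (h : ∀ i, T (EuclideanSpace.single i 1) = a i) :
    T = innerSL ℝ a := by
  refine ContinuousLinearMap.coe_injective
    ((EuclideanSpace.basisFun (Fin n) ℝ).toBasis.ext fun i => ?_)
  simp [h i, EuclideanSpace.inner_single_right]

lemma IsWeakGradOn.mono {n : ℕ} {Ω O : Set (EuclideanSpace ℝ (Fin n))}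
    {u : EuclideanSpace ℝ (Fin n) → ℝ} {du : EuclideanSpace ℝ (Fin n) → EuclideanSpace ℝ (Fin n)}
    (h : IsWeakGradOn n Ω u du) (hO : O ⊆ Ω) : IsWeakGradOn n O u du := by
  intro φ hφ hc hs i
  have h1 := h φ hφ hc (hs.trans hO) i
  have key : ∀ (S : Set (EuclideanSpace ℝ (Fin n))) (_ : tsupport φ ⊆ S)
      (F : EuclideanSpace ℝ (Fin n) → ℝ), (∀ x, x ∉ tsupport φ → F x = 0) →
      ∫ x in S, F x = ∫ x, F x := fun S hS F hF =>
    setIntegral_eq_integral_of_forall_compl_eq_zero fun x hx => hF x fun hx' => hx (hS hx')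
  have z1 : ∀ x, x ∉ tsupport φ → u x * fderiv ℝ φ x (EuclideanSpace.single i (1 : ℝ)) = 0 := by
    intro x hx
    have : fderiv ℝ φ x = 0 := image_eq_zero_of_notMem_tsupport
      (fun h' => hx (tsupport_fderiv_subset ℝ h'))
    simp [this]
  have z2 : ∀ x, x ∉ tsupport φ → du x i * φ x = 0 := fun x hx => by
    simp [image_eq_zero_of_notMem_tsupport hx]
  rw [key O hs _ z1, key O hs _ z2]
  rwa [key Ω (hs.trans hO) _ z1, key Ω (hs.trans hO) _ z2] at h1

lemma IsWeakGradOn.congr_ae {n : ℕ} {O : Set (EuclideanSpace ℝ (Fin n))}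
    {u v : EuclideanSpace ℝ (Fin n) → ℝ}
    {du dv : EuclideanSpace ℝ (Fin n) → EuclideanSpace ℝ (Fin n)}
    (h : IsWeakGradOn n O u du) (huv : ∀ᵐ x ∂volume.restrict O, u x = v x)
    (hduv : ∀ᵐ x ∂volume.restrict O, du x = dv x) : IsWeakGradOn n O v dv := by
  intro φ hφ hc hs i
  have e1 : ∫ x in O, u x * fderiv ℝ φ x (EuclideanSpace.single i (1 : ℝ)) =
      ∫ x in O, v x * fderiv ℝ φ x (EuclideanSpace.single i (1 : ℝ)) :=
    integral_congr_ae (huv.mono fun x hx => by simp only [hx])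
  have e2 : ∫ x in O, du x i * φ x = ∫ x in O, dv x i * φ x :=
    integral_congr_ae (hduv.mono fun x hx => by simp only [hx])
  rw [← e1, ← e2]
  exact h φ hφ hc hs i

lemma IsWeakGradOn.hasFDerivAt_mollify {n : ℕ} {O : Set (EuclideanSpace ℝ (Fin n))}
    {w : EuclideanSpace ℝ (Fin n) → ℝ} {dw : EuclideanSpace ℝ (Fin n) → EuclideanSpace ℝ (Fin n)}
    (hO : MeasurableSet O) (h : IsWeakGradOn n O w dw) (hw : IntegrableOn w O)
    (hdw : IntegrableOn dw O) {j : ℕ} {x : EuclideanSpace ℝ (Fin n)}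
    (hx : closedBall x (1 / ((j : ℝ) + 1)) ⊆ O) :
    HasFDerivAt (mollify j (O.indicator w)) (innerSL ℝ (mollify j (O.indicator dw) x)) x := by
  set φ := (stdBump n j).normed (volume : Measure (EuclideanSpace ℝ (Fin n))) with hφ
  have hφd : ContDiff ℝ (⊤ : ℕ∞) φ := (stdBump n j).contDiff_normed
  have hφs : HasCompactSupport φ := (stdBump n j).hasCompactSupport_normed
  have hwi : Integrable (O.indicator w) := (integrable_indicator_iff hO).2 hw
  have hdwi : Integrable (O.indicator dw) := (integrable_indicator_iff hO).2 hdw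
  have hd := hφs.hasFDerivAt_convolution_left (ContinuousLinearMap.lsmul ℝ ℝ)
    (hφd.of_le (by exact_mod_cast le_top)) hwi.locallyIntegrable x
  refine hd.congr_fderiv (eq_innerSL_of_forall_single fun i => ?_)
  have hint : Integrable (fun t => ((ContinuousLinearMap.lsmul ℝ ℝ).precompL
      (EuclideanSpace ℝ (Fin n))) (fderiv ℝ φ (x - t)) (O.indicator w t)) := by
    have := (hφs.fderiv ℝ).convolutionExists_left
      ((ContinuousLinearMap.lsmul ℝ ℝ : ℝ →L[ℝ] ℝ →L[ℝ] ℝ).precompL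
      (EuclideanSpace ℝ (Fin n))) ((hφd.continuous_fderiv (by simp))) hwi.locallyIntegrable x
    exact this.integrable_swap
  rw [convolution_eq_swap, ContinuousLinearMap.integral_apply hint]
  have htest := h (fun t => φ (x - t)) (hφd.comp (contDiff_const.sub contDiff_id))
    (hφs.comp_homeomorph (Homeomorph.subLeft x)) ?_ i
  · have hfd : ∀ t, fderiv ℝ (fun t => φ (x - t)) t (EuclideanSpace.single i (1 : ℝ)) =
        - fderiv ℝ φ (x - t) (EuclideanSpace.single i (1 : ℝ)) := by
      intro t
      have h1 : HasFDerivAt φ (fderiv ℝ φ (x - t)) (x - t) :=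
        (hφd.differentiable (by simp) _).hasFDerivAt
      have h2 : HasFDerivAt (fun t => x - t)
          (-(ContinuousLinearMap.id ℝ (EuclideanSpace ℝ (Fin n)))) t :=
        (hasFDerivAt_id t).const_sub x
      have := (h1.comp t h2).fderiv
      simp only [Function.comp_def] at this
      rw [this]; simp
    simp only [hfd, mul_neg, integral_neg, neg_inj] at htest
    have e1 : ∫ t, ((ContinuousLinearMap.lsmul ℝ ℝ).precompL
        (EuclideanSpace ℝ (Fin n))) (fderiv ℝ φ (x - t)) (O.indicator w t)
          (EuclideanSpace.single i (1 : ℝ)) =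
        ∫ t in O, w t * fderiv ℝ φ (x - t) (EuclideanSpace.single i (1 : ℝ)) := by
      rw [← integral_indicator hO]
      congr 1; ext t
      by_cases ht : t ∈ O <;> simp [ht, ContinuousLinearMap.precompL, mul_comm]
    have e2 : mollify j (O.indicator dw) x i = ∫ t in O, dw t i * φ (x - t) := by
      have hci : Integrable (fun t => φ (x - t) • O.indicator dw t) := by
        have := hφs.convolutionExists_left (ContinuousLinearMap.lsmul ℝ ℝ) hφd.continuous
          hdwi.locallyIntegrable x
        exact this.integrable_swap
      have := (EuclideanSpace.proj (𝕜 := ℝ) i : EuclideanSpace ℝ (Fin n) →L[ℝ] ℝ).integral_comp_comm hci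
      rw [mollify_apply_swap, ← integral_indicator hO]
      refine this.symm.trans ?_
      congr 1; ext t
      by_cases ht : t ∈ O <;> simp [ht, mul_comm, hφ]
    rw [e1, e2, htest]
  · refine Subset.trans ?_ hx
    refine closure_minimal ?_ isClosed_closedBall
    intro t ht
    have ht1 : x - t ∈ Function.support φ := ht
    rw [hφ, (stdBump n j).support_normed_eq] at ht1
    simp only [stdBump, mem_ball, dist_zero_right] at ht1
    rw [mem_closedBall, dist_comm, dist_eq_norm]
    exact ht1.le

/-! ### Smooth approximation of weakly differentiable functions -/

/-- `v j` are smooth functions with gradients `dv j` on `K` that approximate `(w, dw)` on `K`. -/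
structure SmoothApprox {n : ℕ} (K O : Set (EuclideanSpace ℝ (Fin n)))
    (w : EuclideanSpace ℝ (Fin n) → ℝ) (dw : EuclideanSpace ℝ (Fin n) → EuclideanSpace ℝ (Fin n))
    (v : ℕ → EuclideanSpace ℝ (Fin n) → ℝ)
    (dv : ℕ → EuclideanSpace ℝ (Fin n) → EuclideanSpace ℝ (Fin n)) : Prop where
  contDiff : ∀ j, ContDiff ℝ (⊤ : ℕ∞) (v j)
  continuous : ∀ j, Continuous (dv j)
  hasFDerivAt : ∀ j, ∀ x ∈ K, HasFDerivAt (v j) (innerSL ℝ (dv j x)) x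
  ae_tendsto : ∀ᵐ x ∂volume.restrict K, Filter.Tendsto (fun j => v j x) Filter.atTop (𝓝 (w x))
  ae_tendsto_grad : ∀ᵐ x ∂volume.restrict K,
    Filter.Tendsto (fun j => dv j x) Filter.atTop (𝓝 (dw x))
  tendsto_lintegral : Filter.Tendsto (fun j => ∫⁻ x in K, ‖v j x - w x‖ₑ) Filter.atTop (𝓝 0)
  tendsto_lintegral_grad :
    Filter.Tendsto (fun j => ∫⁻ x in K, ‖dv j x - dw x‖ₑ) Filter.atTop (𝓝 0)
  lintegral_le : ∀ j, ∀ s : ℝ, 1 ≤ s → ∫⁻ x in K, ‖v j x‖ₑ ^ s ≤ ∫⁻ x in O, ‖w x‖ₑ ^ s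
  lintegral_grad_le : ∀ j, ∀ s : ℝ, 1 ≤ s → ∫⁻ x in K, ‖dv j x‖ₑ ^ s ≤ ∫⁻ x in O, ‖dw x‖ₑ ^ s

section weakGrad

variable {n : ℕ} {K O : Set (EuclideanSpace ℝ (Fin n))}
  {w : EuclideanSpace ℝ (Fin n) → ℝ} {dw : EuclideanSpace ℝ (Fin n) → EuclideanSpace ℝ (Fin n)}

lemma exists_forall_closedBall_subset (hK : IsCompact K) (hO : IsOpen O) (hKO : K ⊆ O) :
    ∃ J : ℕ, ∀ j ≥ J, ∀ x ∈ K, closedBall x (1 / ((j : ℝ) + 1)) ⊆ O := by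
  obtain ⟨δ, hδ, hδO⟩ := hK.exists_cthickening_subset_open hO hKO
  have := (tendsto_one_div_add_atTop_nhds_zero_nat (𝕜 := ℝ)).eventually (gt_mem_nhds hδ)
  obtain ⟨J, hJ⟩ := Filter.eventually_atTop.1 this
  exact ⟨J, fun j hj x hx => (closedBall_subset_closedBall (hJ j hj).le).trans
    ((closedBall_subset_cthickening hx δ).trans hδO)⟩

lemma IsWeakGradOn.exists_smoothApprox (h : IsWeakGradOn n O w dw) (hK : IsCompact K)
    (hO : IsOpen O) (hKO : K ⊆ O) (hw : IntegrableOn w O) (hdw : IntegrableOn dw O) :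
    ∃ v dv, SmoothApprox K O w dw v dv := by
  obtain ⟨J, hJ⟩ := exists_forall_closedBall_subset hK hO hKO
  have hOm := hO.measurableSet
  have hKm := hK.measurableSet
  have hwi : Integrable (O.indicator w) := (integrable_indicator_iff hOm).2 hw
  have hdwi : Integrable (O.indicator dw) := (integrable_indicator_iff hOm).2 hdw
  have hJ' : ∀ j, ∀ x ∈ K, closedBall x (1 / (((j + J : ℕ) : ℝ) + 1)) ⊆ O :=
    fun j => hJ (j + J) (by omega)
  have hind : ∀ {F : Type} [NormedAddCommGroup F] (g : EuclideanSpace ℝ (Fin n) → F) (s : ℝ),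
      ∫⁻ x in O, ‖O.indicator g x‖ₑ ^ s = ∫⁻ x in O, ‖g x‖ₑ ^ s := fun g s =>
    setLIntegral_congr_fun hOm fun x hx => by simp only [indicator_of_mem hx]
  refine ⟨fun j => mollify (j + J) (O.indicator w), fun j => mollify (j + J) (O.indicator dw),
    fun j => contDiff_mollify _ hwi.locallyIntegrable,
    fun j => (contDiff_mollify _ hdwi.locallyIntegrable).continuous,
    fun j x hx => h.hasFDerivAt_mollify hOm hw hdw (hJ' j x hx), ?_, ?_, ?_, ?_, ?_, ?_⟩
  · rw [ae_restrict_iff' hKm]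
    filter_upwards [ae_tendsto_mollify hwi.locallyIntegrable] with x hx hxK
    rw [indicator_of_mem (hKO hxK)] at hx
    exact hx.comp (Filter.tendsto_add_atTop_nat J)
  · rw [ae_restrict_iff' hKm]
    filter_upwards [ae_tendsto_mollify hdwi.locallyIntegrable] with x hx hxK
    rw [indicator_of_mem (hKO hxK)] at hx
    exact hx.comp (Filter.tendsto_add_atTop_nat J)
  · refine tendsto_of_tendsto_of_tendsto_of_le_of_le tendsto_const_nhds
      ((tendsto_lintegral_mollify_sub hwi).comp (Filter.tendsto_add_atTop_nat J))
      (fun j => zero_le) fun j => ?_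
    refine le_trans (le_of_eq (setLIntegral_congr_fun hKm fun x hx => ?_))
      (setLIntegral_le_lintegral K _)
    simp only [indicator_of_mem (hKO hx)]
  · refine tendsto_of_tendsto_of_tendsto_of_le_of_le tendsto_const_nhds
      ((tendsto_lintegral_mollify_sub hdwi).comp (Filter.tendsto_add_atTop_nat J))
      (fun j => zero_le) fun j => ?_
    refine le_trans (le_of_eq (setLIntegral_congr_fun hKm fun x hx => ?_))
      (setLIntegral_le_lintegral K _)
    simp only [indicator_of_mem (hKO hx)]
  · intro j s hs
    rw [← hind]
    exact setLIntegral_enorm_mollify_rpow_le hwi.1 hs hKm hOm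
      fun x hx => ball_subset_closedBall.trans (hJ' j x hx)
  · intro j s hs
    rw [← hind]
    exact setLIntegral_enorm_mollify_rpow_le hdwi.1 hs hKm hOm
      fun x hx => ball_subset_closedBall.trans (hJ' j x hx)

lemma integral_mul_eq_of_tendsto {α : Type*} [MeasurableSpace α] {ν : Measure α}
    {F a b : α → ℝ} {G : α → EuclideanSpace ℝ (Fin n)} {C : ℝ}
    (ha : AEStronglyMeasurable a ν) (hb : AEStronglyMeasurable b ν)
    (haC : ∀ x, ‖a x‖ ≤ C) (hbC : ∀ x, ‖b x‖ ≤ C) (hF : Integrable F ν) (hG : Integrable G ν)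
    {Fj : ℕ → α → ℝ} {Gj : ℕ → α → EuclideanSpace ℝ (Fin n)}
    (hFj : ∀ j, Integrable (Fj j) ν) (hGj : ∀ j, Integrable (Gj j) ν)
    (hFlim : Filter.Tendsto (fun j => ∫⁻ x, ‖Fj j x - F x‖ₑ ∂ν) Filter.atTop (𝓝 0))
    (hGlim : Filter.Tendsto (fun j => ∫⁻ x, ‖Gj j x - G x‖ₑ ∂ν) Filter.atTop (𝓝 0)) {i : Fin n}
    (h : ∀ j, ∫ x, Fj j x * a x ∂ν = - ∫ x, Gj j x i * b x ∂ν) :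
    ∫ x, F x * a x ∂ν = - ∫ x, G x i * b x ∂ν := by
  have hcoord : ∀ {H : α → EuclideanSpace ℝ (Fin n)}, Integrable H ν →
      Integrable (fun x => H x i) ν := fun hH =>
    (EuclideanSpace.proj (𝕜 := ℝ) i : EuclideanSpace ℝ (Fin n) →L[ℝ] ℝ).integrable_comp hH
  have gen : ∀ {R : α → ℝ} {Rj : ℕ → α → ℝ} {c : α → ℝ}, AEStronglyMeasurable c ν →
      (∀ x, ‖c x‖ ≤ C) → Integrable R ν → (∀ j, Integrable (Rj j) ν) →
      Filter.Tendsto (fun j => ∫⁻ x, ‖Rj j x - R x‖ₑ ∂ν) Filter.atTop (𝓝 0) →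
      Filter.Tendsto (fun j => ∫ x, Rj j x * c x ∂ν) Filter.atTop (𝓝 (∫ x, R x * c x ∂ν)) := by
    intro R Rj c hc hcC hR hRj hlim
    refine tendsto_integral_of_L1 _ (hR.mul_bdd (c := C) hc (Filter.Eventually.of_forall hcC)).1
      (Filter.Eventually.of_forall fun j =>
        (hRj j).mul_bdd (c := C) hc (Filter.Eventually.of_forall hcC)) ?_
    have h2 := ENNReal.Tendsto.const_mul (a := ENNReal.ofReal C) hlim (Or.inr (by simp))
    rw [mul_zero] at h2
    refine tendsto_of_tendsto_of_tendsto_of_le_of_le tendsto_const_nhds h2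
      (fun j => zero_le) fun j => ?_
    have hm : AEMeasurable (fun x => ‖Rj j x - R x‖ₑ) ν := ((hRj j).1.sub hR.1).enorm
    simp only
    rw [← lintegral_const_mul'' _ hm]
    refine lintegral_mono fun x => ?_
    rw [← sub_mul, enorm_mul, mul_comm]
    gcongr
    rw [← ofReal_norm]
    exact ENNReal.ofReal_le_ofReal (hcC x)
  have h1 := gen ha haC hF hFj hFlim
  have h2 := gen (R := fun x => G x i) (Rj := fun j x => Gj j x i) hb hbC (hcoord hG)
    (fun j => hcoord (hGj j)) (by
      refine tendsto_of_tendsto_of_tendsto_of_le_of_le tendsto_const_nhds hGlim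
        (fun j => zero_le) fun j => lintegral_mono fun x => ?_
      have := PiLp.norm_apply_le (Gj j x - G x) i
      rw [enorm_le_iff_norm_le]
      simpa using this)
  exact tendsto_nhds_unique (h1.congr h) h2.neg

/-- `C¹` functions satisfy the integration by parts formula in the definition of weak gradients. -/
lemma integral_mul_fderiv_single_eq {v φ : EuclideanSpace ℝ (Fin n) → ℝ}
    (hv : ContDiff ℝ 1 v) (hφ : ContDiff ℝ 1 φ) (hc : HasCompactSupport φ)
    (i : Fin n) : ∫ x, v x * fderiv ℝ φ x (EuclideanSpace.single i (1 : ℝ)) =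
      - ∫ x, fderiv ℝ v x (EuclideanSpace.single i (1 : ℝ)) * φ x := by
  have hv1 := hv.continuous_fderiv one_ne_zero
  have hφ1 := hφ.continuous_fderiv one_ne_zero
  refine integral_mul_fderiv_eq_neg_fderiv_mul_of_integrable ?_ ?_ ?_
    (fun x _ => hv.differentiable one_ne_zero x) (fun x _ => hφ.differentiable one_ne_zero x)
  · exact ((hv1.clm_apply continuous_const).mul hφ.continuous).integrable_of_hasCompactSupport
      hc.mul_left
  · exact (hv.continuous.mul (hφ1.clm_apply continuous_const)).integrable_of_hasCompactSupport
      ((hc.fderiv_apply ℝ _).mul_left)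
  · exact (hv.continuous.mul hφ.continuous).integrable_of_hasCompactSupport hc.mul_left

/-- Reduction of an integral identity for a test function to its support. -/
lemma setIntegral_test_eq {φ : EuclideanSpace ℝ (Fin n) → ℝ} (hKO : tsupport φ ⊆ O)
    (w : EuclideanSpace ℝ (Fin n) → ℝ) (dw : EuclideanSpace ℝ (Fin n) → EuclideanSpace ℝ (Fin n))
    (i : Fin n) :
    ((∫ x in O, w x * fderiv ℝ φ x (EuclideanSpace.single i (1 : ℝ))) =
      ∫ x in tsupport φ, w x * fderiv ℝ φ x (EuclideanSpace.single i (1 : ℝ))) ∧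
    ((∫ x in O, dw x i * φ x) = ∫ x in tsupport φ, dw x i * φ x) := by
  have key : ∀ (S : Set (EuclideanSpace ℝ (Fin n))) (_ : tsupport φ ⊆ S)
      (F : EuclideanSpace ℝ (Fin n) → ℝ), (∀ x, x ∉ tsupport φ → F x = 0) →
      ∫ x in S, F x = ∫ x, F x := fun S hS F hF =>
    setIntegral_eq_integral_of_forall_compl_eq_zero fun x hx => hF x fun hx' => hx (hS hx')
  have z1 : ∀ x, x ∉ tsupport φ → w x * fderiv ℝ φ x (EuclideanSpace.single i (1 : ℝ)) = 0 := by
    intro x hx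
    have : fderiv ℝ φ x = 0 := image_eq_zero_of_notMem_tsupport
      (fun h' => hx (tsupport_fderiv_subset ℝ h'))
    simp [this]
  have z2 : ∀ x, x ∉ tsupport φ → dw x i * φ x = 0 := fun x hx => by
    simp [image_eq_zero_of_notMem_tsupport hx]
  exact ⟨(key O hKO _ z1).trans (key _ subset_rfl _ z1).symm,
    (key O hKO _ z2).trans (key _ subset_rfl _ z2).symm⟩

/-- Chain rule for `C¹` functions with bounded derivative. -/
lemma IsWeakGradOn.comp_contDiff (h : IsWeakGradOn n O w dw) (hO : IsOpen O)
    (hw : IntegrableOn w O) (hdw : IntegrableOn dw O) {H : ℝ → ℝ} (hH : ContDiff ℝ 1 H)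
    (hH0 : H 0 = 0) (hH1 : ∀ t, ‖deriv H t‖ ≤ 1) :
    IsWeakGradOn n O (fun x => H (w x)) (fun x => deriv H (w x) • dw x) := by
  intro φ hφ hc hs i
  have hKm := hc.isCompact.measurableSet
  obtain ⟨v, dv, A⟩ := h.exists_smoothApprox hc.isCompact hO hs hw hdw
  have hLip : ∀ s t, ‖H s - H t‖ ≤ ‖s - t‖ := fun s t => by
    have := Convex.norm_image_sub_le_of_norm_deriv_le (f := H) (s := univ) (C := 1) (x := t)
      (y := s) (fun x _ => hH.differentiable one_ne_zero x) (fun x _ => hH1 x) convex_univ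
      (mem_univ _) (mem_univ _)
    simpa using this
  have hHd : Continuous (deriv H) := hH.continuous_deriv le_rfl
  have hwK : IntegrableOn w (tsupport φ) := hw.mono_set hs
  have hdwK : IntegrableOn dw (tsupport φ) := hdw.mono_set hs
  have hφ1 : ContDiff ℝ 1 φ := hφ.of_le (by exact_mod_cast le_top)
  have hdφ : Continuous fun x => fderiv ℝ φ x (EuclideanSpace.single i (1 : ℝ)) :=
    (hφ1.continuous_fderiv one_ne_zero).clm_apply continuous_const
  obtain ⟨C1, hC1⟩ := hc.exists_bound_of_continuous hφ.continuous
  obtain ⟨C2, hC2⟩ := (hc.fderiv_apply ℝ (EuclideanSpace.single i (1 : ℝ))).exists_bound_of_continuous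
    hdφ
  rw [(setIntegral_test_eq hs (fun x => H (w x)) dw i).1,
    (setIntegral_test_eq hs w (fun x => deriv H (w x) • dw x) i).2]
  have hv1 : ∀ j, ContDiff ℝ 1 (v j) := fun j => (A.contDiff j).of_le (by exact_mod_cast le_top)
  have hmH : AEStronglyMeasurable (fun x => deriv H (w x)) (volume.restrict (tsupport φ)) :=
    hHd.comp_aestronglyMeasurable hwK.1
  have hbd : ∀ {μ : Measure (EuclideanSpace ℝ (Fin n))} {z : EuclideanSpace ℝ (Fin n) → ℝ}
      {dz : EuclideanSpace ℝ (Fin n) → EuclideanSpace ℝ (Fin n)},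
      AEStronglyMeasurable z μ → Integrable dz μ →
      Integrable (fun x => deriv H (z x) • dz x) μ := fun hz hdz =>
    hdz.bdd_smul 1 (hHd.comp_aestronglyMeasurable hz)
      (Filter.Eventually.of_forall fun x => hH1 _)
  refine integral_mul_eq_of_tendsto (C := max C1 C2) hdφ.aestronglyMeasurable
    hφ.continuous.aestronglyMeasurable
    (fun x => (hC2 x).trans (le_max_right _ _)) (fun x => (hC1 x).trans (le_max_left _ _))
    (Fj := fun j x => H (v j x)) (Gj := fun j x => deriv H (v j x) • dv j x)
    ?_ (hbd hwK.1 hdwK) ?_ ?_ ?_ ?_ ?_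
  · refine Integrable.mono hwK (hH.continuous.comp_aestronglyMeasurable hwK.1)
      (Filter.Eventually.of_forall fun x => ?_)
    simpa [hH0] using hLip (w x) 0
  · exact fun j => (hH.continuous.comp (hv1 j).continuous).continuousOn.integrableOn_compact
      hc.isCompact
  · exact fun j => hbd (hv1 j).continuous.aestronglyMeasurable
      ((A.continuous j).continuousOn.integrableOn_compact hc.isCompact)
  · refine tendsto_of_tendsto_of_tendsto_of_le_of_le tendsto_const_nhds A.tendsto_lintegral
      (fun j => zero_le) fun j => lintegral_mono fun x => ?_
    rw [enorm_le_iff_norm_le]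
    exact hLip _ _
  · have hdct : Filter.Tendsto (fun j => ∫⁻ x in tsupport φ,
        ‖(deriv H (v j x) - deriv H (w x)) • dw x‖ₑ) Filter.atTop (𝓝 0) := by
      have := tendsto_lintegral_of_dominated_convergence' (μ := volume.restrict (tsupport φ))
        (F := fun j x => ‖(deriv H (v j x) - deriv H (w x)) • dw x‖ₑ) (f := fun _ => 0)
        (fun x => 2 * ‖dw x‖ₑ)
        (fun j => (((hHd.comp (hv1 j).continuous).aestronglyMeasurable.sub hmH).smul
          hdwK.1).enorm)
        (fun j => Filter.Eventually.of_forall fun x => ?_) ?_ ?_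
      · simpa using this
      · simp only
        rw [enorm_smul]
        gcongr
        calc ‖deriv H (v j x) - deriv H (w x)‖ₑ ≤ ‖deriv H (v j x)‖ₑ + ‖deriv H (w x)‖ₑ :=
              enorm_sub_le
          _ ≤ 1 + 1 := by
              gcongr <;> · rw [← ofReal_norm]; exact ENNReal.ofReal_le_one.2 (hH1 _)
          _ = 2 := by norm_num
      · rw [lintegral_const_mul'' _ hdwK.1.enorm]
        exact ENNReal.mul_ne_top (by simp) hdwK.2.ne
      · filter_upwards [A.ae_tendsto] with x hx
        have h1 := (((hHd.tendsto (w x)).comp hx).sub_const (deriv H (w x))).smul_const (dw x)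
        simpa using h1.enorm
    have hsum := A.tendsto_lintegral_grad.add hdct
    rw [add_zero] at hsum
    refine tendsto_of_tendsto_of_tendsto_of_le_of_le tendsto_const_nhds hsum
      (fun j => zero_le) fun j => ?_
    have hm : AEMeasurable (fun x => ‖dv j x - dw x‖ₑ) (volume.restrict (tsupport φ)) :=
      ((A.continuous j).aestronglyMeasurable.sub hdwK.1).enorm
    simp only
    rw [← lintegral_add_left' hm]
    refine lintegral_mono fun x => ?_
    have e : deriv H (v j x) • dv j x - deriv H (w x) • dw x =
        deriv H (v j x) • (dv j x - dw x) + (deriv H (v j x) - deriv H (w x)) • dw x := by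
      rw [smul_sub, sub_smul]; abel
    rw [e]
    refine (enorm_add_le _ _).trans ?_
    gcongr
    rw [enorm_smul]
    refine mul_le_of_le_one_left zero_le ?_
    rw [← ofReal_norm]; exact ENNReal.ofReal_le_one.2 (hH1 _)
  · intro j
    have h1 := integral_mul_fderiv_single_eq (hH.comp (hv1 j)) hφ1 hc i
    have e1 := (setIntegral_test_eq (O := univ) (subset_univ (tsupport φ))
      (fun x => H (v j x)) dw i).1
    rw [setIntegral_univ] at e1
    rw [← e1]
    refine h1.trans ?_
    congr 1
    rw [← setIntegral_eq_integral_of_forall_compl_eq_zero (s := tsupport φ)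
      (fun x hx => by simp [image_eq_zero_of_notMem_tsupport hx])]
    refine setIntegral_congr_fun hKm fun x hx => ?_
    have h3 := ((hH.differentiable one_ne_zero (v j x)).hasDerivAt.comp_hasFDerivAt x
      (A.hasFDerivAt j x hx)).fderiv
    simp only [h3]
    simp [EuclideanSpace.inner_single_right]

end weakGrad
/-- A `C¹` approximation of `t ↦ (t - k)₊`. -/
def smoothPos (k : ℝ) (j : ℕ) (t : ℝ) : ℝ :=
  ∫ s in k..t, Real.smoothTransition (((j : ℝ) + 1) * (s - k))

lemma continuous_smoothPos_integrand (k : ℝ) (j : ℕ) :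
    Continuous fun s : ℝ => Real.smoothTransition (((j : ℝ) + 1) * (s - k)) :=
  Real.smoothTransition.continuous.comp (by fun_prop)

lemma deriv_smoothPos (k : ℝ) (j : ℕ) (t : ℝ) :
    deriv (smoothPos k j) t = Real.smoothTransition (((j : ℝ) + 1) * (t - k)) :=
  (continuous_smoothPos_integrand k j).deriv_integral _ k t

lemma contDiff_smoothPos (k : ℝ) (j : ℕ) : ContDiff ℝ 1 (smoothPos k j) := by
  rw [contDiff_one_iff_deriv]
  refine ⟨fun t => ((continuous_smoothPos_integrand k j).integral_hasStrictDerivAt k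
    t).hasDerivAt.differentiableAt, ?_⟩
  rw [funext (deriv_smoothPos k j)]
  exact continuous_smoothPos_integrand k j

lemma norm_deriv_smoothPos_le (k : ℝ) (j : ℕ) (t : ℝ) : ‖deriv (smoothPos k j) t‖ ≤ 1 := by
  rw [deriv_smoothPos, Real.norm_of_nonneg (Real.smoothTransition.nonneg _)]
  exact Real.smoothTransition.le_one _

lemma smoothPos_of_le {k t : ℝ} (j : ℕ) (h : t ≤ k) : smoothPos k j t = 0 := by
  rw [smoothPos, intervalIntegral.integral_symm, neg_eq_zero]
  refine intervalIntegral.integral_zero_ae (Filter.Eventually.of_forall fun s hs => ?_)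
  rw [uIoc_of_le h] at hs
  exact Real.smoothTransition.zero_of_nonpos
    (mul_nonpos_of_nonneg_of_nonpos (by positivity) (by linarith [hs.2]))

lemma tendsto_deriv_smoothPos {k t : ℝ} (h : k < t) :
    Filter.Tendsto (fun j => deriv (smoothPos k j) t) Filter.atTop (𝓝 1) := by
  refine tendsto_const_nhds.congr' ?_
  obtain ⟨N, hN⟩ := exists_nat_gt (1 / (t - k))
  filter_upwards [Filter.eventually_ge_atTop N] with j hj
  have h1 : 0 < t - k := by linarith
  rw [deriv_smoothPos, Real.smoothTransition.one_of_one_le]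
  have h2 : (N : ℝ) ≤ j := by exact_mod_cast hj
  rw [div_lt_iff₀ h1] at hN
  nlinarith

lemma tendsto_smoothPos (k t : ℝ) :
    Filter.Tendsto (fun j => smoothPos k j t) Filter.atTop (𝓝 (max (t - k) 0)) := by
  rcases le_or_gt t k with h | h
  · rw [max_eq_right (by linarith)]
    exact tendsto_const_nhds.congr fun j => (smoothPos_of_le j h).symm
  · have := intervalIntegral.tendsto_integral_filter_of_dominated_convergence (μ := volume)
      (a := k) (b := t) (l := Filter.atTop)
      (F := fun (j : ℕ) s => Real.smoothTransition (((j : ℝ) + 1) * (s - k))) (f := fun _ => 1)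
      (fun _ => 1)
      (Filter.Eventually.of_forall fun j =>
        (continuous_smoothPos_integrand k j).aestronglyMeasurable)
      (Filter.Eventually.of_forall fun j => Filter.Eventually.of_forall fun s _ => by
        rw [Real.norm_of_nonneg (Real.smoothTransition.nonneg _)]
        exact Real.smoothTransition.le_one _) (by simp)
      (Filter.Eventually.of_forall fun s hs => by
        rw [uIoc_of_le h.le] at hs
        exact (tendsto_deriv_smoothPos hs.1).congr fun j => deriv_smoothPos k j s)
    rw [max_eq_left (by linarith)]
    simpa [smoothPos] using this

lemma norm_smoothPos_le {k : ℝ} (hk : 0 ≤ k) (j : ℕ) (t : ℝ) : ‖smoothPos k j t‖ ≤ ‖t‖ := by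
  have := Convex.norm_image_sub_le_of_norm_deriv_le (f := smoothPos k j) (s := univ) (C := 1)
    (x := 0) (y := t) (fun x _ => (contDiff_smoothPos k j).differentiable one_ne_zero x)
    (fun x _ => norm_deriv_smoothPos_le k j x) convex_univ (mem_univ _) (mem_univ _)
  simpa [smoothPos_of_le j hk] using this

section weakGrad

variable {n : ℕ} {K O : Set (EuclideanSpace ℝ (Fin n))}
  {w : EuclideanSpace ℝ (Fin n) → ℝ} {dw : EuclideanSpace ℝ (Fin n) → EuclideanSpace ℝ (Fin n)}

/-- The weak gradient of the truncation `(w - k)₊`. -/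
lemma IsWeakGradOn.posPart (h : IsWeakGradOn n O w dw) (hO : IsOpen O)
    (hw : IntegrableOn w O) (hdw : IntegrableOn dw O) (hwm : Measurable w) {k : ℝ} (hk : 0 ≤ k) :
    IsWeakGradOn n O (fun x => max (w x - k) 0) ({x | k < w x}.indicator dw) := by
  intro φ hφ hc hs i
  have hset : MeasurableSet {x | k < w x} := measurableSet_lt measurable_const hwm
  have hφ1 : ContDiff ℝ 1 φ := hφ.of_le (by exact_mod_cast le_top)
  have hdφ : Continuous fun x => fderiv ℝ φ x (EuclideanSpace.single i (1 : ℝ)) :=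
    (hφ1.continuous_fderiv one_ne_zero).clm_apply continuous_const
  obtain ⟨C1, hC1⟩ := hc.exists_bound_of_continuous hφ.continuous
  obtain ⟨C2, hC2⟩ := (hc.fderiv_apply ℝ (EuclideanSpace.single i (1 : ℝ))).exists_bound_of_continuous
    hdφ
  have hcont : ∀ j, Continuous (smoothPos k j) := fun j => (contDiff_smoothPos k j).continuous
  have hdcont : ∀ j, Continuous (deriv (smoothPos k j)) := fun j =>
    (contDiff_smoothPos k j).continuous_deriv le_rfl
  have hFj : ∀ j, IntegrableOn (fun x => smoothPos k j (w x)) O := fun j =>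
    Integrable.mono hw ((hcont j).comp_aestronglyMeasurable hw.1)
      (Filter.Eventually.of_forall fun x => norm_smoothPos_le hk j _)
  have hGj : ∀ j, IntegrableOn (fun x => deriv (smoothPos k j) (w x) • dw x) O := fun j =>
    Integrable.bdd_smul hdw 1 ((hdcont j).comp_aestronglyMeasurable hw.1)
      (Filter.Eventually.of_forall fun x => norm_deriv_smoothPos_le k j _)
  have hbound : ∀ t : ℝ, ‖max (t - k) 0‖ ≤ ‖t‖ := fun t => by
    rw [Real.norm_of_nonneg (le_max_right _ _)]
    exact max_le ((sub_le_self _ hk).trans (le_abs_self t)) (norm_nonneg _)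
  have hF : IntegrableOn (fun x => max (w x - k) 0) O := by
    refine Integrable.mono hw ?_ (Filter.Eventually.of_forall fun x => hbound _)
    exact (hwm.sub_const k).max measurable_const |>.aestronglyMeasurable
  have hG : IntegrableOn ({x | k < w x}.indicator dw) O := hdw.indicator hset
  refine integral_mul_eq_of_tendsto (C := max C1 C2) hdφ.aestronglyMeasurable
    hφ.continuous.aestronglyMeasurable
    (fun x => (hC2 x).trans (le_max_right _ _)) (fun x => (hC1 x).trans (le_max_left _ _))
    hF hG hFj hGj ?_ ?_ (fun j => h.comp_contDiff hO hw hdw (contDiff_smoothPos k j)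
      (smoothPos_of_le j hk) (norm_deriv_smoothPos_le k j) φ hφ hc hs i)
  · have := tendsto_lintegral_of_dominated_convergence' (μ := volume.restrict O)
      (F := fun j x => ‖smoothPos k j (w x) - max (w x - k) 0‖ₑ) (f := fun _ => 0)
      (fun x => 2 * ‖w x‖ₑ) (fun j => ((hFj j).1.sub hF.1).enorm)
      (fun j => Filter.Eventually.of_forall fun x => ?_) ?_ ?_
    · simpa using this
    · simp only
      rw [two_mul]
      refine enorm_sub_le.trans ?_
      gcongr <;> rw [enorm_le_iff_norm_le]
      · exact norm_smoothPos_le hk j _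
      · exact hbound _
    · rw [lintegral_const_mul'' _ hw.1.enorm]
      exact ENNReal.mul_ne_top (by simp) hw.2.ne
    · refine Filter.Eventually.of_forall fun x => ?_
      simpa using ((tendsto_smoothPos k (w x)).sub_const (max (w x - k) 0)).enorm
  · have := tendsto_lintegral_of_dominated_convergence' (μ := volume.restrict O)
      (F := fun j x => ‖deriv (smoothPos k j) (w x) • dw x - {x | k < w x}.indicator dw x‖ₑ)
      (f := fun _ => 0)
      (fun x => 2 * ‖dw x‖ₑ) (fun j => ((hGj j).1.sub hG.1).enorm)
      (fun j => Filter.Eventually.of_forall fun x => ?_) ?_ ?_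
    · simpa using this
    · simp only
      rw [two_mul]
      refine enorm_sub_le.trans ?_
      gcongr
      · rw [enorm_smul]
        refine mul_le_of_le_one_left zero_le ?_
        rw [← ofReal_norm]; exact ENNReal.ofReal_le_one.2 (norm_deriv_smoothPos_le k j _)
      · exact enorm_indicator_le_enorm_self _ _
    · rw [lintegral_const_mul'' _ hdw.1.enorm]
      exact ENNReal.mul_ne_top (by simp) hdw.2.ne
    · refine Filter.Eventually.of_forall fun x => ?_
      by_cases hx : k < w x
      · have := (((tendsto_deriv_smoothPos hx).smul_const (dw x)).sub_const (dw x)).enorm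
        simpa [indicator_of_mem (show x ∈ {x | k < w x} from hx)] using this
      · refine tendsto_const_nhds.congr fun j => ?_
        rw [indicator_of_notMem (show x ∉ {x | k < w x} from hx), deriv_smoothPos,
          Real.smoothTransition.zero_of_nonpos]
        · simp
        · exact mul_nonpos_of_nonneg_of_nonpos (by positivity) (by linarith)

/-- The product rule with a Lipschitz cutoff; the result has a weak gradient on every set. -/
lemma IsWeakGradOn.mul_lipschitz (h : IsWeakGradOn n O w dw) (hO : IsOpen O)
    (hw : IntegrableOn w O) (hdw : IntegrableOn dw O) {Θ : EuclideanSpace ℝ (Fin n) → ℝ}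
    {D : ℝ≥0} (hΘ : LipschitzWith D Θ) (hΘ1 : ∀ x, ‖Θ x‖ ≤ 1) (hΘc : HasCompactSupport Θ)
    (hΘO : tsupport Θ ⊆ O) (Ω : Set (EuclideanSpace ℝ (Fin n))) :
    IsWeakGradOn n Ω (fun x => Θ x * w x) (fun x => Θ x • dw x + w x • gradient Θ x) := by
  suffices hu : IsWeakGradOn n univ (fun x => Θ x * w x)
      (fun x => Θ x • dw x + w x • gradient Θ x) from hu.mono (subset_univ _)
  intro φ hφ hc _ i
  have hKm := hΘc.isCompact.measurableSet
  obtain ⟨v, dv, A⟩ := h.exists_smoothApprox hΘc.isCompact hO hΘO hw hdw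
  have hφ1 : ContDiff ℝ 1 φ := hφ.of_le (by exact_mod_cast le_top)
  have hv1 : ∀ j, ContDiff ℝ 1 (v j) := fun j => (A.contDiff j).of_le (by exact_mod_cast le_top)
  have hdφ : Continuous fun x => fderiv ℝ φ x (EuclideanSpace.single i (1 : ℝ)) :=
    (hφ1.continuous_fderiv one_ne_zero).clm_apply continuous_const
  obtain ⟨C1, hC1⟩ := hc.exists_bound_of_continuous hφ.continuous
  obtain ⟨C2, hC2⟩ := (hc.fderiv_apply ℝ (EuclideanSpace.single i (1 : ℝ))).exists_bound_of_continuous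
    hdφ
  have hwK : IntegrableOn w (tsupport Θ) := hw.mono_set hΘO
  have hdwK : IntegrableOn dw (tsupport Θ) := hdw.mono_set hΘO
  have hgm : Measurable (gradient Θ) :=
    (InnerProductSpace.toDual ℝ (EuclideanSpace ℝ (Fin n))).symm.continuous.measurable.comp
      (measurable_fderiv ℝ Θ)
  have hgb : ∀ x, ‖gradient Θ x‖ ≤ D := fun x => by
    rw [gradient, LinearIsometryEquiv.norm_map]
    exact norm_fderiv_le_of_lipschitz ℝ hΘ
  have z0 : ∀ x, x ∉ tsupport Θ → Θ x = 0 := fun x hx => image_eq_zero_of_notMem_tsupport hx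
  have z1 : ∀ x, x ∉ tsupport Θ → gradient Θ x = 0 := fun x hx => by
    have : fderiv ℝ Θ x = 0 := image_eq_zero_of_notMem_tsupport
      (fun h' => hx (tsupport_fderiv_subset ℝ h'))
    simp [gradient, this]
  have hI : ∀ {z : EuclideanSpace ℝ (Fin n) → ℝ}, IntegrableOn z (tsupport Θ) →
      IntegrableOn (fun x => Θ x * z x) (tsupport Θ) := fun hz =>
    Integrable.bdd_mul (c := 1) hz hΘ.continuous.aestronglyMeasurable
      (Filter.Eventually.of_forall hΘ1)
  have hI2 : ∀ {z : EuclideanSpace ℝ (Fin n) → ℝ}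
      {dz : EuclideanSpace ℝ (Fin n) → EuclideanSpace ℝ (Fin n)},
      IntegrableOn z (tsupport Θ) → IntegrableOn dz (tsupport Θ) →
      IntegrableOn (fun x => Θ x • dz x + z x • gradient Θ x) (tsupport Θ) := fun hz hdz =>
    (Integrable.bdd_smul hdz 1 hΘ.continuous.aestronglyMeasurable
      (Filter.Eventually.of_forall hΘ1)).add
      (Integrable.smul_bdd hz D hgm.aestronglyMeasurable (Filter.Eventually.of_forall hgb))
  rw [setIntegral_univ, setIntegral_univ,
    ← setIntegral_eq_integral_of_forall_compl_eq_zero (s := tsupport Θ)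
      (fun x hx => by simp [z0 x hx]),
    ← setIntegral_eq_integral_of_forall_compl_eq_zero (s := tsupport Θ)
      (f := fun x => (Θ x • dw x + w x • gradient Θ x) i * φ x)
      (fun x hx => by simp [z0 x hx, z1 x hx])]
  have hvK : ∀ j, IntegrableOn (v j) (tsupport Θ) := fun j =>
    (hv1 j).continuous.continuousOn.integrableOn_compact hΘc.isCompact
  have hdvK : ∀ j, IntegrableOn (dv j) (tsupport Θ) := fun j =>
    (A.continuous j).continuousOn.integrableOn_compact hΘc.isCompact
  refine integral_mul_eq_of_tendsto (C := max C1 C2) hdφ.aestronglyMeasurable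
    hφ.continuous.aestronglyMeasurable
    (fun x => (hC2 x).trans (le_max_right _ _)) (fun x => (hC1 x).trans (le_max_left _ _))
    (Fj := fun j x => Θ x * v j x) (Gj := fun j x => Θ x • dv j x + v j x • gradient Θ x)
    (hI hwK) (hI2 hwK hdwK) (fun j => hI (hvK j)) (fun j => hI2 (hvK j) (hdvK j)) ?_ ?_ ?_
  · refine tendsto_of_tendsto_of_tendsto_of_le_of_le tendsto_const_nhds A.tendsto_lintegral
      (fun j => zero_le) fun j => lintegral_mono fun x => ?_
    rw [← mul_sub, enorm_mul]
    refine mul_le_of_le_one_left zero_le ?_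
    rw [← ofReal_norm]; exact ENNReal.ofReal_le_one.2 (hΘ1 _)
  · have hsum := A.tendsto_lintegral_grad.add
      (ENNReal.Tendsto.const_mul (a := (D : ℝ≥0∞)) A.tendsto_lintegral (Or.inr (by simp)))
    rw [mul_zero, add_zero] at hsum
    refine tendsto_of_tendsto_of_tendsto_of_le_of_le tendsto_const_nhds hsum
      (fun j => zero_le) fun j => ?_
    have hm : AEMeasurable (fun x => ‖dv j x - dw x‖ₑ) (volume.restrict (tsupport Θ)) :=
      ((A.continuous j).aestronglyMeasurable.sub hdwK.1).enorm
    have hm2 : AEMeasurable (fun x => ‖v j x - w x‖ₑ) (volume.restrict (tsupport Θ)) :=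
      ((hvK j).1.sub hwK.1).enorm
    simp only
    rw [← lintegral_const_mul'' _ hm2, ← lintegral_add_left' hm]
    refine lintegral_mono fun x => ?_
    have e : Θ x • dv j x + v j x • gradient Θ x - (Θ x • dw x + w x • gradient Θ x) =
        Θ x • (dv j x - dw x) + (v j x - w x) • gradient Θ x := by
      rw [smul_sub, sub_smul]; abel
    rw [e]
    refine (enorm_add_le _ _).trans ?_
    rw [enorm_smul, enorm_smul, mul_comm (D : ℝ≥0∞)]
    gcongr
    · refine mul_le_of_le_one_left zero_le ?_
      rw [← ofReal_norm]; exact ENNReal.ofReal_le_one.2 (hΘ1 _)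
    · rw [← ofReal_norm, ← ENNReal.ofReal_coe_nnreal]
      exact ENNReal.ofReal_le_ofReal (hgb x)
  · intro j
    have hvφ : ContDiff ℝ 1 fun x => v j x * φ x := (hv1 j).mul hφ1
    have hvφc : HasCompactSupport fun x => v j x * φ x := hc.mul_left
    obtain ⟨D', hD'⟩ := hvφ.lipschitzWith_of_hasCompactSupport hvφc one_ne_zero
    have key := hΘ.integral_lineDeriv_mul_eq (μ := volume) hD' hvφc
      (EuclideanSpace.single i (1 : ℝ))
    have hnull := hΘ.ae_differentiableAt (μ := volume)
    have eL : ∫ x, lineDeriv ℝ Θ x (EuclideanSpace.single i (1 : ℝ)) * (v j x * φ x) =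
        ∫ x in tsupport Θ, (v j x • gradient Θ x) i * φ x := by
      rw [setIntegral_eq_integral_of_forall_compl_eq_zero (fun x hx => by simp [z1 x hx])]
      refine integral_congr_ae (hnull.mono fun x hx => ?_)
      have h1 : gradient Θ x i = fderiv ℝ Θ x (EuclideanSpace.single i (1 : ℝ)) := by
        have := inner_gradient_left (f := Θ) (x := x) (y := EuclideanSpace.single i (1 : ℝ))
        rw [← this, EuclideanSpace.inner_single_right]
        simp
      simp only [hx.lineDeriv_eq_fderiv, PiLp.smul_apply, h1, smul_eq_mul]
      ring
    have eR : ∫ x, lineDeriv ℝ (fun x => v j x * φ x) x (-(EuclideanSpace.single i (1 : ℝ))) * Θ x =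
        - (∫ x in tsupport Θ, (Θ x • dv j x) i * φ x) -
          ∫ x in tsupport Θ, Θ x * v j x * fderiv ℝ φ x (EuclideanSpace.single i (1 : ℝ)) := by
      rw [← setIntegral_eq_integral_of_forall_compl_eq_zero (s := tsupport Θ)
        (fun x hx => by simp [z0 x hx]), ← integral_neg, ← integral_sub]
      · refine setIntegral_congr_fun hKm fun x hx => ?_
        have h3 : HasFDerivAt (fun x => v j x * φ x) _ x := (A.hasFDerivAt j x hx).mul (hφ1.differentiable one_ne_zero x).hasFDerivAt
        simp only
        rw [(hvφ.differentiable one_ne_zero x).lineDeriv_eq_fderiv, map_neg, h3.fderiv]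
        simp [EuclideanSpace.inner_single_right]
        ring
      · refine Integrable.neg ?_
        refine Integrable.mul_bdd (c := C1) ?_ hφ.continuous.aestronglyMeasurable
          (Filter.Eventually.of_forall hC1)
        exact (EuclideanSpace.proj (𝕜 := ℝ) i : EuclideanSpace ℝ (Fin n) →L[ℝ] ℝ).integrable_comp
          (Integrable.bdd_smul (hdvK j) 1 hΘ.continuous.aestronglyMeasurable
            (Filter.Eventually.of_forall hΘ1))
      · exact Integrable.mul_bdd (c := C2) (hI (hvK j)) hdφ.aestronglyMeasurable
          (Filter.Eventually.of_forall hC2)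
    rw [eL, eR] at key
    have esum : ∫ x in tsupport Θ, (Θ x • dv j x + v j x • gradient Θ x) i * φ x =
        (∫ x in tsupport Θ, (Θ x • dv j x) i * φ x) +
          ∫ x in tsupport Θ, (v j x • gradient Θ x) i * φ x := by
      rw [← integral_add]
      · simp only [PiLp.add_apply, add_mul]
      · refine Integrable.mul_bdd (c := C1) ?_ hφ.continuous.aestronglyMeasurable
          (Filter.Eventually.of_forall hC1)
        exact (EuclideanSpace.proj (𝕜 := ℝ) i : EuclideanSpace ℝ (Fin n) →L[ℝ] ℝ).integrable_comp
          (Integrable.bdd_smul (hdvK j) 1 hΘ.continuous.aestronglyMeasurable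
            (Filter.Eventually.of_forall hΘ1))
      · refine Integrable.mul_bdd (c := C1) ?_ hφ.continuous.aestronglyMeasurable
          (Filter.Eventually.of_forall hC1)
        exact (EuclideanSpace.proj (𝕜 := ℝ) i : EuclideanSpace ℝ (Fin n) →L[ℝ] ℝ).integrable_comp
          (Integrable.smul_bdd (hvK j) D hgm.aestronglyMeasurable (Filter.Eventually.of_forall hgb))
    rw [esum, key]
    ring

end weakGrad
/-! ### Scaling -/

section scaling

variable {n : ℕ}

/-- The homeomorphism `y ↦ x₀ + r y`. -/
def addSMulHomeo (x₀ : EuclideanSpace ℝ (Fin n)) {r : ℝ} (hr : 0 < r) :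
    EuclideanSpace ℝ (Fin n) ≃ₜ EuclideanSpace ℝ (Fin n) :=
  (Homeomorph.smulOfNeZero r hr.ne').trans (Homeomorph.addLeft x₀)

lemma map_add_smul_volume (x₀ : EuclideanSpace ℝ (Fin n)) {r : ℝ} (hr : 0 < r) :
    Measure.map (fun y => x₀ + r • y) (volume : Measure (EuclideanSpace ℝ (Fin n))) =
      ENNReal.ofReal ((r ^ n)⁻¹) • volume := by
  have h1 : Measure.map (fun y => x₀ + r • y) (volume : Measure (EuclideanSpace ℝ (Fin n))) =
      Measure.map (fun y => x₀ + y) (Measure.map (fun y => r • y) volume) :=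
    (Measure.map_map (measurable_const_add x₀) (measurable_const_smul r)).symm
  rw [h1, Measure.map_addHaar_smul _ hr.ne', Measure.map_smul, map_add_left_eq_self]
  simp [abs_of_pos hr]

lemma setLIntegral_comp_add_smul (x₀ : EuclideanSpace ℝ (Fin n)) {r : ℝ} (hr : 0 < r)
    {S : Set (EuclideanSpace ℝ (Fin n))} (hS : MeasurableSet S)
    (F : EuclideanSpace ℝ (Fin n) → ℝ≥0∞) :
    ∫⁻ y in (fun y => x₀ + r • y) ⁻¹' S, F (x₀ + r • y) =
      ENNReal.ofReal ((r ^ n)⁻¹) * ∫⁻ x in S, F x := by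
  have hemb : MeasurableEmbedding (fun y : EuclideanSpace ℝ (Fin n) => x₀ + r • y) :=
    (addSMulHomeo x₀ hr).measurableEmbedding
  rw [← hemb.lintegral_map, ← Measure.restrict_map hemb.measurable hS, map_add_smul_volume _ hr,
    Measure.restrict_smul, lintegral_smul_measure, smul_eq_mul]

lemma setIntegral_comp_add_smul {F : Type*} [NormedAddCommGroup F] [NormedSpace ℝ F]
    (x₀ : EuclideanSpace ℝ (Fin n)) {r : ℝ} (hr : 0 < r)
    {S : Set (EuclideanSpace ℝ (Fin n))} (hS : MeasurableSet S)
    (f : EuclideanSpace ℝ (Fin n) → F) :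
    ∫ y in (fun y => x₀ + r • y) ⁻¹' S, f (x₀ + r • y) = (r ^ n)⁻¹ • ∫ x in S, f x := by
  have hemb : MeasurableEmbedding (fun y : EuclideanSpace ℝ (Fin n) => x₀ + r • y) :=
    (addSMulHomeo x₀ hr).measurableEmbedding
  rw [← hemb.integral_map, ← Measure.restrict_map hemb.measurable hS, map_add_smul_volume _ hr,
    Measure.restrict_smul, integral_smul_measure, ENNReal.toReal_ofReal (by positivity)]

lemma integrableOn_comp_add_smul {F : Type*} [NormedAddCommGroup F]
    (x₀ : EuclideanSpace ℝ (Fin n)) {r : ℝ} (hr : 0 < r)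
    {S : Set (EuclideanSpace ℝ (Fin n))} (hS : MeasurableSet S)
    {f : EuclideanSpace ℝ (Fin n) → F} (hf : IntegrableOn f S) :
    IntegrableOn (fun y => f (x₀ + r • y)) ((fun y => x₀ + r • y) ⁻¹' S) := by
  have hemb : MeasurableEmbedding (fun y : EuclideanSpace ℝ (Fin n) => x₀ + r • y) :=
    (addSMulHomeo x₀ hr).measurableEmbedding
  rw [IntegrableOn, ← Function.comp_def f, ← hemb.integrable_map_iff,
    ← Measure.restrict_map hemb.measurable hS, map_add_smul_volume _ hr, Measure.restrict_smul]
  exact Integrable.smul_measure hf (by simp)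

lemma IsWeakGradOn.comp_add_smul {O : Set (EuclideanSpace ℝ (Fin n))}
    {w : EuclideanSpace ℝ (Fin n) → ℝ} {dw : EuclideanSpace ℝ (Fin n) → EuclideanSpace ℝ (Fin n)}
    (h : IsWeakGradOn n O w dw) (hO : MeasurableSet O) (x₀ : EuclideanSpace ℝ (Fin n)) {r : ℝ}
    (hr : 0 < r) :
    IsWeakGradOn n ((fun y => x₀ + r • y) ⁻¹' O) (fun y => w (x₀ + r • y))
      (fun y => r • dw (x₀ + r • y)) := by
  intro ψ hψ hc hs i
  set T := addSMulHomeo x₀ hr with hT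
  have hTa : ∀ y, T y = x₀ + r • y := fun y => rfl
  have hTs : ∀ x, T.symm x = r⁻¹ • (x - x₀) := fun x => by
    rw [T.symm_apply_eq, hTa, smul_smul, mul_inv_cancel₀ hr.ne', one_smul]; abel
  have hTsm : ContDiff ℝ (⊤ : ℕ∞) T.symm := by
    have : (T.symm : EuclideanSpace ℝ (Fin n) → EuclideanSpace ℝ (Fin n)) =
      fun x => r⁻¹ • (x - x₀) := funext hTs
    rw [this]
    exact (contDiff_id.sub contDiff_const).const_smul _
  have htest := h (ψ ∘ T.symm) (hψ.comp hTsm) (hc.comp_homeomorph T.symm) ?_ i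
  · have hfd : ∀ x, fderiv ℝ (ψ ∘ T.symm) x (EuclideanSpace.single i (1 : ℝ)) =
        r⁻¹ * fderiv ℝ ψ (T.symm x) (EuclideanSpace.single i (1 : ℝ)) := by
      intro x
      have h1 : HasFDerivAt ψ (fderiv ℝ ψ (T.symm x)) (T.symm x) :=
        (hψ.differentiable (by simp) _).hasFDerivAt
      have h2 : HasFDerivAt T.symm (r⁻¹ • ContinuousLinearMap.id ℝ (EuclideanSpace ℝ (Fin n))) x := by
        have : (T.symm : EuclideanSpace ℝ (Fin n) → EuclideanSpace ℝ (Fin n)) =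
          fun x => r⁻¹ • (x - x₀) := funext hTs
        rw [this]
        exact HasFDerivAt.const_smul ((hasFDerivAt_id (𝕜 := ℝ) x).sub_const x₀) (r⁻¹)
      rw [(h1.comp x h2).fderiv]
      simp
    have e1 := setIntegral_comp_add_smul x₀ hr hO
      (fun x => w x * fderiv ℝ ψ (T.symm x) (EuclideanSpace.single i (1 : ℝ)))
    have e2 := setIntegral_comp_add_smul x₀ hr hO (fun x => dw x i * ψ (T.symm x))
    have hTT : ∀ y, T.symm (x₀ + r • y) = y := fun y => by rw [← hTa, T.symm_apply_apply]
    simp only [hTT] at e1 e2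
    have e3 : ∫ y in (fun y => x₀ + r • y) ⁻¹' O, (r • dw (x₀ + r • y)) i * ψ y =
        r * ∫ y in (fun y => x₀ + r • y) ⁻¹' O, dw (x₀ + r • y) i * ψ y := by
      rw [← integral_const_mul]
      congr 1; ext y; simp [mul_assoc]
    simp only [hfd, Function.comp_apply] at htest
    have e4 : ∫ x in O, w x * (r⁻¹ * fderiv ℝ ψ (T.symm x) (EuclideanSpace.single i (1 : ℝ))) =
        r⁻¹ * ∫ x in O, w x * fderiv ℝ ψ (T.symm x) (EuclideanSpace.single i (1 : ℝ)) := by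
      rw [← integral_const_mul]
      congr 1; ext y; ring
    rw [e4] at htest
    rw [e1, e3, e2, smul_eq_mul, smul_eq_mul]
    have h5 : ∫ x in O, w x * fderiv ℝ ψ (T.symm x) (EuclideanSpace.single i (1 : ℝ)) =
        r * -∫ x in O, dw x i * ψ (T.symm x) := by
      rw [← htest, ← mul_assoc, mul_inv_cancel₀ hr.ne', one_mul]
    rw [h5]; ring
  · have : tsupport (ψ ∘ T.symm) = T.symm ⁻¹' tsupport ψ := by
      rw [tsupport, tsupport, T.symm.preimage_closure]
      rfl
    rw [this]
    intro x hx
    have := hs hx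
    simp only [mem_preimage] at this
    rwa [← hTa, T.apply_symm_apply] at this

end scaling

/-! ### Poincaré inequalities -/

section poincare

variable {n : ℕ}

lemma lintegral_comp_add_smul_le {H : EuclideanSpace ℝ (Fin n) → ℝ≥0∞}
    (y : EuclideanSpace ℝ (Fin n)) {t : ℝ} (ht : 1 / 2 ≤ t) :
    ∫⁻ x, H (y + t • x) ≤ 2 ^ n * ∫⁻ x, H x := by
  have ht0 : 0 < t := by linarith
  have := setLIntegral_comp_add_smul y ht0 MeasurableSet.univ H
  simp only [preimage_univ, setLIntegral_univ] at this
  rw [this]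
  gcongr
  rw [show (2 : ℝ≥0∞) ^ n = ENNReal.ofReal (2 ^ n) by
    rw [ENNReal.ofReal_pow (by norm_num)]; simp]
  refine ENNReal.ofReal_le_ofReal ?_
  rw [← inv_pow]
  refine pow_le_pow_left₀ (by positivity) ?_ n
  rw [inv_le_comm₀ ht0 (by norm_num)]
  linarith

lemma enorm_sub_rpow_le_lintegral {K : Set (EuclideanSpace ℝ (Fin n))} (hK : Convex ℝ K)
    {v : EuclideanSpace ℝ (Fin n) → ℝ} {dv : EuclideanSpace ℝ (Fin n) → EuclideanSpace ℝ (Fin n)}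
    (hdv : Continuous dv) (hd : ∀ x ∈ K, HasFDerivAt v (innerSL ℝ (dv x)) x) {p : ℝ} (hp : 1 ≤ p)
    {x y : EuclideanSpace ℝ (Fin n)} (hx : x ∈ K) (hy : y ∈ K) (hxy : ‖x - y‖ ≤ 2) :
    ‖v x - v y‖ₑ ^ p ≤ 2 ^ p * ∫⁻ t in Icc (0 : ℝ) 1, ‖dv ((1 - t) • y + t • x)‖ₑ ^ p := by
  have hp0 : 0 ≤ p := by linarith
  set c : ℝ → EuclideanSpace ℝ (Fin n) := fun t => (1 - t) • y + t • x with hc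
  have hcc : Continuous c := by fun_prop
  have hcK : ∀ t ∈ Icc (0 : ℝ) 1, c t ∈ K := fun t ht =>
    hK hy hx (by linarith [ht.2]) ht.1 (by ring)
  have hcd : ∀ t, HasDerivAt c (x - y) t := fun t => by
    have h1 := (((hasDerivAt_id t).const_sub 1).smul_const y).add ((hasDerivAt_id t).smul_const x)
    have h2 : x - y = (-1 : ℝ) • y + (1 : ℝ) • x := by simp [sub_eq_add_neg, add_comm]
    rw [h2]
    exact h1
  have hderiv : ∀ t ∈ uIcc (0 : ℝ) 1, HasDerivAt (v ∘ c) (inner ℝ (dv (c t)) (x - y)) t := by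
    intro t ht
    rw [uIcc_of_le zero_le_one] at ht
    simpa using (hd (c t) (hcK t ht)).comp_hasDerivAt t (hcd t)
  have hcont : Continuous fun t => inner ℝ (dv (c t)) (x - y) :=
    (hdv.comp hcc).inner continuous_const
  have hFTC := intervalIntegral.integral_eq_sub_of_hasDerivAt hderiv
    (hcont.intervalIntegrable 0 1)
  have e : v x - v y = ∫ t in Icc (0 : ℝ) 1, inner ℝ (dv (c t)) (x - y) := by
    rw [integral_Icc_eq_integral_Ioc, ← intervalIntegral.integral_of_le zero_le_one, hFTC]
    simp [hc]
  have hprob : IsProbabilityMeasure ((volume : Measure ℝ).restrict (Icc (0 : ℝ) 1)) :=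
    ⟨by simp⟩
  calc ‖v x - v y‖ₑ ^ p ≤ (2 * ∫⁻ t in Icc (0 : ℝ) 1, ‖dv (c t)‖ₑ) ^ p := by
        refine ENNReal.rpow_le_rpow ?_ hp0
        rw [e]
        refine (enorm_integral_le_lintegral_enorm _).trans ?_
        have hm : Measurable fun t => ‖dv (c t)‖ₑ := (hdv.comp hcc).enorm.measurable
        rw [← lintegral_const_mul _ hm]
        refine lintegral_mono fun t => ?_
        have h1 := norm_inner_le_norm (𝕜 := ℝ) (dv (c t)) (x - y)
        have h2 : ‖inner ℝ (dv (c t)) (x - y)‖ ≤ 2 * ‖dv (c t)‖ := by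
          refine h1.trans ?_
          rw [mul_comm]
          gcongr
        calc ‖inner ℝ (dv (c t)) (x - y)‖ₑ = ENNReal.ofReal ‖inner ℝ (dv (c t)) (x - y)‖ :=
              (ofReal_norm _).symm
          _ ≤ ENNReal.ofReal (2 * ‖dv (c t)‖) := ENNReal.ofReal_le_ofReal h2
          _ = 2 * ‖dv (c t)‖ₑ := by
            rw [ENNReal.ofReal_mul zero_le_two, ofReal_norm, ENNReal.ofReal_ofNat]
    _ = 2 ^ p * (∫⁻ t in Icc (0 : ℝ) 1, ‖dv (c t)‖ₑ) ^ p := ENNReal.mul_rpow_of_nonneg _ _ hp0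
    _ ≤ _ := by
        gcongr
        exact lintegral_rpow_le_of_isProbabilityMeasure
          (hdv.comp hcc).enorm.measurable.aemeasurable hp

lemma lintegral_lintegral_segment_le {H : EuclideanSpace ℝ (Fin n) → ℝ≥0∞} (hHm : Measurable H)
    (K : Set (EuclideanSpace ℝ (Fin n))) {t : ℝ} :
    ∫⁻ x in K, ∫⁻ y in K, H ((1 - t) • y + t • x) ≤ 2 ^ n * volume K * ∫⁻ x, H x := by
  rcases le_total (1 / 2) t with h | h
  · have hmt : Measurable fun z : EuclideanSpace ℝ (Fin n) × EuclideanSpace ℝ (Fin n) =>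
        H ((1 - t) • z.2 + t • z.1) := hHm.comp (by fun_prop)
    rw [lintegral_lintegral_swap (f := fun x y => H ((1 - t) • y + t • x)) hmt.aemeasurable]
    calc ∫⁻ y in K, ∫⁻ x in K, H ((1 - t) • y + t • x)
        ≤ ∫⁻ y in K, 2 ^ n * ∫⁻ x, H x := by
          refine lintegral_mono fun y => (setLIntegral_le_lintegral _ _).trans ?_
          exact lintegral_comp_add_smul_le _ h
      _ = _ := by rw [setLIntegral_const]; ring
  · calc ∫⁻ x in K, ∫⁻ y in K, H ((1 - t) • y + t • x)
        ≤ ∫⁻ y in K, 2 ^ n * ∫⁻ x, H x := by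
          refine lintegral_mono fun x => (setLIntegral_le_lintegral _ _).trans ?_
          simp only [add_comm _ (t • x)]
          exact lintegral_comp_add_smul_le _ (by linarith)
      _ = _ := by rw [setLIntegral_const]; ring

lemma lintegral_lintegral_lintegral_segment_le {H : EuclideanSpace ℝ (Fin n) → ℝ≥0∞}
    (hHm : Measurable H) (K : Set (EuclideanSpace ℝ (Fin n))) [SFinite (volume.restrict K)] :
    ∫⁻ x in K, ∫⁻ y in K, ∫⁻ t in Icc (0 : ℝ) 1, H ((1 - t) • y + t • x) ≤
      2 ^ n * volume K * ∫⁻ x, H x := by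
  have hm6 : ∀ x, Measurable fun z : EuclideanSpace ℝ (Fin n) × ℝ =>
      H ((1 - z.2) • z.1 + z.2 • x) := fun x => hHm.comp (by fun_prop)
  have hm3 : Measurable fun z : (EuclideanSpace ℝ (Fin n) × ℝ) × EuclideanSpace ℝ (Fin n) =>
    H ((1 - z.1.2) • z.2 + z.1.2 • z.1.1) := hHm.comp (by fun_prop)
  have hm7 : Measurable fun z : EuclideanSpace ℝ (Fin n) × ℝ =>
      ∫⁻ y in K, H ((1 - z.2) • y + z.2 • z.1) := hm3.lintegral_prod_right'
  have e1 : ∫⁻ x in K, ∫⁻ y in K, ∫⁻ t in Icc (0 : ℝ) 1, H ((1 - t) • y + t • x) =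
      ∫⁻ x in K, ∫⁻ t in Icc (0 : ℝ) 1, ∫⁻ y in K, H ((1 - t) • y + t • x) :=
    lintegral_congr fun x => lintegral_lintegral_swap
      (f := fun y t => H ((1 - t) • y + t • x)) (hm6 x).aemeasurable
  have e2 : ∫⁻ x in K, ∫⁻ t in Icc (0 : ℝ) 1, ∫⁻ y in K, H ((1 - t) • y + t • x) =
      ∫⁻ t in Icc (0 : ℝ) 1, ∫⁻ x in K, ∫⁻ y in K, H ((1 - t) • y + t • x) :=
    lintegral_lintegral_swap
      (f := fun x t => ∫⁻ y in K, H ((1 - t) • y + t • x)) hm7.aemeasurable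
  rw [e1, e2]
  refine (lintegral_mono fun t => lintegral_lintegral_segment_le hHm K).trans (le_of_eq ?_)
  rw [setLIntegral_const, Real.volume_Icc]
  simp

/-- Poincaré inequality, in double integral form, for `C¹` functions on the unit ball. -/
lemma lintegral_lintegral_enorm_sub_rpow_le {v : EuclideanSpace ℝ (Fin n) → ℝ}
    {dv : EuclideanSpace ℝ (Fin n) → EuclideanSpace ℝ (Fin n)} (hdv : Continuous dv)
    (hd : ∀ x ∈ closedBall (0 : EuclideanSpace ℝ (Fin n)) 1, HasFDerivAt v (innerSL ℝ (dv x)) x)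
    {p : ℝ} (hp : 1 ≤ p) :
    ∫⁻ x in closedBall (0 : EuclideanSpace ℝ (Fin n)) 1,
      ∫⁻ y in closedBall (0 : EuclideanSpace ℝ (Fin n)) 1, ‖v x - v y‖ₑ ^ p ≤
      2 ^ p * (2 ^ n * volume (closedBall (0 : EuclideanSpace ℝ (Fin n)) 1)) *
        ∫⁻ x in closedBall (0 : EuclideanSpace ℝ (Fin n)) 1, ‖dv x‖ₑ ^ p := by
  obtain ⟨K, hK⟩ : ∃ K, K = closedBall (0 : EuclideanSpace ℝ (Fin n)) 1 := ⟨_, rfl⟩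
  have hKm : MeasurableSet K := hK ▸ measurableSet_closedBall
  have hKc : Convex ℝ K := hK ▸ convex_closedBall 0 1
  rw [← hK] at hd ⊢
  obtain ⟨H, hH⟩ : ∃ H, H = K.indicator fun x => ‖dv x‖ₑ ^ p := ⟨_, rfl⟩
  have hHm : Measurable H := hH ▸ (hdv.enorm.measurable.pow_const p).indicator hKm
  have hHI : ∫⁻ x, H x = ∫⁻ x in K, ‖dv x‖ₑ ^ p := by rw [hH]; exact lintegral_indicator hKm _
  have hm1 : Measurable fun z : (EuclideanSpace ℝ (Fin n) × EuclideanSpace ℝ (Fin n)) × ℝ =>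
      H ((1 - z.2) • z.1.2 + z.2 • z.1.1) := hHm.comp (by fun_prop)
  have hm2 : Measurable fun z : (EuclideanSpace ℝ (Fin n) × EuclideanSpace ℝ (Fin n)) =>
      ∫⁻ t in Icc (0 : ℝ) 1, H ((1 - t) • z.2 + t • z.1) := hm1.lintegral_prod_right'
  have hm4 : Measurable fun x : EuclideanSpace ℝ (Fin n) =>
      ∫⁻ y in K, ∫⁻ t in Icc (0 : ℝ) 1, H ((1 - t) • y + t • x) := hm2.lintegral_prod_right'
  have hm5 : ∀ x, Measurable fun y => ∫⁻ t in Icc (0 : ℝ) 1, H ((1 - t) • y + t • x) := fun x =>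
    hm2.comp (by fun_prop : Measurable fun y => (x, y))
  have h1 : ∫⁻ x in K, ∫⁻ y in K, ‖v x - v y‖ₑ ^ p ≤
      ∫⁻ x in K, ∫⁻ y in K, 2 ^ p * ∫⁻ t in Icc (0 : ℝ) 1, H ((1 - t) • y + t • x) := by
    refine setLIntegral_mono' hKm fun x hx => setLIntegral_mono' hKm fun y hy => ?_
    refine (enorm_sub_rpow_le_lintegral hKc hdv hd hp hx hy ?_).trans ?_
    · have h1 : ‖x‖ ≤ 1 := by simpa [hK] using hx
      have h2 : ‖y‖ ≤ 1 := by simpa [hK] using hy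
      exact (norm_sub_le _ _).trans (by linarith)
    · gcongr 2 ^ p * ?_
      refine setLIntegral_mono' measurableSet_Icc fun t ht => ?_
      have hmem : (1 - t) • y + t • x ∈ K :=
        hKc hy hx (by linarith [ht.2] : (0 : ℝ) ≤ 1 - t) ht.1 (by ring)
      rw [hH, indicator_of_mem hmem]
  have e0 : ∫⁻ x in K, ∫⁻ y in K, 2 ^ p * ∫⁻ t in Icc (0 : ℝ) 1, H ((1 - t) • y + t • x) =
      2 ^ p * ∫⁻ x in K, ∫⁻ y in K, ∫⁻ t in Icc (0 : ℝ) 1, H ((1 - t) • y + t • x) := by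
    rw [← lintegral_const_mul _ hm4]
    refine lintegral_congr fun x => ?_
    rw [lintegral_const_mul _ (hm5 x)]
  rw [e0] at h1
  refine h1.trans ?_
  rw [mul_assoc, ← hHI]
  exact mul_le_mul_right (lintegral_lintegral_lintegral_segment_le hHm K) _

/-- Poincaré inequality, in double integral form, for weakly differentiable functions. -/
lemma IsWeakGradOn.lintegral_lintegral_enorm_sub_rpow_le {O : Set (EuclideanSpace ℝ (Fin n))}
    {w : EuclideanSpace ℝ (Fin n) → ℝ}
    {dw : EuclideanSpace ℝ (Fin n) → EuclideanSpace ℝ (Fin n)} (h : IsWeakGradOn n O w dw)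
    (hO : IsOpen O) (hBO : closedBall 0 1 ⊆ O) (hw : IntegrableOn w O) (hdw : IntegrableOn dw O)
    {p : ℝ} (hp : 1 ≤ p) :
    ∫⁻ x in closedBall (0 : EuclideanSpace ℝ (Fin n)) 1,
      ∫⁻ y in closedBall (0 : EuclideanSpace ℝ (Fin n)) 1, ‖w x - w y‖ₑ ^ p ≤
      2 ^ p * (2 ^ n * volume (closedBall (0 : EuclideanSpace ℝ (Fin n)) 1)) *
        ∫⁻ x in O, ‖dw x‖ₑ ^ p := by
  set K := closedBall (0 : EuclideanSpace ℝ (Fin n)) 1 with hK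
  have hp0 : 0 ≤ p := by linarith
  obtain ⟨v, dv, A⟩ := h.exists_smoothApprox (isCompact_closedBall 0 1) hO hBO hw hdw
  have hm : ∀ j, Measurable fun z : EuclideanSpace ℝ (Fin n) × EuclideanSpace ℝ (Fin n) =>
      ‖v j z.1 - v j z.2‖ₑ ^ p := fun j =>
    ((((A.contDiff j).continuous.comp continuous_fst).sub
      ((A.contDiff j).continuous.comp continuous_snd)).enorm.measurable).pow_const p
  calc ∫⁻ x in K, ∫⁻ y in K, ‖w x - w y‖ₑ ^ p
      ≤ ∫⁻ x in K, Filter.liminf (fun j => ∫⁻ y in K, ‖v j x - v j y‖ₑ ^ p) Filter.atTop := by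
        refine lintegral_mono_ae (A.ae_tendsto.mono fun x hx => ?_)
        refine le_trans ?_ (lintegral_liminf_le fun j =>
          (hm j).comp (by fun_prop : Measurable fun y => (x, y)))
        refine lintegral_mono_ae (A.ae_tendsto.mono fun y hy => le_of_eq ?_)
        exact (((ENNReal.continuous_rpow_const.tendsto _).comp (hx.sub hy).enorm).liminf_eq).symm
    _ ≤ Filter.liminf (fun j => ∫⁻ x in K, ∫⁻ y in K, ‖v j x - v j y‖ₑ ^ p) Filter.atTop :=
        lintegral_liminf_le fun j => (hm j).lintegral_prod_right'
    _ ≤ _ := by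
        refine Filter.liminf_le_of_le (by isBoundedDefault) fun b hb => ?_
        obtain ⟨j, hj⟩ := hb.exists
        refine hj.trans ((_root_.lintegral_lintegral_enorm_sub_rpow_le (A.continuous j)
          (A.hasFDerivAt j) hp).trans ?_)
        gcongr _ * ?_
        exact A.lintegral_grad_le j p hp

/-- A weakly differentiable function with gradient in `Lᵖ` is in `Lᵖ` on a smaller ball. -/
lemma IsWeakGradOn.lintegral_enorm_rpow_lt_top {O : Set (EuclideanSpace ℝ (Fin n))}
    {w : EuclideanSpace ℝ (Fin n) → ℝ}
    {dw : EuclideanSpace ℝ (Fin n) → EuclideanSpace ℝ (Fin n)} (h : IsWeakGradOn n O w dw)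
    (hO : IsOpen O) (hBO : closedBall 0 1 ⊆ O) (hw : IntegrableOn w O) (hdw : IntegrableOn dw O)
    (hwm : Measurable w) {p : ℝ} (hp : 1 ≤ p) (hfin : ∫⁻ x in O, ‖dw x‖ₑ ^ p < ∞) :
    ∫⁻ x in closedBall (0 : EuclideanSpace ℝ (Fin n)) 1, ‖w x‖ₑ ^ p < ∞ := by
  set K := closedBall (0 : EuclideanSpace ℝ (Fin n)) 1 with hK
  have hp0 : 0 ≤ p := by linarith
  have h1 := h.lintegral_lintegral_enorm_sub_rpow_le hO hBO hw hdw hp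
  rw [← hK] at h1
  have hKfin : volume K < ∞ := measure_closedBall_lt_top
  have h2 : ∫⁻ x in K, ∫⁻ y in K, ‖w x - w y‖ₑ ^ p < ∞ := by
    refine h1.trans_lt ?_
    have : (2 : ℝ≥0∞) ^ p ≠ ∞ := by simp
    exact ENNReal.mul_lt_top (by finiteness) hfin
  have hm : Measurable fun z : EuclideanSpace ℝ (Fin n) × EuclideanSpace ℝ (Fin n) =>
      ‖w z.1 - w z.2‖ₑ ^ p :=
    (((hwm.comp measurable_fst).sub (hwm.comp measurable_snd)).enorm).pow_const p
  have h3 := ae_lt_top' hm.lintegral_prod_right'.aemeasurable h2.ne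
  have hne : (volume.restrict K : Measure (EuclideanSpace ℝ (Fin n))) ≠ 0 := by
    rw [Ne, Measure.restrict_eq_zero]
    exact (measure_closedBall_pos volume _ one_pos).ne'
  have : (ae (volume.restrict K : Measure (EuclideanSpace ℝ (Fin n)))).NeBot := ae_neBot.2 hne
  obtain ⟨x, hx⟩ := h3.exists
  calc ∫⁻ y in K, ‖w y‖ₑ ^ p
      ≤ ∫⁻ y in K, 2 ^ (p - 1) * (‖w x‖ₑ ^ p + ‖w x - w y‖ₑ ^ p) := by
        refine lintegral_mono fun y => ?_
        refine le_trans (ENNReal.rpow_le_rpow ?_ hp0) (ENNReal.rpow_add_le_mul_rpow_add_rpow _ _ hp)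
        have : w y = w x - (w x - w y) := by ring
        conv_lhs => rw [this]
        exact enorm_sub_le
    _ = 2 ^ (p - 1) * (‖w x‖ₑ ^ p * volume K + ∫⁻ y in K, ‖w x - w y‖ₑ ^ p) := by
        have hmx : Measurable fun y => ‖w x‖ₑ ^ p + ‖w x - w y‖ₑ ^ p :=
          measurable_const.add (hm.comp (by fun_prop : Measurable fun y => (x, y)))
        rw [lintegral_const_mul _ hmx, lintegral_add_left measurable_const, setLIntegral_const]
    _ < ∞ := by
        have : (2 : ℝ≥0∞) ^ (p - 1) ≠ ∞ := by simp
        have h5 : ‖w x‖ₑ ^ p ≠ ∞ := by simp [hp0]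
        have h6 := hx.ne
        simp only at h6
        exact ENNReal.mul_lt_top this.lt_top (ENNReal.add_lt_top.2 ⟨by finiteness, h6.lt_top⟩)

/-- Poincaré inequality for functions vanishing on a large portion of the unit ball. -/
lemma IsWeakGradOn.measure_mul_lintegral_rpow_le {O : Set (EuclideanSpace ℝ (Fin n))}
    {w : EuclideanSpace ℝ (Fin n) → ℝ}
    {dw : EuclideanSpace ℝ (Fin n) → EuclideanSpace ℝ (Fin n)} (h : IsWeakGradOn n O w dw)
    (hO : IsOpen O) (hBO : closedBall 0 1 ⊆ O) (hw : IntegrableOn w O) (hdw : IntegrableOn dw O)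
    (hwm : Measurable w) {p : ℝ} (hp : 1 ≤ p) :
    volume (closedBall (0 : EuclideanSpace ℝ (Fin n)) 1 ∩ {x | w x = 0}) *
      ∫⁻ x in closedBall (0 : EuclideanSpace ℝ (Fin n)) 1, ‖w x‖ₑ ^ p ≤
      2 ^ p * (2 ^ n * volume (closedBall (0 : EuclideanSpace ℝ (Fin n)) 1)) *
        ∫⁻ x in O, ‖dw x‖ₑ ^ p := by
  refine le_trans ?_ (h.lintegral_lintegral_enorm_sub_rpow_le hO hBO hw hdw hp)
  set K := closedBall (0 : EuclideanSpace ℝ (Fin n)) 1 with hK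
  have hZ : MeasurableSet (K ∩ {x | w x = 0}) :=
    measurableSet_closedBall.inter (hwm (measurableSet_singleton 0))
  rw [mul_comm, ← setLIntegral_const]
  refine (setLIntegral_mono' hZ fun x hx => ?_).trans
    (lintegral_mono_set (inter_subset_left : K ∩ {x | w x = 0} ⊆ K))
  refine lintegral_mono fun y => ?_
  have : w x = 0 := hx.2
  simp [this]

end poincare
/-! ### Comparison of Lebesgue measures under maps with Lipschitz inverse -/

section lipschitzComparison

lemma exists_measure_preimage_le {α β : Type*} [NormedAddCommGroup α] [NormedSpace ℝ α]
    [FiniteDimensional ℝ α] [MeasurableSpace α] [BorelSpace α] [NormedAddCommGroup β]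
    [NormedSpace ℝ β] [FiniteDimensional ℝ β] [MeasurableSpace β] [BorelSpace β]
    (μ : Measure α) [μ.IsAddHaarMeasure] (ν : Measure β) [ν.IsAddHaarMeasure]
    (hd : Module.finrank ℝ α = Module.finrank ℝ β) (K : ℝ≥0) :
    ∃ C : ℝ≥0, ∀ (f : α → β) (g : β → α) (s : Set α), LipschitzOnWith K g (f '' s) →
      (∀ x ∈ s, g (f x) = x) → μ s ≤ C * ν (f '' s) := by
  have e1 := Measure.isAddLeftInvariant_eq_smul μ
    (Measure.hausdorffMeasure (Module.finrank ℝ α) : Measure α)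
  have e2 := Measure.isAddLeftInvariant_eq_smul
    (Measure.hausdorffMeasure (Module.finrank ℝ β) : Measure β) ν
  set a := Measure.addHaarScalarFactor μ
    (Measure.hausdorffMeasure (Module.finrank ℝ α) : Measure α)
  set b := Measure.addHaarScalarFactor
    (Measure.hausdorffMeasure (Module.finrank ℝ β) : Measure β) ν
  refine ⟨a * (K ^ (Module.finrank ℝ α) * b), fun f g s hg hgf => ?_⟩
  have hs : g '' (f '' s) = s := by
    rw [image_image]
    exact (image_congr hgf).trans (image_id' s)
  have h1 := hg.hausdorffMeasure_image_le (d := Module.finrank ℝ α) (by positivity)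
  rw [hs] at h1
  calc μ s = a * Measure.hausdorffMeasure (Module.finrank ℝ α) s := by
        have := congrArg (fun m : Measure α => m s) e1
        simpa only [Measure.smul_apply, ENNReal.smul_def, smul_eq_mul] using this
    _ ≤ a * ((K : ℝ≥0∞) ^ (Module.finrank ℝ α : ℝ) * (b * ν (f '' s))) := by
        gcongr
        refine h1.trans (le_of_eq ?_)
        congr 1
        rw [hd]
        have := congrArg (fun m : Measure β => m (f '' s)) e2
        simpa only [Measure.smul_apply, ENNReal.smul_def, smul_eq_mul] using this
    _ = _ := by
        rw [ENNReal.rpow_natCast]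
        push_cast
        ring

/-- If `f : s → t` has a Lipschitz left inverse, then the push-forward of Lebesgue measure under
`f` is controlled by Lebesgue measure. -/
lemma exists_setLIntegral_comp_le {α β : Type*} [NormedAddCommGroup α] [NormedSpace ℝ α]
    [FiniteDimensional ℝ α] [MeasurableSpace α] [BorelSpace α] [NormedAddCommGroup β]
    [NormedSpace ℝ β] [FiniteDimensional ℝ β] [MeasurableSpace β] [BorelSpace β]
    (μ : Measure α) [μ.IsAddHaarMeasure] (ν : Measure β) [ν.IsAddHaarMeasure]
    (hd : Module.finrank ℝ α = Module.finrank ℝ β) (K : ℝ≥0) :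
    ∃ C : ℝ≥0, ∀ (f : α → β) (g : β → α) (s : Set α) (t : Set β), Measurable f →
      LipschitzOnWith K g t → (∀ x ∈ s, g (f x) = x) → MapsTo f s t →
      Measure.map f (μ.restrict s) ≤ (C : ℝ≥0∞) • ν.restrict t := by
  obtain ⟨C, hC⟩ := exists_measure_preimage_le μ ν hd K
  refine ⟨C, fun f g s t hf hg hgf hst => ?_⟩
  refine Measure.le_iff.2 fun A hA => ?_
  rw [Measure.map_apply hf hA, Measure.restrict_apply (hf hA), Measure.smul_apply,
    Measure.restrict_apply hA, smul_eq_mul]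
  have hsub : f '' (f ⁻¹' A ∩ s) ⊆ A ∩ t := by
    rintro _ ⟨x, ⟨hx, hxs⟩, rfl⟩
    exact ⟨hx, hst hxs⟩
  refine (hC f g (f ⁻¹' A ∩ s) (hg.mono (hsub.trans inter_subset_right))
    fun x hx => hgf x hx.2).trans ?_
  gcongr

lemma setLIntegral_comp_le_of_map_le {α β : Type*} [MeasurableSpace α] [MeasurableSpace β]
    {μ : Measure α} {ν : Measure β} {s : Set α} {t : Set β} {C : ℝ≥0} {f : α → β}
    (hf : Measurable f) (h : Measure.map f (μ.restrict s) ≤ (C : ℝ≥0∞) • ν.restrict t)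
    {F : β → ℝ≥0∞} (hF : Measurable F) : ∫⁻ x in s, F (f x) ∂μ ≤ C * ∫⁻ x in t, F x ∂ν := by
  rw [← lintegral_map hF hf]
  refine (lintegral_mono' h le_rfl).trans (le_of_eq ?_)
  rw [lintegral_smul_measure, smul_eq_mul]

lemma ae_comp_of_map_le {α β : Type*} [MeasurableSpace α] [MeasurableSpace β]
    {μ : Measure α} {ν : Measure β} {s : Set α} {t : Set β} {C : ℝ≥0} {f : α → β}
    (hf : Measurable f) (h : Measure.map f (μ.restrict s) ≤ (C : ℝ≥0∞) • ν.restrict t)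
    {P : β → Prop} (hP : ∀ᵐ x ∂ν.restrict t, P x) : ∀ᵐ x ∂μ.restrict s, P (f x) := by
  refine ae_of_ae_map hf.aemeasurable ?_
  have h1 : Measure.map f (μ.restrict s) ≪ ν.restrict t :=
    (Measure.absolutelyContinuous_of_le h).trans (Measure.smul_absolutelyContinuous)
  exact h1.ae_le hP

end lipschitzComparison

/-! ### Gnomonic charts in polar coordinates -/

section gnomonic

variable {n : ℕ}

/-- The polar gnomonic chart centred at the direction `e`. -/
def gnomonic (e : EuclideanSpace ℝ (Fin n)) (z : ℝ × (ℝ ∙ e)ᗮ) : EuclideanSpace ℝ (Fin n) :=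
  (z.1 / ‖e + (z.2 : EuclideanSpace ℝ (Fin n))‖) • (e + (z.2 : EuclideanSpace ℝ (Fin n)))

/-- The inverse of the polar gnomonic chart centred at the direction `e`. -/
def gnomonicInv (e : EuclideanSpace ℝ (Fin n)) (x : EuclideanSpace ℝ (Fin n)) : ℝ × (ℝ ∙ e)ᗮ :=
  (‖x‖, (inner ℝ e x)⁻¹ • (ℝ ∙ e)ᗮ.orthogonalProjectionOnto x)

lemma one_le_norm_add_orthogonal {e : EuclideanSpace ℝ (Fin n)} (he : ‖e‖ = 1) (y : (ℝ ∙ e)ᗮ) :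
    1 ≤ ‖e + (y : EuclideanSpace ℝ (Fin n))‖ := by
  have h : inner ℝ e (y : EuclideanSpace ℝ (Fin n)) = 0 :=
    (Submodule.mem_orthogonal_singleton_iff_inner_right).1 y.2
  have h1 : inner ℝ e (e + (y : EuclideanSpace ℝ (Fin n))) = 1 := by
    rw [inner_add_right, h, real_inner_self_eq_norm_sq, he]; norm_num
  have h2 := real_inner_le_norm e (e + (y : EuclideanSpace ℝ (Fin n)))
  rw [h1, he, one_mul] at h2
  exact h2

lemma norm_gnomonic {e : EuclideanSpace ℝ (Fin n)} (he : ‖e‖ = 1) (z : ℝ × (ℝ ∙ e)ᗮ)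
    (hz : 0 ≤ z.1) : ‖gnomonic e z‖ = z.1 := by
  have h := one_le_norm_add_orthogonal he z.2
  rw [gnomonic, norm_smul, Real.norm_eq_abs, abs_div, abs_of_nonneg hz, abs_norm,
    div_mul_cancel₀ _ (by linarith)]

lemma inner_gnomonic {e : EuclideanSpace ℝ (Fin n)} (he : ‖e‖ = 1) (z : ℝ × (ℝ ∙ e)ᗮ) :
    inner ℝ e (gnomonic e z) = z.1 / ‖e + (z.2 : EuclideanSpace ℝ (Fin n))‖ := by
  have h : inner ℝ e (z.2 : EuclideanSpace ℝ (Fin n)) = 0 :=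
    (Submodule.mem_orthogonal_singleton_iff_inner_right).1 z.2.2
  rw [gnomonic, inner_smul_right, inner_add_right, h, real_inner_self_eq_norm_sq, he]
  norm_num

lemma measurable_gnomonic (e : EuclideanSpace ℝ (Fin n)) : Measurable (gnomonic e) := by
  unfold gnomonic
  fun_prop

lemma measurable_gnomonicInv (e : EuclideanSpace ℝ (Fin n)) : Measurable (gnomonicInv e) := by
  unfold gnomonicInv
  fun_prop

lemma gnomonicInv_gnomonic {e : EuclideanSpace ℝ (Fin n)} (he : ‖e‖ = 1) (z : ℝ × (ℝ ∙ e)ᗮ)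
    (hz : 0 < z.1) : gnomonicInv e (gnomonic e z) = z := by
  have h := one_le_norm_add_orthogonal he z.2
  refine Prod.ext (norm_gnomonic he z hz.le) ?_
  have h0 : (ℝ ∙ e)ᗮ.orthogonalProjectionOnto e = 0 :=
    Submodule.orthogonalProjectionOnto_orthogonalComplement_singleton_eq_zero e
  simp only [gnomonicInv, inner_gnomonic he]
  rw [gnomonic, map_smul, map_add, h0, zero_add, Submodule.orthogonalProjectionOnto_mem_subspace_eq_self, smul_smul,
    inv_mul_cancel₀ (by positivity), one_smul]

lemma gnomonic_gnomonicInv {e : EuclideanSpace ℝ (Fin n)} (he : ‖e‖ = 1)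
    {x : EuclideanSpace ℝ (Fin n)} (hx : 0 < inner ℝ e x) :
    gnomonic e (gnomonicInv e x) = x := by
  have h1 : (inner ℝ e x) • e + ((ℝ ∙ e)ᗮ.orthogonalProjectionOnto x : EuclideanSpace ℝ (Fin n)) = x := by
    have := (ℝ ∙ e).starProjection_add_starProjection_orthogonal x
    rwa [Submodule.starProjection_unit_singleton ℝ he] at this
  have h2 : e + (inner ℝ e x)⁻¹ • ((ℝ ∙ e)ᗮ.orthogonalProjectionOnto x : EuclideanSpace ℝ (Fin n)) =
      (inner ℝ e x)⁻¹ • x := by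
    have := congrArg (fun z => (inner ℝ e x)⁻¹ • z) h1
    simpa only [smul_add, smul_smul, inv_mul_cancel₀ hx.ne', one_smul] using this
  have hx0 : x ≠ 0 := by rintro rfl; simp at hx
  have hx1 : 0 < ‖x‖ := norm_pos_iff.2 hx0
  simp only [gnomonic, gnomonicInv, Submodule.coe_smul]
  rw [h2, norm_smul, smul_smul, norm_inv, Real.norm_eq_abs, abs_of_pos hx]
  have : ‖x‖ / ((inner ℝ e x)⁻¹ * ‖x‖) * (inner ℝ e x)⁻¹ = 1 := by field_simp
  rw [this, one_smul]

lemma norm_smul_sub_smul_le {E : Type*} [NormedAddCommGroup E] [NormedSpace ℝ E] {r r' : ℝ}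
    (hr' : 0 ≤ r') (hr1 : r' ≤ 1) {z z' : E} (hz : 1 ≤ ‖z‖) (hz' : 1 ≤ ‖z'‖) :
    ‖(r / ‖z‖) • z - (r' / ‖z'‖) • z'‖ ≤ |r - r'| + 2 * ‖z - z'‖ := by
  have hz0 : 0 < ‖z‖ := by linarith
  have hz0' : 0 < ‖z'‖ := by linarith
  have e : (r / ‖z‖) • z - (r' / ‖z'‖) • z' = ((r - r') / ‖z‖) • z + (r' / ‖z‖) • (z - z') +
      (r' * (‖z'‖ - ‖z‖) / (‖z‖ * ‖z'‖)) • z' := by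
    have : r' * (‖z'‖ - ‖z‖) / (‖z‖ * ‖z'‖) = r' / ‖z‖ - r' / ‖z'‖ := by field_simp
    rw [this, sub_div, sub_smul, sub_smul, smul_sub]
    abel
  rw [e]
  refine (norm_add₃_le).trans ?_
  have h1 : ‖((r - r') / ‖z‖) • z‖ = |r - r'| := by
    rw [norm_smul, Real.norm_eq_abs, abs_div, abs_norm, div_mul_cancel₀ _ hz0.ne']
  have h2 : ‖(r' / ‖z‖) • (z - z')‖ ≤ ‖z - z'‖ := by
    rw [norm_smul, Real.norm_eq_abs, abs_div, abs_norm, abs_of_nonneg hr']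
    refine mul_le_of_le_one_left (norm_nonneg _) ?_
    rw [div_le_one hz0]; linarith
  have h3 : ‖(r' * (‖z'‖ - ‖z‖) / (‖z‖ * ‖z'‖)) • z'‖ ≤ ‖z - z'‖ := by
    rw [norm_smul, Real.norm_eq_abs, abs_div, abs_mul, abs_mul, abs_norm, abs_norm,
      abs_of_nonneg hr']
    have h4 : r' * |‖z'‖ - ‖z‖| / (‖z‖ * ‖z'‖) * ‖z'‖ = r' / ‖z‖ * |‖z'‖ - ‖z‖| := by
      field_simp
    rw [h4]
    refine (mul_le_of_le_one_left (abs_nonneg _) ?_).trans ?_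
    · rw [div_le_one hz0]; linarith
    · rw [abs_sub_comm]; exact abs_norm_sub_norm_le z z'
  linarith

lemma lipschitzOnWith_gnomonic {e : EuclideanSpace ℝ (Fin n)} (he : ‖e‖ = 1) :
    LipschitzOnWith 3 (gnomonic e) (Icc 0 1 ×ˢ univ) := by
  refine LipschitzOnWith.of_dist_le_mul fun a ha b hb => ?_
  rw [dist_eq_norm]
  refine (norm_smul_sub_smul_le hb.1.1 hb.1.2 (one_le_norm_add_orthogonal he a.2)
    (one_le_norm_add_orthogonal he b.2)).trans ?_
  have h1 : |a.1 - b.1| ≤ dist a b := le_max_left _ _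
  have h2 : ‖e + (a.2 : EuclideanSpace ℝ (Fin n)) - (e + (b.2 : EuclideanSpace ℝ (Fin n)))‖ ≤
      dist a b := by
    rw [add_sub_add_left_eq_sub]
    have : dist a.2 b.2 ≤ dist a b := le_max_right _ _
    rwa [dist_eq_norm] at this
  push_cast
  linarith

lemma exists_lipschitzOnWith_gnomonicInv {e : EuclideanSpace ℝ (Fin n)} (he : ‖e‖ = 1) {c : ℝ}
    (hc : 0 < c) : ∃ K : ℝ≥0, LipschitzOnWith K (gnomonicInv e)
      {x | ‖x‖ ≤ 1 ∧ c ≤ inner ℝ e x} := by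
  refine ⟨(1 + 1 / c + 1 / c ^ 2).toNNReal,
    LipschitzOnWith.of_dist_le_mul fun x hx x' hx' => ?_⟩
  have hP : ∀ z, ‖(ℝ ∙ e)ᗮ.orthogonalProjectionOnto z‖ ≤ ‖z‖ := fun z =>
    Submodule.norm_orthogonalProjectionOnto_apply_le _ z
  set a := inner ℝ e x with ha
  set b := inner ℝ e x' with hb
  have ha0 : c ≤ a := hx.2
  have hb0 : c ≤ b := hx'.2
  have ha1 : 0 < a := hc.trans_le ha0
  have hb1 : 0 < b := hc.trans_le hb0
  rw [Prod.dist_eq, dist_eq_norm x x', Real.coe_toNNReal _ (by positivity)]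
  have hq : 0 ≤ 1 / c := by positivity
  have hq2 : 0 ≤ 1 / c ^ 2 := by positivity
  refine max_le ?_ ?_
  · refine (abs_norm_sub_norm_le x x').trans ?_
    exact le_mul_of_one_le_left (norm_nonneg _) (by linarith)
  · simp only [gnomonicInv]
    rw [dist_eq_norm, ← ha, ← hb]
    have e1 : a⁻¹ • (ℝ ∙ e)ᗮ.orthogonalProjectionOnto x -
        b⁻¹ • (ℝ ∙ e)ᗮ.orthogonalProjectionOnto x' =
        a⁻¹ • (ℝ ∙ e)ᗮ.orthogonalProjectionOnto (x - x') +
        ((b - a) / (a * b)) • (ℝ ∙ e)ᗮ.orthogonalProjectionOnto x' := by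
      have : (b - a) / (a * b) = a⁻¹ - b⁻¹ := by field_simp
      rw [this, map_sub, sub_smul, smul_sub]; abel
    rw [e1]
    refine (norm_add_le _ _).trans ?_
    have h1 : ‖a⁻¹ • (ℝ ∙ e)ᗮ.orthogonalProjectionOnto (x - x')‖ ≤ 1 / c * ‖x - x'‖ := by
      rw [norm_smul, norm_inv, Real.norm_eq_abs, abs_of_pos ha1, one_div]
      exact mul_le_mul (inv_anti₀ hc ha0) (hP _) (norm_nonneg _) (by positivity)
    have h2 : |b - a| ≤ ‖x - x'‖ := by
      rw [hb, ha, ← inner_sub_right, norm_sub_rev]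
      refine (abs_real_inner_le_norm _ _).trans ?_
      rw [he, one_mul]
    have h3 : ‖((b - a) / (a * b)) • (ℝ ∙ e)ᗮ.orthogonalProjectionOnto x'‖ ≤
        1 / c ^ 2 * ‖x - x'‖ := by
      rw [norm_smul, Real.norm_eq_abs, abs_div, abs_of_pos (mul_pos ha1 hb1)]
      calc |b - a| / (a * b) * ‖(ℝ ∙ e)ᗮ.orthogonalProjectionOnto x'‖
          ≤ |b - a| / (a * b) * 1 := by gcongr; exact (hP _).trans hx'.1
        _ ≤ ‖x - x'‖ / (c ^ 2) := by
          rw [mul_one, sq]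
          gcongr
        _ = _ := by ring
    have h4 := norm_nonneg (x - x')
    nlinarith

/-- The image of a cylinder under the gnomonic chart. -/
lemma inner_gnomonic_ge {e : EuclideanSpace ℝ (Fin n)} (he : ‖e‖ = 1) {R : ℝ}
    {z : ℝ × (ℝ ∙ e)ᗮ} (hz1 : 1 / 2 ≤ z.1) (hz2 : ‖z.2‖ ≤ R) :
    1 / (2 * (1 + R)) ≤ inner ℝ e (gnomonic e z) := by
  rw [inner_gnomonic he]
  have h := one_le_norm_add_orthogonal he z.2
  have h2 : ‖e + (z.2 : EuclideanSpace ℝ (Fin n))‖ ≤ 1 + R := by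
    refine (norm_add_le _ _).trans ?_
    rw [he]
    have : ‖(z.2 : EuclideanSpace ℝ (Fin n))‖ = ‖z.2‖ := rfl
    linarith
  have hR : 0 < 1 + R := by linarith
  rw [div_le_div_iff₀ (by positivity) (by linarith)]
  nlinarith

lemma norm_gnomonicInv_snd_le {e : EuclideanSpace ℝ (Fin n)} {R : ℝ} {x : EuclideanSpace ℝ (Fin n)}
    (hx : 0 < inner ℝ e x) (hxR : ‖x‖ ≤ R * inner ℝ e x) : ‖(gnomonicInv e x).2‖ ≤ R := by
  simp only [gnomonicInv]
  rw [norm_smul, norm_inv, Real.norm_eq_abs, abs_of_pos hx]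
  have := Submodule.norm_orthogonalProjectionOnto_apply_le (ℝ ∙ e)ᗮ x
  rw [inv_mul_le_iff₀ hx, mul_comm]
  linarith

/-- Every vector lies in the cone around some signed coordinate direction. -/
lemma exists_norm_le_mul_inner (hn : 0 < n) (x : EuclideanSpace ℝ (Fin n)) :
    ∃ i : Fin n, ∃ b : Bool,
      ‖x‖ ≤ n * inner ℝ ((if b then (1 : ℝ) else -1) • EuclideanSpace.single i (1 : ℝ)) x := by
  have : Nonempty (Fin n) := ⟨⟨0, hn⟩⟩
  obtain ⟨i, hi⟩ := Finite.exists_max fun i => |x i|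
  have h1 : ‖x‖ ≤ n * |x i| := by
    have h2 : ‖x‖ ≤ ∑ j, |x j| := by
      have h3 : x = ∑ j, x j • EuclideanSpace.single j (1 : ℝ) := by
        ext l; simp [Finset.sum_apply, Pi.single_apply]
      conv_lhs => rw [h3]
      refine (norm_sum_le _ _).trans (le_of_eq ?_)
      simp [norm_smul]
    refine h2.trans ((Finset.sum_le_sum fun j _ => hi j).trans (le_of_eq ?_))
    simp
  rcases le_total 0 (x i) with h | h
  · refine ⟨i, true, ?_⟩
    rw [abs_of_nonneg h] at h1
    simpa [inner_smul_left, EuclideanSpace.inner_single_left] using h1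
  · refine ⟨i, false, ?_⟩
    rw [abs_of_nonpos h] at h1
    simpa [inner_smul_left, EuclideanSpace.inner_single_left] using h1

end gnomonic
/-! ### Sobolev inequality for compactly supported functions -/

section sobolev

variable {Y : Type*} [NormedAddCommGroup Y] [InnerProductSpace ℝ Y] [FiniteDimensional ℝ Y]
  [MeasurableSpace Y] [BorelSpace Y]

lemma exists_sobolev_of_lt {q s : ℝ} (hs : 1 ≤ s) (hq : 0 < q)
    (hsm : s < Module.finrank ℝ Y) (hsq : 1 / s - 1 / (Module.finrank ℝ Y : ℝ) ≤ 1 / q) (R : ℝ) :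
    ∃ C : ℝ≥0, ∀ V : Y → ℝ, ContDiff ℝ 1 V → Function.support V ⊆ closedBall 0 R →
      (∫⁻ y, ‖V y‖ₑ ^ q) ^ (s / q) ≤ C * ∫⁻ y, ‖fderiv ℝ V y‖ₑ ^ s := by
  have hs0 : 0 < s := by linarith
  lift s to ℝ≥0 using hs0.le
  lift q to ℝ≥0 using hq.le
  refine ⟨eLpNormLESNormFDerivOfLeConst ℝ (volume : Measure Y) (closedBall 0 R) s q ^ (s : ℝ),
    fun V hV hsupp => ?_⟩
  have h := eLpNorm_le_eLpNorm_fderiv_of_le (volume : Measure Y) hV hsupp (p := s) (q := q)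
    (by exact_mod_cast hs) (by exact_mod_cast hsm) (by
      simpa [one_div] using hsq) isBounded_closedBall
  have hq' : (q : ℝ≥0∞) ≠ 0 := by
    simpa using (show (q : ℝ) ≠ 0 from hq.ne')
  have hs' : (s : ℝ≥0∞) ≠ 0 := by
    simpa using (show (s : ℝ) ≠ 0 from hs0.ne')
  rw [eLpNorm_eq_lintegral_rpow_enorm_toReal hq' (by simp),
    eLpNorm_eq_lintegral_rpow_enorm_toReal hs' (by simp)] at h
  simp only [ENNReal.coe_toReal] at h
  have h2 := ENNReal.rpow_le_rpow h hs0.le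
  rw [ENNReal.mul_rpow_of_nonneg _ _ hs0.le, ← ENNReal.rpow_mul, ← ENNReal.rpow_mul,
    one_div_mul_cancel hs0.ne', ENNReal.rpow_one, one_div_mul_eq_div,
    ← ENNReal.coe_rpow_of_nonneg _ hs0.le] at h2
  exact h2

lemma enorm_le_lintegral_fderiv_of_finrank_eq_one (hY : Module.finrank ℝ Y = 1) {V : Y → ℝ}
    (hV : ContDiff ℝ 1 V) (hc : HasCompactSupport V) (y : Y) :
    ‖V y‖ₑ ≤ ∫⁻ z, ‖fderiv ℝ V z‖ₑ := by
  have hr' : Module.finrank ℝ ℝ = Module.finrank ℝ Y := by simp [hY]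
  let T : ℝ ≃ₗᵢ[ℝ] Y := (stdOrthonormalBasis ℝ ℝ).equiv (stdOrthonormalBasis ℝ Y) (finCongr hr')
  have hW : ContDiff ℝ 1 (V ∘ T) := hV.comp T.contDiff
  have hWc : HasCompactSupport (V ∘ T) := hc.comp_homeomorph T.toHomeomorph
  have h := hWc.enorm_le_lintegral_Ici_deriv hW (T.symm y)
  simp only [Function.comp_apply, LinearIsometryEquiv.apply_symm_apply] at h
  refine h.trans ((setLIntegral_le_lintegral _ _).trans ?_)
  rw [← T.measurePreserving.lintegral_comp
    (hV.continuous_fderiv (by simp)).enorm.measurable]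
  refine lintegral_mono fun t => ?_
  have h1 : HasDerivAt (V ∘ T) (fderiv ℝ V (T t) (T 1)) t := by
    have h2 := (hV.differentiable (by simp) (T t)).hasFDerivAt
    have h3 : HasDerivAt T (T 1) t := (T : ℝ →L[ℝ] Y).hasDerivAt
    exact h2.comp_hasDerivAt t h3
  rw [h1.deriv, enorm_le_iff_norm_le]
  refine (ContinuousLinearMap.le_opNorm _ _).trans ?_
  simp

lemma exists_sobolev_of_finrank_eq_one (hY : Module.finrank ℝ Y = 1) {q : ℝ} (hq : 0 < q)
    (R : ℝ) :
    ∃ C : ℝ≥0, ∀ V : Y → ℝ, ContDiff ℝ 1 V → Function.support V ⊆ closedBall 0 R →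
      (∫⁻ y, ‖V y‖ₑ ^ q) ^ (1 / q) ≤ C * ∫⁻ y, ‖fderiv ℝ V y‖ₑ := by
  refine ⟨((volume (closedBall (0 : Y) R)) ^ (1 / q)).toNNReal, fun V hV hsupp => ?_⟩
  have hfin : (volume (closedBall (0 : Y) R)) ^ (1 / q) ≠ ∞ :=
    ENNReal.rpow_ne_top_of_nonneg (by positivity) measure_closedBall_lt_top.ne
  rw [ENNReal.coe_toNNReal hfin]
  have hc : HasCompactSupport V :=
    HasCompactSupport.intro (isCompact_closedBall 0 R) fun x hx => by
      by_contra h; exact hx (hsupp h)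
  have h1 : ∫⁻ y, ‖V y‖ₑ ^ q ≤ (∫⁻ z, ‖fderiv ℝ V z‖ₑ) ^ q * volume (closedBall (0 : Y) R) := by
    rw [← setLIntegral_const, ← lintegral_indicator measurableSet_closedBall]
    refine lintegral_mono fun y => ?_
    by_cases hy : y ∈ closedBall (0 : Y) R
    · rw [indicator_of_mem hy]
      exact ENNReal.rpow_le_rpow (enorm_le_lintegral_fderiv_of_finrank_eq_one hY hV hc y) hq.le
    · have : V y = 0 := by
        by_contra h; exact hy (hsupp h)
      simp [this, hq]
  refine (ENNReal.rpow_le_rpow h1 (by positivity)).trans (le_of_eq ?_)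
  rw [ENNReal.mul_rpow_of_nonneg _ _ (by positivity), ← ENNReal.rpow_mul, mul_one_div_cancel hq.ne',
    ENNReal.rpow_one, mul_comm]

lemma exists_sobolev {q s : ℝ} (hs : 1 ≤ s) (hq : 0 < q)
    (hsm : s < Module.finrank ℝ Y ∨ Module.finrank ℝ Y = 1 ∧ s = 1)
    (hsq : 1 / s - 1 / (Module.finrank ℝ Y : ℝ) ≤ 1 / q) (R : ℝ) :
    ∃ C : ℝ≥0, ∀ V : Y → ℝ, ContDiff ℝ 1 V → Function.support V ⊆ closedBall 0 R →
      (∫⁻ y, ‖V y‖ₑ ^ q) ^ (s / q) ≤ C * ∫⁻ y, ‖fderiv ℝ V y‖ₑ ^ s := by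
  rcases hsm with h | ⟨h, rfl⟩
  · exact exists_sobolev_of_lt hs hq h hsq R
  · simpa using exists_sobolev_of_finrank_eq_one h hq R

/-- Local Sobolev inequality. -/
lemma exists_local_sobolev {q s : ℝ} (hs : 1 ≤ s) (hq : 0 < q)
    (hsm : s < Module.finrank ℝ Y ∨ Module.finrank ℝ Y = 1 ∧ s = 1)
    (hsq : 1 / s - 1 / (Module.finrank ℝ Y : ℝ) ≤ 1 / q) {R : ℝ} (hR : 0 < R) :
    ∃ C : ℝ≥0, ∀ (V : Y → ℝ) (D : Y → ℝ), ContDiff ℝ 1 V → (∀ y, ‖fderiv ℝ V y‖ ≤ D y) →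
      Measurable D →
      (∫⁻ y in closedBall 0 R, ‖V y‖ₑ ^ q) ^ (s / q) ≤
        C * ∫⁻ y in closedBall 0 (R + 1), (‖V y‖ₑ ^ s + ‖D y‖ₑ ^ s) := by
  obtain ⟨C, hC⟩ := exists_sobolev (Y := Y) hs hq hsm hsq (R + 1)
  have hs0 : 0 < s := by linarith
  let χ : ContDiffBump (0 : Y) := ⟨R, R + 1, hR, by linarith⟩
  have hχ : ContDiff ℝ 1 χ := χ.contDiff
  have hχc : HasCompactSupport χ := χ.hasCompactSupport
  obtain ⟨B, hB⟩ : ∃ B : ℝ, ∀ y, ‖fderiv ℝ χ y‖ ≤ B := by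
    obtain ⟨B, hB⟩ := (hχc.fderiv ℝ).exists_bound_of_continuous (hχ.continuous_fderiv (by simp))
    exact ⟨B, hB⟩
  have hB0 : 0 ≤ B := (norm_nonneg _).trans (hB 0)
  obtain ⟨B', hB'⟩ : ∃ B' : ℝ≥0, (B' : ℝ) = B := ⟨⟨B, hB0⟩, rfl⟩
  refine ⟨C * (2 ^ (s - 1) * (1 + B' ^ s)), fun V D hV hVD hD => ?_⟩
  set W : Y → ℝ := fun y => χ y * V y with hW
  have hWsupp : Function.support W ⊆ closedBall 0 (R + 1) := by
    intro y hy
    have : χ y ≠ 0 := left_ne_zero_of_mul hy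
    have h2 : y ∈ Function.support χ := this
    rw [χ.support_eq] at h2
    exact ball_subset_closedBall h2
  have hWd : ContDiff ℝ 1 W := hχ.mul hV
  have h1 := hC W hWd hWsupp
  have h2 : ∫⁻ y in closedBall 0 R, ‖V y‖ₑ ^ q ≤ ∫⁻ y, ‖W y‖ₑ ^ q := by
    refine le_trans (le_of_eq (setLIntegral_congr_fun measurableSet_closedBall fun y hy => ?_))
      (setLIntegral_le_lintegral _ _)
    have : χ y = 1 := χ.one_of_mem_closedBall hy
    simp [hW, this]
  have h3 : ∀ y, ‖fderiv ℝ W y‖ₑ ^ s ≤ (closedBall (0 : Y) (R + 1)).indicator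
      (fun y => (2 ^ (s - 1) * (1 + (B' : ℝ≥0∞) ^ s)) * (‖V y‖ₑ ^ s + ‖D y‖ₑ ^ s)) y := by
    intro y
    by_cases hy : y ∈ closedBall (0 : Y) (R + 1)
    · rw [indicator_of_mem hy]
      have h4 : ‖fderiv ℝ W y‖ ≤ |D y| + B * |V y| := by
        rw [hW, fderiv_fun_mul (hχ.differentiable (by simp) y) (hV.differentiable (by simp) y)]
        refine (norm_add_le _ _).trans ?_
        rw [norm_smul, norm_smul]
        have h5 : ‖χ y‖ ≤ 1 := by
          rw [Real.norm_eq_abs, abs_of_nonneg χ.nonneg]; exact χ.le_one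
        have h6 := (hVD y).trans (le_abs_self _)
        have h7 := mul_le_mul h5 h6 (norm_nonneg _) zero_le_one
        have h8 := mul_le_mul_of_nonneg_left (hB y) (norm_nonneg (V y))
        rw [Real.norm_eq_abs (V y)] at h8
        rw [Real.norm_eq_abs (V y)]
        linarith
      have h5 : ‖fderiv ℝ W y‖ₑ ≤ ‖D y‖ₑ + B' * ‖V y‖ₑ := by
        rw [← ofReal_norm, ← ofReal_norm, ← ofReal_norm (V y), Real.norm_eq_abs (D y),
          Real.norm_eq_abs (V y),
          show (B' : ℝ≥0∞) = ENNReal.ofReal B by rw [← hB', ENNReal.ofReal_coe_nnreal],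
          ← ENNReal.ofReal_mul hB0, ← ENNReal.ofReal_add (abs_nonneg _) (by positivity)]
        exact ENNReal.ofReal_le_ofReal h4
      calc ‖fderiv ℝ W y‖ₑ ^ s ≤ (‖D y‖ₑ + B' * ‖V y‖ₑ) ^ s := ENNReal.rpow_le_rpow h5 hs0.le
        _ ≤ 2 ^ (s - 1) * (‖D y‖ₑ ^ s + (B' * ‖V y‖ₑ) ^ s) :=
          ENNReal.rpow_add_le_mul_rpow_add_rpow _ _ hs
        _ = 2 ^ (s - 1) * (‖D y‖ₑ ^ s + (B' : ℝ≥0∞) ^ s * ‖V y‖ₑ ^ s) := by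
          rw [ENNReal.mul_rpow_of_nonneg _ _ hs0.le]
        _ ≤ 2 ^ (s - 1) * ((1 + (B' : ℝ≥0∞) ^ s) * ‖D y‖ₑ ^ s +
            (1 + (B' : ℝ≥0∞) ^ s) * ‖V y‖ₑ ^ s) := by
          gcongr
          · exact le_mul_of_one_le_left' le_self_add
          · exact le_add_self
        _ = _ := by ring
    · have : fderiv ℝ W y = 0 := by
        have h4 : y ∉ tsupport W := fun h => hy
          (closure_minimal hWsupp isClosed_closedBall h)
        exact Function.notMem_support.1 fun h => h4 (support_fderiv_subset ℝ h)
      have h6 : ‖fderiv ℝ W y‖ₑ = 0 := by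
        rw [← ofReal_norm, this, norm_zero, ENNReal.ofReal_zero]
      rw [h6, ENNReal.zero_rpow_of_pos hs0]
      exact zero_le
  calc (∫⁻ y in closedBall 0 R, ‖V y‖ₑ ^ q) ^ (s / q)
      ≤ (∫⁻ y, ‖W y‖ₑ ^ q) ^ (s / q) := ENNReal.rpow_le_rpow h2 (by positivity)
    _ ≤ C * ∫⁻ y, ‖fderiv ℝ W y‖ₑ ^ s := h1
    _ ≤ C * ∫⁻ y in closedBall 0 (R + 1), (2 ^ (s - 1) * (1 + (B' : ℝ≥0∞) ^ s)) *
        (‖V y‖ₑ ^ s + ‖D y‖ₑ ^ s) := by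
      gcongr C * ?_
      rw [← lintegral_indicator measurableSet_closedBall]
      exact lintegral_mono h3
    _ = _ := by
      have hm : Measurable fun y => ‖V y‖ₑ ^ s + ‖D y‖ₑ ^ s :=
        (hV.continuous.enorm.measurable.pow_const s).add (hD.enorm.pow_const s)
      rw [lintegral_const_mul _ hm, ← mul_assoc]
      congr 1
      push_cast
      rw [ENNReal.coe_rpow_of_nonneg _ (by linarith), ENNReal.coe_rpow_of_nonneg _ hs0.le]
      simp

end sobolev
/-! ### Sobolev inequality on spheres, integrated over radii -/

section spheres

variable {n : ℕ}

lemma finrank_orthogonal_eq (hn : 2 ≤ n) {e : EuclideanSpace ℝ (Fin n)} (he : ‖e‖ = 1) :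
    Module.finrank ℝ (ℝ ∙ e)ᗮ = n - 1 := by
  have : Fact (Module.finrank ℝ (EuclideanSpace ℝ (Fin n)) = (n - 1) + 1) := ⟨by simp; omega⟩
  exact Submodule.finrank_orthogonal_span_singleton (norm_pos_iff.1 (by rw [he]; exact one_pos))

lemma contDiff_gnomonic_snd {e : EuclideanSpace ℝ (Fin n)} (he : ‖e‖ = 1) (r : ℝ) :
    ContDiff ℝ 1 fun y : (ℝ ∙ e)ᗮ => gnomonic e (r, y) := by
  have h1 : ContDiff ℝ 1 fun y : (ℝ ∙ e)ᗮ => e + (y : EuclideanSpace ℝ (Fin n)) :=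
    contDiff_const.add (ℝ ∙ e)ᗮ.subtypeL.contDiff
  have h2 : ∀ y : (ℝ ∙ e)ᗮ, e + (y : EuclideanSpace ℝ (Fin n)) ≠ 0 := fun y h => by
    have := one_le_norm_add_orthogonal he y
    rw [h, norm_zero] at this
    linarith
  exact (contDiff_const.div (h1.norm ℝ h2) fun y => norm_ne_zero_iff.2 (h2 y)).smul h1

lemma exists_sphere_sobolev (hn : 2 ≤ n) {q s : ℝ} (hs : 1 ≤ s) (hq : 0 < q)
    (hsn : s < (n : ℝ) - 1 ∨ n = 2 ∧ s = 1) (hsq : 1 / s - 1 / ((n : ℝ) - 1) ≤ 1 / q)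
    {e : EuclideanSpace ℝ (Fin n)} (he : ‖e‖ = 1) {R : ℝ} (hR : 0 < R) :
    ∃ C : ℝ≥0, ∀ (v : EuclideanSpace ℝ (Fin n) → ℝ)
      (dv : EuclideanSpace ℝ (Fin n) → EuclideanSpace ℝ (Fin n)), ContDiff ℝ (⊤ : ℕ∞) v →
      Continuous dv → ∀ r : ℝ, 0 ≤ r → r ≤ 1 →
      (∀ x, ‖x‖ = r → HasFDerivAt v (innerSL ℝ (dv x)) x) →
      (∫⁻ y in closedBall (0 : (ℝ ∙ e)ᗮ) R, ‖v (gnomonic e (r, y))‖ₑ ^ q) ^ (s / q) ≤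
        C * ∫⁻ y in closedBall (0 : (ℝ ∙ e)ᗮ) (R + 1),
          (‖v (gnomonic e (r, y))‖ₑ ^ s + ‖dv (gnomonic e (r, y))‖ₑ ^ s) := by
  have hfr := finrank_orthogonal_eq hn he
  have hcast : ((n - 1 : ℕ) : ℝ) = (n : ℝ) - 1 := by
    rw [Nat.cast_sub (by omega)]; simp
  have hs0 : 0 < s := by linarith
  obtain ⟨C, hC⟩ := exists_local_sobolev (Y := (ℝ ∙ e)ᗮ) hs hq
    (by
      rw [hfr, hcast]
      refine hsn.imp id fun h => ⟨by omega, h.2⟩) (by rw [hfr, hcast]; exact hsq) hR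
  refine ⟨C * 3 ^ s, fun v dv hv hdv r hr0 hr1 hd => ?_⟩
  have hg := contDiff_gnomonic_snd he r
  have hgl : LipschitzWith 3 fun y : (ℝ ∙ e)ᗮ => gnomonic e (r, y) := by
    refine LipschitzWith.of_dist_le_mul fun y y' => ?_
    have := (lipschitzOnWith_gnomonic he).dist_le_mul (r, y) ⟨⟨hr0, hr1⟩, mem_univ _⟩ (r, y')
      ⟨⟨hr0, hr1⟩, mem_univ _⟩
    rwa [dist_prod_same_left] at this
  have hV : ContDiff ℝ 1 fun y : (ℝ ∙ e)ᗮ => v (gnomonic e (r, y)) :=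
    (hv.of_le (by exact_mod_cast le_top)).comp hg
  have h := hC (fun y => v (gnomonic e (r, y))) (fun y => 3 * ‖dv (gnomonic e (r, y))‖) hV ?_
    (((hdv.comp hg.continuous).norm.const_mul 3).measurable)
  · refine h.trans ?_
    rw [ENNReal.coe_mul, mul_assoc]
    gcongr C * ?_
    rw [← lintegral_const_mul']
    · refine lintegral_mono fun y => ?_
      rw [mul_add, enorm_mul, enorm_norm, ENNReal.mul_rpow_of_nonneg _ _ hs0.le,
        ENNReal.coe_rpow_of_nonneg _ hs0.le]
      have h3 : ‖(3 : ℝ)‖ₑ = ((3 : ℝ≥0) : ℝ≥0∞) := by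
        rw [← ofReal_norm, Real.norm_ofNat]; simp
      rw [h3]
      gcongr
      refine le_mul_of_one_le_left' ?_
      exact ENNReal.one_le_rpow (by norm_num) hs0
    · simp
  · intro y
    have hn1 : ‖gnomonic e (r, y)‖ = r := norm_gnomonic he (r, y) hr0
    have h1 := (hd _ hn1).comp y (hg.differentiable (by simp) y).hasFDerivAt
    change ‖fderiv ℝ (v ∘ fun y : (ℝ ∙ e)ᗮ => gnomonic e (r, y)) y‖ ≤ _
    rw [h1.fderiv]
    refine (ContinuousLinearMap.opNorm_comp_le _ _).trans ?_
    rw [innerSL_apply_norm, mul_comm]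
    gcongr
    exact_mod_cast norm_fderiv_le_of_lipschitz ℝ hgl

lemma exists_lintegral_radii_le (hn : 2 ≤ n) {q s : ℝ} (hs : 1 ≤ s) (hq : 0 < q)
    (hsn : s < (n : ℝ) - 1 ∨ n = 2 ∧ s = 1) (hsq : 1 / s - 1 / ((n : ℝ) - 1) ≤ 1 / q)
    {e : EuclideanSpace ℝ (Fin n)} (he : ‖e‖ = 1) {R : ℝ} (hR : 0 < R) :
    ∃ C : ℝ≥0, ∀ (w : EuclideanSpace ℝ (Fin n) → ℝ)
      (dw : EuclideanSpace ℝ (Fin n) → EuclideanSpace ℝ (Fin n)) (ρ σ' σ : ℝ),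
      1 / 2 ≤ ρ → ρ < σ' → σ' < σ → σ ≤ 1 → IsWeakGradOn n (ball 0 σ) w dw →
      IntegrableOn w (ball 0 σ) → IntegrableOn dw (ball 0 σ) → Measurable w →
      ∫⁻ r in Ioo ρ σ', (∫⁻ y in closedBall (0 : (ℝ ∙ e)ᗮ) R,
        ‖w (gnomonic e (r, y))‖ₑ ^ q) ^ (s / q) ≤
        C * ((∫⁻ x in ball 0 σ, ‖w x‖ₑ ^ s) + ∫⁻ x in ball 0 σ, ‖dw x‖ₑ ^ s) := by
  have hs0 : 0 < s := by linarith
  have hsq0 : 0 < s / q := by positivity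
  obtain ⟨C₁, hC₁⟩ := exists_sphere_sobolev hn hs hq hsn hsq he hR
  obtain ⟨K, hK⟩ := exists_lipschitzOnWith_gnomonicInv he (c := 1 / (2 * (1 + (R + 1))))
    (by positivity)
  have hfr : Module.finrank ℝ (ℝ × (ℝ ∙ e)ᗮ) = Module.finrank ℝ (EuclideanSpace ℝ (Fin n)) := by
    rw [Module.finrank_prod, finrank_orthogonal_eq hn he]
    simp; omega
  obtain ⟨C₂, hC₂⟩ := exists_setLIntegral_comp_le
    ((volume : Measure ℝ).prod (volume : Measure (ℝ ∙ e)ᗮ))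
    (volume : Measure (EuclideanSpace ℝ (Fin n))) hfr K
  refine ⟨C₁ * C₂, fun w dw ρ σ' σ hρ hρσ hσ' hσ h hw hdw hwm => ?_⟩
  obtain ⟨v, dv, A⟩ := h.exists_smoothApprox (isCompact_closedBall 0 σ') isOpen_ball
    (closedBall_subset_ball hσ') hw hdw
  set M := (∫⁻ x in ball 0 σ, ‖w x‖ₑ ^ s) + ∫⁻ x in ball 0 σ, ‖dw x‖ₑ ^ s with hM
  have hmg := measurable_gnomonic e
  have hmap := hC₂ (gnomonic e) (gnomonicInv e) (Ioo ρ σ' ×ˢ closedBall 0 (R + 1))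
    (closedBall 0 σ' ∩ {x | 1 / (2 * (1 + (R + 1))) ≤ inner ℝ e x}) hmg
    (hK.mono fun x hx => ⟨(mem_closedBall_zero_iff.1 hx.1).trans (by linarith), hx.2⟩)
    (fun z hz => gnomonicInv_gnomonic he z (by linarith [hz.1.1]))
    (fun z hz => ⟨by
        simp only [mem_closedBall, dist_zero_right]
        rw [norm_gnomonic he z (by linarith [hz.1.1])]
        exact hz.1.2.le,
      inner_gnomonic_ge he (by linarith [hz.1.1]) (by simpa using hz.2)⟩)
  have hmap' : Measure.map (gnomonic e) (((volume : Measure ℝ).prod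
      (volume : Measure (ℝ ∙ e)ᗮ)).restrict (Ioo ρ σ' ×ˢ closedBall 0 (R + 1))) ≤
      (C₂ : ℝ≥0∞) • volume.restrict (closedBall 0 σ') :=
    hmap.trans (by gcongr; exact inter_subset_left)
  have hvm : ∀ j, Measurable fun z : ℝ × (ℝ ∙ e)ᗮ => ‖v j (gnomonic e z)‖ₑ ^ q := fun j =>
    (((A.contDiff j).continuous.measurable.comp hmg).enorm).pow_const q
  have hbound : ∀ j, ∫⁻ r in Ioo ρ σ', (∫⁻ y in closedBall (0 : (ℝ ∙ e)ᗮ) R,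
        ‖v j (gnomonic e (r, y))‖ₑ ^ q) ^ (s / q) ≤ (C₁ * C₂ : ℝ≥0) * M := by
    intro j
    have hFm : Measurable fun x => ‖v j x‖ₑ ^ s + ‖dv j x‖ₑ ^ s :=
      ((A.contDiff j).continuous.enorm.measurable.pow_const s).add
        ((A.continuous j).enorm.measurable.pow_const s)
    have hFgm : Measurable fun z => ‖v j (gnomonic e z)‖ₑ ^ s + ‖dv j (gnomonic e z)‖ₑ ^ s :=
      hFm.comp hmg
    have hFgm' : Measurable fun r => ∫⁻ y in closedBall (0 : (ℝ ∙ e)ᗮ) (R + 1),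
          (‖v j (gnomonic e (r, y))‖ₑ ^ s + ‖dv j (gnomonic e (r, y))‖ₑ ^ s) :=
      hFgm.lintegral_prod_right'
    calc _ ≤ ∫⁻ r in Ioo ρ σ', C₁ * ∫⁻ y in closedBall (0 : (ℝ ∙ e)ᗮ) (R + 1),
          (‖v j (gnomonic e (r, y))‖ₑ ^ s + ‖dv j (gnomonic e (r, y))‖ₑ ^ s) := by
          refine setLIntegral_mono' measurableSet_Ioo fun r hr => ?_
          refine hC₁ (v j) (dv j) (A.contDiff j) (A.continuous j) r (by linarith [hr.1])
            (by linarith [hr.2]) fun x hx => A.hasFDerivAt j x ?_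
          simp only [mem_closedBall, dist_zero_right]
          linarith [hr.2]
      _ = C₁ * ∫⁻ z in Ioo ρ σ' ×ˢ closedBall (0 : (ℝ ∙ e)ᗮ) (R + 1),
          (‖v j (gnomonic e z)‖ₑ ^ s + ‖dv j (gnomonic e z)‖ₑ ^ s)
            ∂((volume : Measure ℝ).prod (volume : Measure (ℝ ∙ e)ᗮ)) := by
          rw [lintegral_const_mul _ hFgm', ← Measure.prod_restrict, lintegral_prod _ hFgm.aemeasurable]
      _ ≤ C₁ * (C₂ * ∫⁻ x in closedBall 0 σ', (‖v j x‖ₑ ^ s + ‖dv j x‖ₑ ^ s)) := by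
          gcongr C₁ * ?_
          exact setLIntegral_comp_le_of_map_le hmg hmap' hFm
      _ ≤ C₁ * (C₂ * M) := by
          gcongr C₁ * (C₂ * ?_)
          rw [lintegral_add_left ((A.contDiff j).continuous.enorm.measurable.pow_const s)]
          exact add_le_add (A.lintegral_le j s hs) (A.lintegral_grad_le j s hs)
      _ = _ := by rw [ENNReal.coe_mul, mul_assoc]
  have hae : ∀ᵐ r ∂volume.restrict (Ioo ρ σ'), ∀ᵐ y ∂volume.restrict (closedBall (0 : (ℝ ∙ e)ᗮ) R),
      Filter.Tendsto (fun j => v j (gnomonic e (r, y))) Filter.atTop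
        (𝓝 (w (gnomonic e (r, y)))) := by
    have h1 := ae_comp_of_map_le hmg hmap' A.ae_tendsto
    rw [← Measure.prod_restrict] at h1
    filter_upwards [Measure.ae_ae_of_ae_prod h1] with r hr
    exact ae_restrict_of_ae_restrict_of_subset (closedBall_subset_closedBall (by linarith)) hr
  calc _ ≤ ∫⁻ r in Ioo ρ σ', Filter.liminf (fun j => (∫⁻ y in closedBall (0 : (ℝ ∙ e)ᗮ) R,
        ‖v j (gnomonic e (r, y))‖ₑ ^ q) ^ (s / q)) Filter.atTop := by
        refine lintegral_mono_ae (hae.mono fun r hr => ?_)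
        have h1 : ∫⁻ y in closedBall (0 : (ℝ ∙ e)ᗮ) R, ‖w (gnomonic e (r, y))‖ₑ ^ q ≤
            Filter.liminf (fun j => ∫⁻ y in closedBall (0 : (ℝ ∙ e)ᗮ) R,
              ‖v j (gnomonic e (r, y))‖ₑ ^ q) Filter.atTop := by
          refine le_trans ?_ (lintegral_liminf_le fun j =>
            (hvm j).comp (measurable_const.prodMk measurable_id : Measurable fun y => (r, y)))
          refine lintegral_mono_ae (hr.mono fun y hy => le_of_eq ?_)
          exact (((ENNReal.continuous_rpow_const.tendsto _).comp hy.enorm).liminf_eq).symm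
        refine (ENNReal.rpow_le_rpow h1 hsq0.le).trans (le_of_eq ?_)
        exact OrderIso.liminf_apply (ENNReal.orderIsoRpow (s / q) hsq0)
    _ ≤ Filter.liminf (fun j => ∫⁻ r in Ioo ρ σ', (∫⁻ y in closedBall (0 : (ℝ ∙ e)ᗮ) R,
        ‖v j (gnomonic e (r, y))‖ₑ ^ q) ^ (s / q)) Filter.atTop :=
        lintegral_liminf_le fun j => ((hvm j).lintegral_prod_right').pow_const _
    _ ≤ _ := by
        refine Filter.liminf_le_of_le (by isBoundedDefault) fun b hb => ?_
        obtain ⟨j, hj⟩ := hb.exists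
        exact hj.trans (hbound j)

end spheres

section cutoff

variable {n : ℕ}

/-- A cutoff profile whose derivative lives on a prescribed compact set of radii. -/
lemma exists_profile {T : Set ℝ} (hT : IsCompact T) (hT0 : 0 < volume.real T) {ρ σ : ℝ}
    (hTs : T ⊆ Ioo ρ σ) :
    ∃ ψ : ℝ → ℝ, LipschitzWith (Real.toNNReal (1 / volume.real T)) ψ ∧
      (∀ r, 0 ≤ ψ r ∧ ψ r ≤ 1) ∧ (∀ r ≤ ρ, ψ r = 1) ∧ (∀ r, σ ≤ r → ψ r = 0) ∧
      ∀ r ∉ T, ∀ᶠ r' in 𝓝 r, ψ r' = ψ r := by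
  have hfin : volume T ≠ ∞ := hT.measure_lt_top.ne
  refine ⟨fun r => 1 - volume.real (T ∩ Iic r) / volume.real T, ?_, fun r => ?_, fun r hr => ?_,
    fun r hr => ?_, fun r hr => ?_⟩
  · have key : ∀ a b, a ≤ b → volume.real (T ∩ Iic a) ≤ volume.real (T ∩ Iic b) ∧
        volume.real (T ∩ Iic b) ≤ volume.real (T ∩ Iic a) + (b - a) := by
      intro a b hab
      refine ⟨measureReal_mono (inter_subset_inter_right _ (Iic_subset_Iic.2 hab))
        (measure_ne_top_of_subset inter_subset_left hfin), ?_⟩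
      calc volume.real (T ∩ Iic b) ≤ volume.real ((T ∩ Iic a) ∪ Ioc a b) := by
            refine measureReal_mono (fun x hx => ?_)
              (measure_union_ne_top (measure_ne_top_of_subset inter_subset_left hfin) (by simp))
            rcases le_or_gt x a with h | h
            · exact Or.inl ⟨hx.1, h⟩
            · exact Or.inr ⟨h, hx.2⟩
        _ ≤ volume.real (T ∩ Iic a) + volume.real (Ioc a b) := measureReal_union_le _ _
        _ = _ := by rw [Real.volume_real_Ioc_of_le hab]
    refine LipschitzWith.of_dist_le_mul fun a b => ?_
    rw [Real.coe_toNNReal _ (by positivity), Real.dist_eq, Real.dist_eq]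
    have e : 1 - volume.real (T ∩ Iic a) / volume.real T -
        (1 - volume.real (T ∩ Iic b) / volume.real T) =
        1 / volume.real T * (volume.real (T ∩ Iic b) - volume.real (T ∩ Iic a)) := by ring
    rw [e, abs_mul, abs_of_nonneg (by positivity : 0 ≤ 1 / volume.real T)]
    refine mul_le_mul_of_nonneg_left ?_ (by positivity)
    rcases le_total a b with h | h
    · obtain ⟨h1, h2⟩ := key a b h
      rw [abs_of_nonneg (by linarith), abs_sub_comm, abs_of_nonneg (by linarith)]
      linarith
    · obtain ⟨h1, h2⟩ := key b a h
      rw [abs_sub_comm, abs_of_nonneg (by linarith), abs_of_nonneg (by linarith)]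
      linarith
  · have h1 : volume.real (T ∩ Iic r) ≤ volume.real T := measureReal_mono inter_subset_left hfin
    have h2 : volume.real (T ∩ Iic r) / volume.real T ≤ 1 := div_le_one_of_le₀ h1 hT0.le
    have h3 : 0 ≤ volume.real (T ∩ Iic r) / volume.real T := by positivity
    constructor <;> linarith
  · have : T ∩ Iic r = ∅ := by
      ext x
      simp only [mem_inter_iff, mem_Iic, mem_empty_iff_false, iff_false, not_and, not_le]
      exact fun hx => hr.trans_lt (hTs hx).1
    simp [this]
  · have : T ∩ Iic r = T := inter_eq_left.2 fun x hx => (hTs hx).2.le.trans hr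
    simp [this, hT0.ne']
  · obtain ⟨δ, hδ, hb⟩ := Metric.isOpen_iff.1 hT.isClosed.isOpen_compl r hr
    filter_upwards [ball_mem_nhds r hδ] with r' hr'
    have : T ∩ Iic r' = T ∩ Iic r := by
      ext x
      simp only [mem_inter_iff, mem_Iic, and_congr_right_iff]
      intro hx
      have hx' : δ ≤ |x - r| := by
        by_contra hc
        exact hb (by rw [mem_ball, Real.dist_eq]; linarith) hx
      rw [mem_ball, Real.dist_eq, abs_lt] at hr'
      rcases le_abs'.1 hx' with h | h
      · exact ⟨fun _ => by linarith, fun _ => by linarith⟩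
      · exact ⟨fun _ => by linarith, fun _ => by linarith⟩
    simp only [this]

/-- A radial cutoff whose gradient lives on a prescribed compact set of radii. -/
lemma exists_radial_cutoff {E : Type*} [NormedAddCommGroup E] [NormedSpace ℝ E]
    {T : Set ℝ} (hT : IsCompact T) (hT0 : 0 < volume.real T)
    {ρ σ : ℝ} (hTs : T ⊆ Ioo ρ σ) :
    ∃ η : E → ℝ, (∃ D, LipschitzWith D η) ∧
      (∀ x, 0 ≤ η x ∧ η x ≤ 1) ∧ (∀ x, ‖x‖ ≤ ρ → η x = 1) ∧ (∀ x, σ ≤ ‖x‖ → η x = 0) ∧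
      (∀ x, ‖fderiv ℝ η x‖ ≤ 1 / volume.real T) ∧ ∀ x, ‖x‖ ∉ T → fderiv ℝ η x = 0 := by
  obtain ⟨ψ, h1, h2, h3, h4, h5⟩ := exists_profile hT hT0 hTs
  have hl : LipschitzWith (Real.toNNReal (1 / volume.real T)) fun x : E => ψ ‖x‖ := by
    have := h1.comp (lipschitzWith_one_norm (E := E))
    rwa [mul_one] at this
  refine ⟨fun x => ψ ‖x‖, ⟨_, hl⟩, fun x => h2 _, fun x => h3 _, fun x => h4 _, fun x => ?_,
    fun x hx => ?_⟩
  · have := norm_fderiv_le_of_lipschitz ℝ hl (x₀ := x)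
    rwa [Real.coe_toNNReal _ (by positivity)] at this
  · have : (fun x : E => ψ ‖x‖) =ᶠ[𝓝 x] fun _ => ψ ‖x‖ :=
      continuous_norm.continuousAt.eventually (h5 _ hx)
    rw [this.fderiv_eq]
    simp

/-- The directions `±eᵢ`. -/
def axisDir (a : Fin n × Bool) : EuclideanSpace ℝ (Fin n) :=
  (if a.2 then (1 : ℝ) else -1) • EuclideanSpace.single a.1 (1 : ℝ)

lemma norm_axisDir (a : Fin n × Bool) : ‖axisDir a‖ = 1 := by
  unfold axisDir
  rw [norm_smul]
  split_ifs <;> simp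

/-- The integral over a set of spheres is controlled by integrals in gnomonic charts. -/
lemma exists_lintegral_spheres_le (hn : 2 ≤ n) (q : ℝ) :
    ∃ C : ℝ≥0, ∀ (w : EuclideanSpace ℝ (Fin n) → ℝ) (T : Set ℝ), Measurable w →
      MeasurableSet T → T ⊆ Ioo 0 1 →
      ∫⁻ x in {x | ‖x‖ ∈ T}, ‖w x‖ₑ ^ q ≤ C * ∫⁻ r in T, ∑ a : Fin n × Bool,
        ∫⁻ y in closedBall (0 : (ℝ ∙ axisDir a)ᗮ) n, ‖w (gnomonic (axisDir a) (r, y))‖ₑ ^ q := by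
  have hex : ∀ a : Fin n × Bool, ∃ C : ℝ≥0, ∀ (w : EuclideanSpace ℝ (Fin n) → ℝ) (T : Set ℝ),
      Measurable w → MeasurableSet T → T ⊆ Ioo 0 1 →
      ∫⁻ x in {x | ‖x‖ ∈ T ∧ ‖x‖ ≤ n * inner ℝ (axisDir a) x}, ‖w x‖ₑ ^ q ≤ C * ∫⁻ r in T,
        ∫⁻ y in closedBall (0 : (ℝ ∙ axisDir a)ᗮ) n,
          ‖w (gnomonic (axisDir a) (r, y))‖ₑ ^ q := by
    intro a
    have hfr : Module.finrank ℝ (EuclideanSpace ℝ (Fin n)) =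
        Module.finrank ℝ (ℝ × (ℝ ∙ axisDir a)ᗮ) := by
      rw [Module.finrank_prod, finrank_orthogonal_eq hn (norm_axisDir a)]
      simp; omega
    obtain ⟨C, hC⟩ := exists_setLIntegral_comp_le
      (volume : Measure (EuclideanSpace ℝ (Fin n)))
      ((volume : Measure ℝ).prod (volume : Measure (ℝ ∙ axisDir a)ᗮ)) hfr 3
    refine ⟨C, fun w T hw hT hTs => ?_⟩
    have hin : ∀ x : EuclideanSpace ℝ (Fin n), ‖x‖ ∈ T → ‖x‖ ≤ n * inner ℝ (axisDir a) x →
        0 < inner ℝ (axisDir a) x := fun x hx hx' => by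
      have h0 : (0 : ℝ) < n * inner ℝ (axisDir a) x := (hTs hx).1.trans_le hx'
      exact pos_of_mul_pos_right h0 (by positivity)
    have hF : Measurable fun z => ‖w (gnomonic (axisDir a) z)‖ₑ ^ q :=
      (hw.comp (measurable_gnomonic _)).enorm.pow_const q
    have h := setLIntegral_comp_le_of_map_le (measurable_gnomonicInv (axisDir a))
      (hC (gnomonicInv (axisDir a)) (gnomonic (axisDir a))
      {x | ‖x‖ ∈ T ∧ ‖x‖ ≤ n * inner ℝ (axisDir a) x} (T ×ˢ closedBall 0 n)
      (measurable_gnomonicInv _)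
      ((lipschitzOnWith_gnomonic (norm_axisDir a)).mono fun z hz =>
        ⟨⟨(hTs hz.1).1.le, (hTs hz.1).2.le⟩, mem_univ _⟩)
      (fun x hx => gnomonic_gnomonicInv (norm_axisDir a) (hin x hx.1 hx.2))
      (fun x hx => ⟨hx.1, mem_closedBall_zero_iff.2
        (norm_gnomonicInv_snd_le (hin x hx.1 hx.2) hx.2)⟩)) hF
    rw [← Measure.prod_restrict, lintegral_prod _ hF.aemeasurable] at h
    refine le_trans (le_of_eq ?_) h
    have hms : MeasurableSet {x : EuclideanSpace ℝ (Fin n) |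
        ‖x‖ ∈ T ∧ ‖x‖ ≤ n * inner ℝ (axisDir a) x} :=
      (measurable_norm hT).inter (measurableSet_le measurable_norm (by fun_prop))
    refine setLIntegral_congr_fun hms fun x hx => ?_
    simp only [gnomonic_gnomonicInv (norm_axisDir a) (hin x hx.1 hx.2)]
  choose C hC using hex
  refine ⟨∑ a, C a, fun w T hw hT hTs => ?_⟩
  have hFm : ∀ a : Fin n × Bool, Measurable fun r => ∫⁻ y in closedBall
      (0 : (ℝ ∙ axisDir a)ᗮ) n, ‖w (gnomonic (axisDir a) (r, y))‖ₑ ^ q := fun a =>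
    ((hw.comp (measurable_gnomonic (axisDir a))).enorm.pow_const q).lintegral_prod_right'
  have hcov : {x : EuclideanSpace ℝ (Fin n) | ‖x‖ ∈ T} ⊆
      ⋃ a : Fin n × Bool, {x | ‖x‖ ∈ T ∧ ‖x‖ ≤ n * inner ℝ (axisDir a) x} := by
    intro x hx
    obtain ⟨i, b, h⟩ := exists_norm_le_mul_inner (by omega) x
    exact mem_iUnion.2 ⟨(i, b), hx, h⟩
  calc _ ≤ ∫⁻ x in ⋃ a : Fin n × Bool, {x | ‖x‖ ∈ T ∧ ‖x‖ ≤ n * inner ℝ (axisDir a) x},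
        ‖w x‖ₑ ^ q := lintegral_mono_set hcov
    _ ≤ ∑ a : Fin n × Bool, ∫⁻ x in {x | ‖x‖ ∈ T ∧ ‖x‖ ≤ n * inner ℝ (axisDir a) x},
        ‖w x‖ₑ ^ q := by
      rw [← tsum_fintype (L := .unconditional _)]
      exact lintegral_iUnion_le _ _
    _ ≤ ∑ a : Fin n × Bool, (∑ a, C a : ℝ≥0) * ∫⁻ r in T,
        ∫⁻ y in closedBall (0 : (ℝ ∙ axisDir a)ᗮ) n,
          ‖w (gnomonic (axisDir a) (r, y))‖ₑ ^ q := by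
      refine Finset.sum_le_sum fun a _ => (hC a w T hw hT hTs).trans ?_
      gcongr
      exact Finset.single_le_sum (f := C) (fun _ _ => zero_le) (Finset.mem_univ a)
    _ = _ := by
      rw [← Finset.mul_sum, lintegral_finsetSum _ fun a _ => hFm a]

end cutoff

section cutoffs

variable {n : ℕ}

/-- Chebyshev's inequality, with a compact set of good points. -/
lemma exists_isCompact_le {H : ℝ → ℝ≥0∞} (hH : Measurable H) {ρ σ : ℝ} (hρσ : ρ < σ)
    {M : ℝ≥0∞} (hM : M ≠ ∞) (hHM : ∫⁻ r in Ioo ρ σ, H r ≤ M) :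
    ∃ T ⊆ Ioo ρ σ, IsCompact T ∧ (σ - ρ) / 3 ≤ volume.real T ∧
      ∀ r ∈ T, H r ≤ ENNReal.ofReal (2 / (σ - ρ)) * M := by
  have hl : 0 < σ - ρ := sub_pos.2 hρσ
  set lam := ENNReal.ofReal (2 / (σ - ρ)) * M with hlam
  have hlam_top : lam ≠ ∞ := ENNReal.mul_ne_top ENNReal.ofReal_ne_top hM
  have hSm : MeasurableSet {r | H r ≤ lam} := measurableSet_le hH measurable_const
  have hbad : volume.restrict (Ioo ρ σ) {r | lam < H r} ≤ ENNReal.ofReal ((σ - ρ) / 2) := by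
    rcases eq_or_ne M 0 with h0 | h0
    · have h1 : ∫⁻ r in Ioo ρ σ, H r = 0 := le_antisymm (h0 ▸ hHM) zero_le
      rw [lintegral_eq_zero_iff hH] at h1
      have : volume.restrict (Ioo ρ σ) {r | lam < H r} = 0 := by
        refine measure_mono_null (fun r hr => ?_) h1
        exact (lt_of_le_of_lt zero_le hr).ne'
      rw [this]
      exact zero_le
    · have hlam0 : lam ≠ 0 := mul_ne_zero (by simpa using hρσ) h0
      have h1 := mul_meas_ge_le_lintegral (μ := volume.restrict (Ioo ρ σ)) hH lam
      have h2 : volume.restrict (Ioo ρ σ) {r | lam < H r} ≤ M / lam := by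
        rw [ENNReal.le_div_iff_mul_le (Or.inl hlam0) (Or.inl hlam_top), mul_comm]
        refine le_trans ?_ (h1.trans hHM)
        gcongr
        exact fun h => h.le
      refine h2.trans (le_of_eq ?_)
      have e : ENNReal.ofReal ((σ - ρ) / 2) = (ENNReal.ofReal (2 / (σ - ρ)))⁻¹ := by
        rw [← ENNReal.ofReal_inv_of_pos (by positivity), inv_div]
      rw [hlam, e, div_eq_mul_inv, ENNReal.mul_inv (Or.inl (by simpa using hρσ))
        (Or.inl ENNReal.ofReal_ne_top), mul_left_comm, ENNReal.mul_inv_cancel h0 hM, mul_one]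
  have htot : volume (Ioo ρ σ) = ENNReal.ofReal (σ - ρ) := Real.volume_Ioo
  have hgood : ENNReal.ofReal ((σ - ρ) / 3) < volume (Ioo ρ σ ∩ {r | H r ≤ lam}) := by
    by_contra! hc
    have h1 : volume (Ioo ρ σ) ≤ volume (Ioo ρ σ ∩ {r | H r ≤ lam}) +
        volume.restrict (Ioo ρ σ) {r | lam < H r} := by
      rw [Measure.restrict_apply (measurableSet_lt measurable_const hH)]
      refine (measure_mono fun r hr => ?_).trans (measure_union_le _ _)
      rcases le_or_gt (H r) lam with h | h
      · exact Or.inl ⟨hr, h⟩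
      · exact Or.inr ⟨h, hr⟩
    have h2 := h1.trans (add_le_add hc hbad)
    rw [htot, ← ENNReal.ofReal_add (by positivity) (by positivity),
      ENNReal.ofReal_le_ofReal_iff (by positivity)] at h2
    linarith
  obtain ⟨T, hTs, hTc, hT⟩ := (measurableSet_Ioo.inter hSm).exists_lt_isCompact_of_ne_top
    (measure_ne_top_of_subset inter_subset_left (by simp)) hgood
  refine ⟨T, hTs.trans inter_subset_left, hTc, ?_, fun r hr => (hTs hr).2⟩
  rw [Measure.real, ← ENNReal.ofReal_le_iff_le_toReal hTc.measure_lt_top.ne]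
  exact hT.le

/-- A cutoff function adapted to `w`, for which the error term in the Caccioppoli inequality
only sees integrals over well-chosen spheres. -/
lemma exists_cutoff (hn : 2 ≤ n) {q s : ℝ} (hs : 1 ≤ s) (hq : 0 < q)
    (hsn : s < (n : ℝ) - 1 ∨ n = 2 ∧ s = 1) (hsq : 1 / s - 1 / ((n : ℝ) - 1) ≤ 1 / q) :
    ∃ C : ℝ≥0, ∀ (w : EuclideanSpace ℝ (Fin n) → ℝ)
      (dw : EuclideanSpace ℝ (Fin n) → EuclideanSpace ℝ (Fin n)) (ρ σ : ℝ),
      1 / 2 ≤ ρ → ρ < σ → σ ≤ 1 → IsWeakGradOn n (ball 0 σ) w dw →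
      IntegrableOn w (ball 0 σ) → IntegrableOn dw (ball 0 σ) → Measurable w →
      (∫⁻ x in ball 0 σ, ‖w x‖ₑ ^ s) + (∫⁻ x in ball 0 σ, ‖dw x‖ₑ ^ s) ≠ ∞ →
      ∃ η : EuclideanSpace ℝ (Fin n) → ℝ, (∃ D, LipschitzWith D η) ∧
        (∀ x, 0 ≤ η x ∧ η x ≤ 1) ∧ (∀ x, ‖x‖ ≤ ρ → η x = 1) ∧
        (∃ σ' < σ, ∀ x, σ' ≤ ‖x‖ → η x = 0) ∧
        ∫⁻ x, ‖w x‖ₑ ^ q * ‖fderiv ℝ η x‖ₑ ^ q ≤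
          C * ENNReal.ofReal ((σ - ρ) ^ (-(q - 1 + q / s))) *
            ((∫⁻ x in ball 0 σ, ‖w x‖ₑ ^ s) + ∫⁻ x in ball 0 σ, ‖dw x‖ₑ ^ s) ^ (q / s) := by
  have hs0 : 0 < s := by linarith
  obtain ⟨C₁, hC₁⟩ := exists_lintegral_spheres_le hn q
  have hn0 : (0 : ℝ) < n := by positivity
  choose C₂ hC₂ using fun a : Fin n × Bool =>
    exists_lintegral_radii_le hn hs hq hsn hsq (norm_axisDir a) hn0
  set C₃ : ℝ≥0 := ∑ a, C₂ a with hC₃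
  refine ⟨6 ^ q * (C₁ * (Fintype.card (Fin n × Bool) * (4 * C₃) ^ (q / s))),
    fun w dw ρ σ hρ hρσ hσ h hw hdw hwm hMtop => ?_⟩
  set M := (∫⁻ x in ball 0 σ, ‖w x‖ₑ ^ s) + ∫⁻ x in ball 0 σ, ‖dw x‖ₑ ^ s with hM
  set σ' := (ρ + σ) / 2 with hσ'
  have hσ'σ : σ' < σ := by linarith
  have hρσ' : ρ < σ' := by linarith
  have hFm : ∀ a : Fin n × Bool, Measurable fun r => ∫⁻ y in closedBall
      (0 : (ℝ ∙ axisDir a)ᗮ) n, ‖w (gnomonic (axisDir a) (r, y))‖ₑ ^ q := fun a =>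
    ((hwm.comp (measurable_gnomonic (axisDir a))).enorm.pow_const q).lintegral_prod_right'
  have hFsm : ∀ a : Fin n × Bool, Measurable fun r => (∫⁻ y in closedBall
      (0 : (ℝ ∙ axisDir a)ᗮ) n, ‖w (gnomonic (axisDir a) (r, y))‖ₑ ^ q) ^ (s / q) := fun a =>
    (hFm a).pow_const _
  have hHm : Measurable fun r => ∑ a : Fin n × Bool, (∫⁻ y in closedBall
      (0 : (ℝ ∙ axisDir a)ᗮ) n, ‖w (gnomonic (axisDir a) (r, y))‖ₑ ^ q) ^ (s / q) :=
    Finset.measurable_fun_sum _ fun a _ => hFsm a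
  obtain ⟨T, hTs, hTc, hTv, hTH⟩ := exists_isCompact_le hHm hρσ' (M := C₃ * M)
    (ENNReal.mul_ne_top ENNReal.coe_ne_top hMtop) (by
      rw [lintegral_finsetSum _ fun a _ => hFsm a, hC₃, ENNReal.ofNNReal_finsetSum, Finset.sum_mul]
      exact Finset.sum_le_sum fun a _ => hC₂ a w dw ρ σ' σ hρ hρσ' hσ'σ hσ h hw hdw hwm)
  have hl : 0 < σ - ρ := sub_pos.2 hρσ
  have hT0 : 0 < volume.real T := lt_of_lt_of_le (by linarith) hTv
  obtain ⟨η, hηl, hη01, hη1, hη0, hηd, hηd0⟩ := exists_radial_cutoff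
    (E := EuclideanSpace ℝ (Fin n)) hTc hT0 hTs
  refine ⟨η, hηl, hη01, hη1, ⟨σ', hσ'σ, hη0⟩, ?_⟩
  have hTm : MeasurableSet T := hTc.measurableSet
  have hlam : ENNReal.ofReal (2 / (σ' - ρ)) * (C₃ * M) = ENNReal.ofReal (1 / (σ - ρ)) *
      ((4 * C₃ : ℝ≥0) * M) := by
    have e : 2 / (σ' - ρ) = 1 / (σ - ρ) * 4 := by
      rw [hσ']
      have : (ρ + σ) / 2 - ρ = (σ - ρ) / 2 := by ring
      rw [this]
      field_simp
      norm_num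
    rw [e, ENNReal.ofReal_mul (by positivity)]
    push_cast
    have : ENNReal.ofReal 4 = 4 := by simp
    rw [this]
    ring
  calc ∫⁻ x, ‖w x‖ₑ ^ q * ‖fderiv ℝ η x‖ₑ ^ q
      ≤ ∫⁻ x, {x : EuclideanSpace ℝ (Fin n) | ‖x‖ ∈ T}.indicator
          (fun x => ENNReal.ofReal (6 / (σ - ρ)) ^ q * ‖w x‖ₑ ^ q) x := by
        refine lintegral_mono fun x => ?_
        by_cases hx : ‖x‖ ∈ T
        · rw [indicator_of_mem (show x ∈ {x : EuclideanSpace ℝ (Fin n) | ‖x‖ ∈ T} from hx),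
            mul_comm]
          gcongr
          rw [← ofReal_norm]
          refine ENNReal.ofReal_le_ofReal ((hηd x).trans ?_)
          rw [div_le_div_iff₀ hT0 hl]
          linarith
        · have h0 : ‖fderiv ℝ η x‖ₑ = 0 := by rw [← ofReal_norm, hηd0 x hx]; simp
          rw [h0, ENNReal.zero_rpow_of_pos hq, mul_zero]
          exact zero_le
    _ = ENNReal.ofReal (6 / (σ - ρ)) ^ q * ∫⁻ x in {x : EuclideanSpace ℝ (Fin n) | ‖x‖ ∈ T},
          ‖w x‖ₑ ^ q := by
        rw [lintegral_indicator (show MeasurableSet {x : EuclideanSpace ℝ (Fin n) | ‖x‖ ∈ T} from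
          measurable_norm hTm), lintegral_const_mul _ (hwm.enorm.pow_const q)]
    _ ≤ ENNReal.ofReal (6 / (σ - ρ)) ^ q * (C₁ * ∫⁻ r in T, ∑ a : Fin n × Bool,
          ∫⁻ y in closedBall (0 : (ℝ ∙ axisDir a)ᗮ) n,
            ‖w (gnomonic (axisDir a) (r, y))‖ₑ ^ q) := by
        gcongr
        exact hC₁ w T hwm hTm (hTs.trans (Ioo_subset_Ioo (by linarith) (by linarith)))
    _ ≤ ENNReal.ofReal (6 / (σ - ρ)) ^ q * (C₁ * ∫⁻ r in T, ∑ a : Fin n × Bool,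
          (ENNReal.ofReal (1 / (σ - ρ)) * ((4 * C₃ : ℝ≥0) * M)) ^ (q / s)) := by
        gcongr ENNReal.ofReal (6 / (σ - ρ)) ^ q * (C₁ * ?_)
        refine setLIntegral_mono' hTm fun r hr => Finset.sum_le_sum fun a _ => ?_
        have h1 := (Finset.single_le_sum (f := fun a : Fin n × Bool => (∫⁻ y in closedBall
          (0 : (ℝ ∙ axisDir a)ᗮ) n, ‖w (gnomonic (axisDir a) (r, y))‖ₑ ^ q) ^ (s / q))
          (fun _ _ => zero_le) (Finset.mem_univ a)).trans (hTH r hr)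
        rw [hlam] at h1
        have h2 := ENNReal.rpow_le_rpow h1 (by positivity : 0 ≤ q / s)
        rwa [← ENNReal.rpow_mul, div_mul_div_cancel₀ hq.ne', div_self hs0.ne',
          ENNReal.rpow_one] at h2
    _ ≤ ENNReal.ofReal (6 / (σ - ρ)) ^ q * (C₁ * ((Fintype.card (Fin n × Bool) *
          (ENNReal.ofReal (1 / (σ - ρ)) * ((4 * C₃ : ℝ≥0) * M)) ^ (q / s)) *
            ENNReal.ofReal (σ - ρ))) := by
        gcongr ENNReal.ofReal (6 / (σ - ρ)) ^ q * (C₁ * ?_)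
        rw [setLIntegral_const, Finset.sum_const, nsmul_eq_mul, Finset.card_univ]
        gcongr
        calc volume T ≤ volume (Ioo ρ σ') := measure_mono hTs
          _ = ENNReal.ofReal (σ' - ρ) := Real.volume_Ioo
          _ ≤ _ := ENNReal.ofReal_le_ofReal (by linarith)
    _ = _ := by
        have e1 : (σ - ρ) ^ (-(q - 1 + q / s)) =
            (1 / (σ - ρ)) ^ q * (1 / (σ - ρ)) ^ (q / s) * (σ - ρ) := by
          rw [one_div, Real.inv_rpow hl.le, Real.inv_rpow hl.le, ← Real.rpow_neg hl.le,
            ← Real.rpow_neg hl.le, ← Real.rpow_add hl]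
          nth_rw 3 [← Real.rpow_one (σ - ρ)]
          rw [← Real.rpow_add hl]
          congr 1
          ring
        have e2 : (6 : ℝ) / (σ - ρ) = 6 * (1 / (σ - ρ)) := by ring
        rw [e1, ENNReal.ofReal_mul (by positivity), ENNReal.ofReal_mul (by positivity), e2,
          ENNReal.ofReal_mul (by norm_num), ENNReal.mul_rpow_of_nonneg _ _ hq.le,
          ENNReal.mul_rpow_of_nonneg _ _ (by positivity),
          ENNReal.mul_rpow_of_nonneg _ _ (by positivity),
          ENNReal.ofReal_rpow_of_nonneg (by positivity : 0 ≤ 1 / (σ - ρ)) hq.le,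
          ENNReal.ofReal_rpow_of_nonneg (by positivity : 0 ≤ 1 / (σ - ρ)) (by positivity)]
        have e3 : ENNReal.ofReal 6 = 6 := by simp
        rw [e3]
        push_cast
        rw [ENNReal.coe_rpow_of_nonneg _ hq.le, ENNReal.coe_rpow_of_nonneg _ (by positivity)]
        push_cast
        ring

end cutoffs

section smallBalls

variable {n : ℕ}

lemma preimage_add_smul_ball (x₀ : EuclideanSpace ℝ (Fin n)) {r : ℝ} (hr : 0 < r) (R : ℝ) :
    (fun y => x₀ + r • y) ⁻¹' ball x₀ (R * r) = ball (0 : EuclideanSpace ℝ (Fin n)) R := by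
  ext y
  simp only [mem_preimage, mem_ball, dist_self_add_left, dist_zero_right, norm_smul,
    Real.norm_eq_abs, abs_of_pos hr]
  rw [mul_comm, mul_lt_mul_iff_left₀ hr]

lemma preimage_add_smul_closedBall (x₀ : EuclideanSpace ℝ (Fin n)) {r : ℝ} (hr : 0 < r) :
    (fun y => x₀ + r • y) ⁻¹' closedBall x₀ r = closedBall (0 : EuclideanSpace ℝ (Fin n)) 1 := by
  ext y
  simp only [mem_preimage, mem_closedBall, dist_self_add_left, dist_zero_right, norm_smul,
    Real.norm_eq_abs, abs_of_pos hr]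
  exact mul_le_iff_le_one_right hr

/-- Change of variables for the error term of a rescaled cutoff. -/
lemma lintegral_cutoff_comp {η : EuclideanSpace ℝ (Fin n) → ℝ} (w : EuclideanSpace ℝ (Fin n) → ℝ)
    (x₀ : EuclideanSpace ℝ (Fin n)) {r : ℝ} (hr : 0 < r) {q : ℝ} (hq : 0 < q) :
    ∫⁻ x, ‖w x‖ₑ ^ q * ‖fderiv ℝ η x‖ₑ ^ q = ENNReal.ofReal (r ^ n) * ENNReal.ofReal (r ^ (-q)) *
      ∫⁻ y, ‖w (x₀ + r • y)‖ₑ ^ q * ‖fderiv ℝ (fun y => η (x₀ + r • y)) y‖ₑ ^ q := by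
  have hd : ∀ y, ‖fderiv ℝ (fun y => η (x₀ + r • y)) y‖ₑ ^ q =
      ENNReal.ofReal (r ^ q) * ‖fderiv ℝ η (x₀ + r • y)‖ₑ ^ q := by
    intro y
    have h1 : fderiv ℝ (fun y => η (x₀ + r • y)) y = r • fderiv ℝ η (x₀ + r • y) := by
      have := fderiv_comp_smul (𝕜 := ℝ) (f := fun z => η (x₀ + z)) (x := y) (c := r)
      rw [this, fderiv_comp_add_left]
    rw [← ofReal_norm, h1, norm_smul, Real.norm_eq_abs, abs_of_pos hr,
      ENNReal.ofReal_mul hr.le, ENNReal.mul_rpow_of_nonneg _ _ hq.le, ofReal_norm,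
      ENNReal.ofReal_rpow_of_pos hr]
  have h2 := setLIntegral_comp_add_smul x₀ hr MeasurableSet.univ
    (fun x => ‖w x‖ₑ ^ q * ‖fderiv ℝ η x‖ₑ ^ q)
  simp only [preimage_univ, Measure.restrict_univ] at h2
  have h3 : ∀ y, ‖w (x₀ + r • y)‖ₑ ^ q * ‖fderiv ℝ (fun y => η (x₀ + r • y)) y‖ₑ ^ q =
      ENNReal.ofReal (r ^ q) * (‖w (x₀ + r • y)‖ₑ ^ q * ‖fderiv ℝ η (x₀ + r • y)‖ₑ ^ q) := by
    intro y
    rw [hd]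
    ring
  simp only [h3]
  rw [lintegral_const_mul' _ _ ENNReal.ofReal_ne_top, h2]
  have h4 : ENNReal.ofReal (r ^ (-q)) * ENNReal.ofReal (r ^ q) = 1 := by
    rw [← ENNReal.ofReal_mul (by positivity), ← Real.rpow_add hr]; simp
  have h5 : ENNReal.ofReal (r ^ n) * ENNReal.ofReal ((r ^ n)⁻¹) = 1 := by
    rw [← ENNReal.ofReal_mul (by positivity), mul_inv_cancel₀ (by positivity)]; simp
  calc _ = (ENNReal.ofReal (r ^ n) * ENNReal.ofReal ((r ^ n)⁻¹)) *
        (ENNReal.ofReal (r ^ (-q)) * ENNReal.ofReal (r ^ q)) *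
        ∫⁻ x, ‖w x‖ₑ ^ q * ‖fderiv ℝ η x‖ₑ ^ q := by rw [h4, h5]; ring
    _ = _ := by ring

/-- A cutoff on a small ball on which `w` vanishes at least half of the time. -/
lemma exists_ball_cutoff (hn : 2 ≤ n) {q s : ℝ} (hs : 1 ≤ s) (hq : 0 < q)
    (hsn : s < (n : ℝ) - 1 ∨ n = 2 ∧ s = 1) (hsq : 1 / s - 1 / ((n : ℝ) - 1) ≤ 1 / q) :
    ∃ C : ℝ≥0, ∀ (w : EuclideanSpace ℝ (Fin n) → ℝ)
      (dw : EuclideanSpace ℝ (Fin n) → EuclideanSpace ℝ (Fin n))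
      (x₀ : EuclideanSpace ℝ (Fin n)) (r τ : ℝ), 0 < r → 0 < τ → τ ≤ 1 / 2 →
      IsWeakGradOn n (ball x₀ (2 * r)) w dw →
      IntegrableOn w (ball x₀ (2 * r)) → IntegrableOn dw (ball x₀ (2 * r)) → Measurable w →
      ∫⁻ x in ball x₀ (2 * r), ‖dw x‖ₑ ^ s ≠ ∞ →
      volume (closedBall x₀ r) ≤ 2 * volume (closedBall x₀ r ∩ {x | w x = 0}) →
      ∃ η : EuclideanSpace ℝ (Fin n) → ℝ, (∃ D, LipschitzWith D η) ∧
        (∀ x, 0 ≤ η x ∧ η x ≤ 1) ∧ (∀ x, dist x x₀ ≤ (1 - τ) * r → η x = 1) ∧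
        (∀ x, r ≤ dist x x₀ → η x = 0) ∧
        ∫⁻ x, ‖w x‖ₑ ^ q * ‖fderiv ℝ η x‖ₑ ^ q ≤
          C * ENNReal.ofReal (τ ^ (-(q - 1 + q / s))) * ENNReal.ofReal (r ^ n) *
            (ENNReal.ofReal ((r ^ n)⁻¹) * ∫⁻ x in ball x₀ (2 * r), ‖dw x‖ₑ ^ s) ^ (q / s) := by
  have hs0 : 0 < s := by linarith
  obtain ⟨C, hC⟩ := exists_cutoff hn hs hq hsn hsq
  set C₁ : ℝ≥0 := 2 ^ s * 2 ^ n * 2 + 1 with hC₁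
  refine ⟨C * C₁ ^ (q / s), fun w dw x₀ r τ hr hτ hτ2 h hw hdw hwm hfin hz => ?_⟩
  have hpre := preimage_add_smul_ball x₀ hr 2
  have hprec := preimage_add_smul_closedBall x₀ hr
  have h' := h.comp_add_smul measurableSet_ball x₀ hr
  have hw' := integrableOn_comp_add_smul x₀ hr measurableSet_ball hw
  have hdw' : IntegrableOn (fun y => r • dw (x₀ + r • y)) _ :=
    (integrableOn_comp_add_smul x₀ hr measurableSet_ball hdw).smul r
  rw [hpre] at h' hw' hdw'
  have hwm' : Measurable fun y => w (x₀ + r • y) := hwm.comp (by fun_prop)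
  set N := ENNReal.ofReal ((r ^ n)⁻¹) * ∫⁻ x in ball x₀ (2 * r), ‖dw x‖ₑ ^ s with hN
  have hgrad : ∫⁻ y in ball (0 : EuclideanSpace ℝ (Fin n)) 2, ‖r • dw (x₀ + r • y)‖ₑ ^ s =
      ENNReal.ofReal (r ^ s) * N := by
    have h1 := setLIntegral_comp_add_smul x₀ hr (measurableSet_ball (x := x₀) (ε := 2 * r))
      (fun x => ‖dw x‖ₑ ^ s)
    rw [hpre] at h1
    rw [hN, ← h1, ← lintegral_const_mul' _ _ ENNReal.ofReal_ne_top]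
    refine lintegral_congr fun y => ?_
    rw [enorm_smul, ENNReal.mul_rpow_of_nonneg _ _ hs0.le, Real.enorm_eq_ofReal hr.le,
      ENNReal.ofReal_rpow_of_pos hr]
  have hNtop : N ≠ ∞ := ENNReal.mul_ne_top ENNReal.ofReal_ne_top hfin
  have hvol : volume (closedBall (0 : EuclideanSpace ℝ (Fin n)) 1) ≤
      2 * volume (closedBall (0 : EuclideanSpace ℝ (Fin n)) 1 ∩ {y | w (x₀ + r • y) = 0}) := by
    have hm : ∀ S : Set (EuclideanSpace ℝ (Fin n)), MeasurableSet S →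
        volume ((fun y => x₀ + r • y) ⁻¹' S) = ENNReal.ofReal ((r ^ n)⁻¹) * volume S := by
      intro S hS
      rw [← Measure.map_apply (by fun_prop) hS, map_add_smul_volume x₀ hr, Measure.smul_apply,
        smul_eq_mul]
    have e1 := hm _ (measurableSet_closedBall (x := x₀) (ε := r))
    have e2 := hm (closedBall x₀ r ∩ {x | w x = 0})
      (measurableSet_closedBall.inter (hwm (measurableSet_singleton 0)))
    rw [preimage_inter, hprec] at e2
    rw [hprec] at e1
    change volume _ ≤ 2 * volume (closedBall _ _ ∩ (fun y => x₀ + r • y) ⁻¹' {x | w x = 0})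
    rw [e1, e2, mul_left_comm]
    gcongr
  have hP : ∫⁻ y in closedBall (0 : EuclideanSpace ℝ (Fin n)) 1, ‖w (x₀ + r • y)‖ₑ ^ s ≤
      2 ^ s * 2 ^ n * 2 * (ENNReal.ofReal (r ^ s) * N) := by
    have h1 := h'.measure_mul_lintegral_rpow_le isOpen_ball
      (closedBall_subset_ball (by norm_num)) hw' hdw' hwm' hs
    rw [hgrad] at h1
    have hv0 : volume (closedBall (0 : EuclideanSpace ℝ (Fin n)) 1) ≠ 0 :=
      (measure_closedBall_pos _ _ one_pos).ne'
    have hvt : volume (closedBall (0 : EuclideanSpace ℝ (Fin n)) 1) ≠ ∞ :=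
      measure_closedBall_lt_top.ne
    refine (ENNReal.mul_le_mul_iff_right hv0 hvt).1 ?_
    refine (mul_le_mul_left hvol _).trans ?_
    rw [mul_assoc]
    refine (mul_le_mul_right h1 _).trans (le_of_eq ?_)
    ring
  have hM : (∫⁻ y in ball (0 : EuclideanSpace ℝ (Fin n)) 1, ‖w (x₀ + r • y)‖ₑ ^ s) +
      (∫⁻ y in ball (0 : EuclideanSpace ℝ (Fin n)) 1, ‖r • dw (x₀ + r • y)‖ₑ ^ s) ≤
      C₁ * (ENNReal.ofReal (r ^ s) * N) := by
    have h1 := (lintegral_mono_set ball_subset_closedBall).trans hP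
    have h2 : ∫⁻ y in ball (0 : EuclideanSpace ℝ (Fin n)) 1, ‖r • dw (x₀ + r • y)‖ₑ ^ s ≤ _ :=
      (lintegral_mono_set (ball_subset_ball one_le_two)).trans hgrad.le
    refine (add_le_add h1 h2).trans (le_of_eq ?_)
    rw [hC₁]
    push_cast
    rw [ENNReal.coe_rpow_of_nonneg _ hs0.le]
    push_cast
    ring
  have hsub : ball (0 : EuclideanSpace ℝ (Fin n)) 1 ⊆ ball 0 2 := ball_subset_ball one_le_two
  obtain ⟨η, ⟨D, hD⟩, hη01, hη1, ⟨σ', hσ', hη0⟩, hcost⟩ := hC (fun y => w (x₀ + r • y))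
    (fun y => r • dw (x₀ + r • y)) (1 - τ) 1 (by linarith) (by linarith) le_rfl (h'.mono hsub)
    (hw'.mono_set hsub) (hdw'.mono_set hsub) hwm'
    (ne_top_of_le_ne_top (by finiteness) hM)
  have hcomp : ∀ y, x₀ + r • y - x₀ = r • y := fun y => by abel
  have hnorm : ∀ x, ‖r⁻¹ • (x - x₀)‖ = r⁻¹ * dist x x₀ := fun x => by
    rw [norm_smul, Real.norm_eq_abs, abs_of_pos (inv_pos.2 hr), dist_eq_norm]
  refine ⟨fun x => η (r⁻¹ • (x - x₀)), ⟨D * (‖r⁻¹‖₊ * (1 + 0)), ?_⟩, fun x => hη01 _,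
    fun x hx => hη1 _ ?_, fun x hx => hη0 _ ?_, ?_⟩
  · refine hD.comp ((lipschitzWith_smul r⁻¹).comp (LipschitzWith.id.sub (LipschitzWith.const _)))
  · rw [hnorm, inv_mul_le_iff₀ hr]
    linarith
  · rw [hnorm]
    refine hσ'.le.trans ?_
    rw [← div_eq_inv_mul, one_le_div hr]
    exact hx
  · rw [lintegral_cutoff_comp w x₀ hr hq]
    have e : (fun y => η (r⁻¹ • (x₀ + r • y - x₀))) = η := by
      funext y
      rw [hcomp, smul_smul, inv_mul_cancel₀ hr.ne', one_smul]
    rw [e]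
    refine (mul_le_mul_right hcost _).trans ?_
    refine (mul_le_mul_right (mul_le_mul_right (ENNReal.rpow_le_rpow hM
      (by positivity : 0 ≤ q / s)) _) _).trans (le_of_eq ?_)
    rw [ENNReal.mul_rpow_of_nonneg _ _ (by positivity), ENNReal.mul_rpow_of_nonneg _ _
      (by positivity), ENNReal.ofReal_rpow_of_nonneg (by positivity) (by positivity),
      ← Real.rpow_mul hr.le, mul_div_cancel₀ _ hs0.ne']
    have h4 : ENNReal.ofReal (r ^ (-q)) * ENNReal.ofReal (r ^ q) = 1 := by
      rw [← ENNReal.ofReal_mul (by positivity), ← Real.rpow_add hr]; simp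
    have e5 : 1 - (1 - τ) = τ := by ring
    push_cast
    rw [ENNReal.coe_rpow_of_nonneg _ (by positivity), e5]
    calc _ = (ENNReal.ofReal (r ^ (-q)) * ENNReal.ofReal (r ^ q)) *
          (C * (C₁ : ℝ≥0∞) ^ (q / s) * ENNReal.ofReal (τ ^ (-(q - 1 + q / s))) *
            ENNReal.ofReal (r ^ n) * N ^ (q / s)) := by ring
      _ = _ := by rw [h4, one_mul]

end smallBalls

section covering

variable {n : ℕ}

lemma ae_eventually_setLIntegral_le {F : EuclideanSpace ℝ (Fin n) → ℝ≥0∞} (hF : AEMeasurable F)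
    (hfin : ∫⁻ x, F x ≠ ∞) :
    ∀ᵐ x, F x = 0 → ∀ κ : ℝ≥0∞, κ ≠ 0 →
      ∀ᶠ r in 𝓝[>] (0 : ℝ), ∫⁻ y in closedBall x r, F y ≤ κ * volume (closedBall x r) := by
  filter_upwards [(Besicovitch.vitaliFamily volume).ae_tendsto_lintegral_div hF hfin]
    with x hx hx0 κ hκ
  rw [hx0] at hx
  have h1 := hx.comp (Besicovitch.tendsto_filterAt volume x)
  have h2 := (tendsto_order.1 h1).2 κ (pos_iff_ne_zero.2 hκ)
  filter_upwards [h2, self_mem_nhdsWithin] with r hr hr0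
  have hv0 : volume (closedBall x r) ≠ 0 := (measure_closedBall_pos _ _ hr0).ne'
  exact (ENNReal.div_le_iff hv0 measure_closedBall_lt_top.ne).1 hr.le

/-- A finite version of the Besicovitch covering theorem. -/
lemma exists_finset_closedBall_covering {Z : Set (EuclideanSpace ℝ (Fin n))} {R : ℝ}
    {P : EuclideanSpace ℝ (Fin n) → ℝ → Prop}
    (hP : ∀ᵐ x, x ∈ Z → ∀ᶠ r in 𝓝[>] (0 : ℝ), P x r)
    (hPR : ∀ x r, P x r → closedBall x r ⊆ ball 0 R) {δ : ℝ≥0∞} (hδ : δ ≠ 0) :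
    ∃ (F : Finset (EuclideanSpace ℝ (Fin n))) (r : EuclideanSpace ℝ (Fin n) → ℝ),
      (∀ x ∈ F, 0 < r x ∧ P x (r x)) ∧
      (F : Set (EuclideanSpace ℝ (Fin n))).PairwiseDisjoint (fun x => closedBall x (r x)) ∧
      volume (Z \ ⋃ x ∈ F, closedBall x (r x)) ≤ δ := by
  classical
  obtain ⟨t, r, htc, htZ, htr, htcov, htd⟩ :=
    Besicovitch.exists_disjoint_closedBall_covering_ae volume (fun x => {r | P x r})
    (Z ∩ {x | ∀ᶠ r in 𝓝[>] (0 : ℝ), P x r}) (fun x hx δ hδ => by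
      have h1 : Ioo (0 : ℝ) δ ∈ 𝓝[>] (0 : ℝ) := Ioo_mem_nhdsGT hδ
      have h2 : ∀ᶠ r in 𝓝[>] (0 : ℝ), P x r := hx.2
      exact (h2.and h1).exists) (fun _ => 1)
      (fun _ _ => one_pos)
  have hsum : ∑' x : t, volume (closedBall (x : EuclideanSpace ℝ (Fin n)) (r x)) ≠ ∞ := by
    rw [← measure_biUnion htc htd fun _ _ => measurableSet_closedBall]
    exact measure_ne_top_of_subset (iUnion₂_subset fun x hx => hPR x _ (htr x hx).1)
      measure_ball_lt_top.ne
  obtain ⟨F, hF⟩ := ((ENNReal.tendsto_tsum_compl_atTop_zero hsum).eventually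
    (ge_mem_nhds (pos_iff_ne_zero.2 hδ))).exists
  refine ⟨F.map (Function.Embedding.subtype _), r, fun x hx => ?_, htd.subset fun x hx => ?_, ?_⟩
  · obtain ⟨y, -, rfl⟩ := Finset.mem_map.1 hx
    exact ⟨(htr y y.2).2.1, (htr y y.2).1⟩
  · obtain ⟨y, -, rfl⟩ := Finset.mem_map.1 (Finset.mem_coe.1 hx)
    exact y.2
  · have hsub : Z \ ⋃ x ∈ F.map (Function.Embedding.subtype _), closedBall x (r x) ⊆
        (Z ∩ {x | ¬ ∀ᶠ r in 𝓝[>] (0 : ℝ), P x r}) ∪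
        (((Z ∩ {x | ∀ᶠ r in 𝓝[>] (0 : ℝ), P x r}) \ ⋃ x ∈ t, closedBall x (r x)) ∪
        ⋃ x : {x : t // x ∉ F}, closedBall ((x : t) : EuclideanSpace ℝ (Fin n)) (r x)) := by
      rintro z ⟨hz, hzF⟩
      by_cases hPz : ∀ᶠ r in 𝓝[>] (0 : ℝ), P z r
      · right
        by_cases hzt : z ∈ ⋃ x ∈ t, closedBall x (r x)
        · right
          obtain ⟨x, hx, hzx⟩ := mem_iUnion₂.1 hzt
          refine mem_iUnion.2 ⟨⟨⟨x, hx⟩, fun hxF => hzF ?_⟩, hzx⟩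
          exact mem_iUnion₂.2 ⟨x, Finset.mem_map.2 ⟨⟨x, hx⟩, hxF, rfl⟩, hzx⟩
        · exact Or.inl ⟨⟨hz, hPz⟩, hzt⟩
      · exact Or.inl ⟨hz, hPz⟩
    have h0 : volume (Z ∩ {x | ¬ ∀ᶠ r in 𝓝[>] (0 : ℝ), P x r}) = 0 := by
      refine measure_mono_null (fun x hx => ?_) (ae_iff.1 hP)
      exact fun h => hx.2 (h hx.1)
    calc _ ≤ _ := measure_mono hsub
      _ ≤ 0 + (0 + ∑' x : {x : t // x ∉ F},
          volume (closedBall ((x : t) : EuclideanSpace ℝ (Fin n)) (r x))) := by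
        refine (measure_union_le _ _).trans (add_le_add h0.le ((measure_union_le _ _).trans
          (add_le_add htcov.le ?_)))
        have : Countable t := htc.to_subtype
        exact measure_iUnion_le _
      _ ≤ δ := by simpa using hF

lemma exists_lipschitzWith_sum {ι : Type*} (F : Finset ι)
    {η : ι → EuclideanSpace ℝ (Fin n) → ℝ} (hη : ∀ i ∈ F, ∃ D, LipschitzWith D (η i)) :
    ∃ D, LipschitzWith D fun x => ∑ i ∈ F, η i x := by
  classical
  induction F using Finset.induction_on with
  | empty => exact ⟨0, by simp⟩
  | insert a F ha ih =>
    obtain ⟨D, hD⟩ := ih fun i hi => hη i (Finset.mem_insert_of_mem hi)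
    obtain ⟨D', hD'⟩ := hη a (Finset.mem_insert_self _ _)
    exact ⟨_, by simpa only [Finset.sum_insert ha] using hD'.add hD⟩

/-- Gluing cutoffs with disjoint supports. -/
lemma exists_glued_cutoff {F : Finset (EuclideanSpace ℝ (Fin n))}
    {r : EuclideanSpace ℝ (Fin n) → ℝ}
    (hd : (F : Set (EuclideanSpace ℝ (Fin n))).PairwiseDisjoint fun x => closedBall x (r x))
    {η : EuclideanSpace ℝ (Fin n) → EuclideanSpace ℝ (Fin n) → ℝ}
    (hη : ∀ i ∈ F, ∃ D, LipschitzWith D (η i)) (hη01 : ∀ i ∈ F, ∀ x, 0 ≤ η i x ∧ η i x ≤ 1)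
    (hη0 : ∀ i ∈ F, ∀ x, r i ≤ dist x i → η i x = 0) {q : ℝ} (hq : 0 < q) :
    ∃ ζ : EuclideanSpace ℝ (Fin n) → ℝ, (∃ D, LipschitzWith D ζ) ∧ (∀ x, 0 ≤ ζ x ∧ ζ x ≤ 1) ∧
      (∀ x, ‖fderiv ℝ ζ x‖ₑ ^ q ≤ ∑ i ∈ F, ‖fderiv ℝ (η i) x‖ₑ ^ q) ∧
      (∀ x, ζ x < 1 → ∃ i ∈ F, x ∈ closedBall i (r i)) ∧
      ∀ i ∈ F, ∀ x, η i x = 1 → ζ x = 0 := by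
  classical
  obtain ⟨D, hD⟩ := exists_lipschitzWith_sum F hη
  have hout : ∀ i ∈ F, ∀ x, x ∉ closedBall i (r i) → ∀ᶠ y in 𝓝 x, η i y = 0 := by
    intro i hi x hx
    filter_upwards [isClosed_closedBall.isOpen_compl.mem_nhds hx] with y hy
    exact hη0 i hi y (le_of_lt (not_le.1 hy))
  have hloc : ∀ x, (∀ᶠ y in 𝓝 x, ∑ j ∈ F, η j y = 0) ∧ (∀ i ∈ F, η i x = 0) ∨
      ∃ i ∈ F, x ∈ closedBall i (r i) ∧ ∀ᶠ y in 𝓝 x, ∑ j ∈ F, η j y = η i y := by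
    intro x
    by_cases hx : ∃ i ∈ F, x ∈ closedBall i (r i)
    · obtain ⟨i, hi, hxi⟩ := hx
      refine Or.inr ⟨i, hi, hxi, ?_⟩
      have h1 : ∀ᶠ y in 𝓝 x, ∀ j ∈ F, j ≠ i → η j y = 0 := by
        rw [Filter.eventually_all_finset]
        intro j hj
        by_cases hji : j = i
        · simp [hji]
        · have hxj : x ∉ closedBall j (r j) := fun hxj =>
            Set.disjoint_left.1 (hd hj hi hji) hxj hxi
          exact (hout j hj x hxj).mono fun y hy _ => hy
      exact h1.mono fun y hy => Finset.sum_eq_single_of_mem i hi hy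
    · push Not at hx
      have h1 : ∀ᶠ y in 𝓝 x, ∀ j ∈ F, η j y = 0 := by
        rw [Filter.eventually_all_finset]
        exact fun j hj => hout j hj x (hx j hj)
      exact Or.inl ⟨h1.mono fun y hy => Finset.sum_eq_zero hy, h1.self_of_nhds⟩
  refine ⟨fun x => 1 - ∑ i ∈ F, η i x, ⟨_, (LipschitzWith.const 1).sub hD⟩, fun x => ?_,
    fun x => ?_, fun x hx => ?_, fun i hi x hx => ?_⟩
  · simp only
    rcases hloc x with h | ⟨i, hi, -, h⟩
    · rw [h.1.self_of_nhds]; norm_num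
    · rw [h.self_of_nhds]
      have := hη01 i hi x
      constructor <;> linarith
  · rw [fderiv_const_sub, enorm_neg]
    rcases hloc x with h | ⟨i, hi, -, h⟩
    · have h1 : (fun x => ∑ i ∈ F, η i x) =ᶠ[𝓝 x] fun _ => (0 : ℝ) := h.1
      have h0 : ‖fderiv ℝ (fun x => ∑ i ∈ F, η i x) x‖ₑ = 0 := by
        rw [← ofReal_norm, h1.fderiv_eq]; simp
      rw [h0, ENNReal.zero_rpow_of_pos hq]
      exact zero_le
    · have h1 : (fun x => ∑ i ∈ F, η i x) =ᶠ[𝓝 x] η i := h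
      rw [h1.fderiv_eq]
      exact Finset.single_le_sum (f := fun i => ‖fderiv ℝ (η i) x‖ₑ ^ q) (fun _ _ => zero_le) hi
  · simp only at hx
    rcases hloc x with h | ⟨i, hi, hxi, -⟩
    · rw [h.1.self_of_nhds] at hx; norm_num at hx
    · exact ⟨i, hi, hxi⟩
  · rcases hloc x with h | ⟨j, hj, hxj, h⟩
    · rw [h.2 i hi] at hx; norm_num at hx
    · have hij : i = j := by
        by_contra hij
        refine Set.disjoint_left.1 (hd hi hj hij) (?_ : x ∈ closedBall i (r i)) hxj
        by_contra hxi
        rw [(hout i hi x hxi).self_of_nhds] at hx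
        norm_num at hx
      subst hij
      simp only [h.self_of_nhds, hx, sub_self]

end covering

section smallCutoff

variable {n : ℕ}

/-- A cutoff, with small error term, which vanishes on a neighbourhood of most of the zero set of
`w` and equals one on most of the rest. -/
lemma exists_small_cutoff (hn : 2 ≤ n) {q s : ℝ} (hs : 1 ≤ s) (hq : 0 < q)
    (hsn : s < (n : ℝ) - 1 ∨ n = 2 ∧ s = 1) (hsq : 1 / s - 1 / ((n : ℝ) - 1) ≤ 1 / q)
    {w : EuclideanSpace ℝ (Fin n) → ℝ} {dw : EuclideanSpace ℝ (Fin n) → EuclideanSpace ℝ (Fin n)}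
    {R : ℝ} (hR : 1 < R) (h : IsWeakGradOn n (ball 0 R) w dw) (hw : IntegrableOn w (ball 0 R))
    (hdw : IntegrableOn dw (ball 0 R)) (hwm : Measurable w) (hdwm : Measurable dw)
    (hfin : ∫⁻ x in ball 0 R, ‖dw x‖ₑ ^ s ≠ ∞) (hdw0 : ∀ x, w x = 0 → dw x = 0)
    {δ : ℝ≥0∞} (hδ : δ ≠ 0) :
    ∃ ζ : EuclideanSpace ℝ (Fin n) → ℝ, (∃ D, LipschitzWith D ζ) ∧ (∀ x, 0 ≤ ζ x ∧ ζ x ≤ 1) ∧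
      ∫⁻ x, ‖w x‖ₑ ^ q * ‖fderiv ℝ ζ x‖ₑ ^ q ≤ δ ∧
      volume ({x | ζ x < 1} ∩ {x | w x ≠ 0}) ≤ δ ∧
      ∃ U, IsOpen U ∧ (∀ x ∈ U, ζ x = 0) ∧ volume ((ball 0 1 ∩ {x | w x = 0}) \ U) ≤ δ := by
  have hs0 : 0 < s := by linarith
  obtain ⟨C, hC⟩ := exists_ball_cutoff hn hs hq hsn hsq
  obtain ⟨V, hV⟩ : ∃ V, V = volume (ball (0 : EuclideanSpace ℝ (Fin n)) 1) := ⟨_, rfl⟩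
  obtain ⟨W, hW⟩ : ∃ W, W = volume (ball (0 : EuclideanSpace ℝ (Fin n)) R) := ⟨_, rfl⟩
  have hV0 : V ≠ 0 := hV ▸ (measure_ball_pos _ _ one_pos).ne'
  have hVt : V ≠ ∞ := hV ▸ measure_ball_lt_top.ne
  have hWt : W ≠ ∞ := hW ▸ measure_ball_lt_top.ne
  have hvol : ∀ (x : EuclideanSpace ℝ (Fin n)) (r : ℝ), 0 ≤ r →
      volume (closedBall x r) = ENNReal.ofReal (r ^ n) * V := by
    intro x r hr
    rw [Measure.addHaar_closedBall _ _ hr, hV]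
    simp
  have hvolb : ∀ (x : EuclideanSpace ℝ (Fin n)) (r : ℝ), 0 ≤ r →
      volume (ball x r) = ENNReal.ofReal (r ^ n) * V := by
    intro x r hr
    have : Nonempty (Fin n) := ⟨⟨0, by omega⟩⟩
    rw [← Measure.addHaar_closedBall_eq_addHaar_ball, hvol x r hr]
  obtain ⟨τ, hτ0, hτ2, hτ⟩ : ∃ τ : ℝ, 0 < τ ∧ τ ≤ 1 / 2 ∧
      ENNReal.ofReal (1 - (1 - τ) ^ n) * W ≤ δ / 2 := by
    have h1 : Filter.Tendsto (fun τ : ℝ => ENNReal.ofReal (1 - (1 - τ) ^ n) * W) (𝓝[>] 0)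
        (𝓝 0) := by
      have h2 : Filter.Tendsto (fun τ : ℝ => 1 - (1 - τ) ^ n) (𝓝[>] 0) (𝓝 0) := by
        have : Continuous fun τ : ℝ => 1 - (1 - τ) ^ n := by fun_prop
        have := this.tendsto 0
        simp only [sub_zero, one_pow, sub_self] at this
        exact this.mono_left nhdsWithin_le_nhds
      have h3 := ENNReal.Tendsto.mul_const (ENNReal.tendsto_ofReal h2) (Or.inr hWt)
      simpa using h3
    have h2 := h1.eventually (ge_mem_nhds (ENNReal.half_pos hδ))
    have h3 : Ioc (0 : ℝ) (1 / 2) ∈ 𝓝[>] (0 : ℝ) := Ioc_mem_nhdsGT (by norm_num)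
    obtain ⟨τ, h4, h5⟩ := (h2.and h3).exists
    exact ⟨τ, h5.1, h5.2, h4⟩
  set A := C * ENNReal.ofReal (τ ^ (-(q - 1 + q / s))) * V⁻¹ with hA
  have hAt : A ≠ ∞ := ENNReal.mul_ne_top (ENNReal.mul_ne_top ENNReal.coe_ne_top
    ENNReal.ofReal_ne_top) (ENNReal.inv_ne_top.2 hV0)
  obtain ⟨κ, hκ0, hκ2, hκδ, hκ⟩ : ∃ κ : ℝ≥0∞, κ ≠ 0 ∧ κ ≤ 1 / 2 ∧ κ * W ≤ δ ∧
      A * (κ * (2 ^ n * V)) ^ (q / s) * W ≤ δ := by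
    have h1 : Filter.Tendsto (fun κ : ℝ≥0∞ => κ * W) (𝓝[>] 0) (𝓝 0) := by
      have := (ENNReal.Tendsto.mul_const (b := W) (Filter.tendsto_id (x := 𝓝 (0 : ℝ≥0∞)))
        (Or.inr hWt)).mono_left (nhdsWithin_le_nhds (s := Ioi 0))
      simpa using this
    have h2 : Filter.Tendsto (fun κ : ℝ≥0∞ => A * (κ * (2 ^ n * V)) ^ (q / s) * W) (𝓝[>] 0)
        (𝓝 0) := by
      have hB : 2 ^ n * V ≠ ∞ := by finiteness
      have h3 := ENNReal.Tendsto.mul_const (b := 2 ^ n * V)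
        (Filter.tendsto_id (x := 𝓝 (0 : ℝ≥0∞))) (Or.inr hB)
      have h4 := ((ENNReal.continuous_rpow_const (y := q / s)).tendsto _).comp h3
      have h5 := ENNReal.Tendsto.mul_const (b := W) (ENNReal.Tendsto.const_mul (a := A) h4
        (Or.inr hAt)) (Or.inr hWt)
      have h6 := h5.mono_left (nhdsWithin_le_nhds (s := Ioi 0))
      rw [zero_mul, ENNReal.zero_rpow_of_pos (by positivity), mul_zero, zero_mul] at h6
      exact h6
    have h3 : Ioc (0 : ℝ≥0∞) (1 / 2) ∈ 𝓝[>] (0 : ℝ≥0∞) := Ioc_mem_nhdsGT (by simp)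
    obtain ⟨κ, ⟨h4, h5⟩, h6⟩ := (((h1.eventually (ge_mem_nhds (pos_iff_ne_zero.2 hδ))).and
      (h2.eventually (ge_mem_nhds (pos_iff_ne_zero.2 hδ)))).and h3).exists
    exact ⟨κ, h6.1.ne', h6.2, h4, h5⟩
  obtain ⟨Z, hZ⟩ : ∃ Z, Z = ball (0 : EuclideanSpace ℝ (Fin n)) 1 ∩ {x | w x = 0} := ⟨_, rfl⟩
  have hSm : MeasurableSet {x | w x ≠ 0} := (hwm (measurableSet_singleton 0)).compl
  have hP : ∀ᵐ x, x ∈ Z → ∀ᶠ r in 𝓝[>] (0 : ℝ), closedBall x r ⊆ ball 0 R ∧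
      closedBall x (2 * r) ⊆ ball 0 R ∧
      volume (closedBall x r ∩ {x | w x ≠ 0}) ≤ κ * volume (closedBall x r) ∧
      ∫⁻ y in closedBall x (2 * r), ‖dw y‖ₑ ^ s ≤ κ * volume (closedBall x (2 * r)) := by
    have hF1m : Measurable ((ball 0 R).indicator fun x => ‖dw x‖ₑ ^ s) :=
      (hdwm.enorm.pow_const s).indicator measurableSet_ball
    have hF1 := ae_eventually_setLIntegral_le hF1m.aemeasurable
      (by rwa [lintegral_indicator measurableSet_ball])
    have hF2m : Measurable ((ball 0 R ∩ {x | w x ≠ 0}).indicator fun _ => (1 : ℝ≥0∞)) :=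
      measurable_const.indicator (measurableSet_ball.inter hSm)
    have hF2 := ae_eventually_setLIntegral_le hF2m.aemeasurable
      (by
        rw [lintegral_indicator (measurableSet_ball.inter hSm), setLIntegral_const, one_mul]
        exact measure_ne_top_of_subset inter_subset_left measure_ball_lt_top.ne)
    filter_upwards [hF1, hF2] with x h1 h2 hxZ
    rw [hZ] at hxZ
    have hx0 : w x = 0 := hxZ.2
    have hx1 : ‖x‖ < 1 := mem_ball_zero_iff.1 hxZ.1
    specialize h1 (by
      by_cases hxR : x ∈ ball (0 : EuclideanSpace ℝ (Fin n)) R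
      · rw [indicator_of_mem hxR, hdw0 x hx0, enorm_zero, ENNReal.zero_rpow_of_pos hs0]
      · rw [indicator_of_notMem hxR]) κ hκ0
    specialize h2 (indicator_of_notMem (fun hx => hx.2 hx0) _) κ hκ0
    have h2t : Filter.Tendsto (fun r : ℝ => 2 * r) (𝓝[>] 0) (𝓝[>] 0) := by
      refine tendsto_nhdsWithin_iff.2 ⟨?_, ?_⟩
      · have := (continuous_const_mul (2 : ℝ)).tendsto 0
        rw [mul_zero] at this
        exact this.mono_left nhdsWithin_le_nhds
      · filter_upwards [self_mem_nhdsWithin] with r hr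
        exact mul_pos two_pos (mem_Ioi.1 hr)
    have hsm : ∀ᶠ r in 𝓝[>] (0 : ℝ), closedBall x r ⊆ ball 0 R := by
      filter_upwards [Ioo_mem_nhdsGT (sub_pos.2 hR)] with r hr
      refine closedBall_subset_ball' ?_
      rw [dist_zero_right]
      linarith [hr.2]
    filter_upwards [h2, h2t.eventually h1, hsm, h2t.eventually hsm] with r h3 h4 h5 h6
    refine ⟨h5, h6, ?_, ?_⟩
    · rw [setLIntegral_indicator (measurableSet_ball.inter hSm), setLIntegral_const, one_mul] at h3
      refine le_trans (measure_mono ?_) h3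
      exact fun y hy => ⟨⟨h5 hy.1, hy.2⟩, hy.1⟩
    · rw [setLIntegral_indicator measurableSet_ball] at h4
      rwa [inter_eq_right.2 h6] at h4
  obtain ⟨F, r, hFr, hFd, hFc⟩ := exists_finset_closedBall_covering hP (fun x r h => h.1)
    (ENNReal.half_pos hδ).ne'
  have hsumW : ∑ i ∈ F, volume (closedBall i (r i)) ≤ W := by
    rw [← measure_biUnion_finset hFd fun _ _ => measurableSet_closedBall, hW]
    exact measure_mono (iUnion₂_subset fun i hi => (hFr i hi).2.1)
  have hex : ∀ i : EuclideanSpace ℝ (Fin n), ∃ η : EuclideanSpace ℝ (Fin n) → ℝ, i ∈ F →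
      (∃ D, LipschitzWith D η) ∧
        (∀ x, 0 ≤ η x ∧ η x ≤ 1) ∧ (∀ x, dist x i ≤ (1 - τ) * r i → η x = 1) ∧
        (∀ x, r i ≤ dist x i → η x = 0) ∧
        ∫⁻ x, ‖w x‖ₑ ^ q * ‖fderiv ℝ η x‖ₑ ^ q ≤
          A * (κ * (2 ^ n * V)) ^ (q / s) * volume (closedBall i (r i)) := by
    intro i
    by_cases hi : i ∈ F
    swap
    · exact ⟨0, fun h => absurd h hi⟩
    obtain ⟨hr0, hr1, hr2, hr3, hr4⟩ := hFr i hi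
    have hsub : ball i (2 * r i) ⊆ ball 0 R := ball_subset_closedBall.trans hr2
    obtain ⟨η, h1, h2, h3, h4, h5⟩ := hC w dw i (r i) τ hr0 hτ0 hτ2 (h.mono hsub)
      (hw.mono_set hsub) (hdw.mono_set hsub) hwm
      (ne_top_of_le_ne_top hfin (lintegral_mono_set hsub)) (by
        have h6 : volume (closedBall i (r i)) ≤ volume (closedBall i (r i) ∩ {x | w x = 0}) +
            1 / 2 * volume (closedBall i (r i)) := by
          refine le_trans ?_ (add_le_add le_rfl (hr3.trans (mul_le_mul_left hκ2 _)))
          refine le_trans (measure_mono fun y hy => ?_) (measure_union_le _ _)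
          by_cases hy0 : w y = 0
          · exact Or.inl ⟨hy, hy0⟩
          · exact Or.inr ⟨hy, hy0⟩
        have h7 := mul_le_mul_right h6 2
        rw [mul_add, ← mul_assoc 2 (1 / 2), one_div, ENNReal.mul_inv_cancel (by simp) (by simp),
          one_mul, two_mul] at h7
        exact (ENNReal.add_le_add_iff_right measure_closedBall_lt_top.ne).1 h7)
    refine ⟨η, fun _ => ⟨h1, h2, h3, h4, h5.trans ?_⟩⟩
    have h6 : ENNReal.ofReal ((r i ^ n)⁻¹) * ∫⁻ x in ball i (2 * r i), ‖dw x‖ₑ ^ s ≤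
        κ * (2 ^ n * V) := by
      calc _ ≤ ENNReal.ofReal ((r i ^ n)⁻¹) * (κ * volume (closedBall i (2 * r i))) := by
            gcongr
            exact (lintegral_mono_set ball_subset_closedBall).trans hr4
        _ = (ENNReal.ofReal ((r i ^ n)⁻¹) * ENNReal.ofReal (r i ^ n)) * (κ * (2 ^ n * V)) := by
            rw [hvol _ _ (by positivity), mul_pow, ENNReal.ofReal_mul (by positivity)]
            have : ENNReal.ofReal (2 ^ n) = 2 ^ n := by
              rw [ENNReal.ofReal_pow (by norm_num)]; simp
            rw [this]
            ring
        _ = _ := by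
            rw [← ENNReal.ofReal_mul (by positivity), inv_mul_cancel₀ (by positivity)]
            simp
    rw [hvol _ _ hr0.le, hA]
    calc _ ≤ C * ENNReal.ofReal (τ ^ (-(q - 1 + q / s))) * ENNReal.ofReal (r i ^ n) *
          (κ * (2 ^ n * V)) ^ (q / s) := by gcongr
      _ = (V⁻¹ * V) * (C * ENNReal.ofReal (τ ^ (-(q - 1 + q / s))) * ENNReal.ofReal (r i ^ n) *
          (κ * (2 ^ n * V)) ^ (q / s)) := by rw [ENNReal.inv_mul_cancel hV0 hVt, one_mul]
      _ = _ := by ring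
  choose η hη using hex
  obtain ⟨ζ, hζl, hζ01, hζd, hζ1, hζ0⟩ := exists_glued_cutoff hFd (fun i hi => (hη i hi).1)
    (fun i hi => (hη i hi).2.1) (fun i hi => (hη i hi).2.2.2.1) hq
  refine ⟨ζ, hζl, hζ01, ?_, ?_, ⋃ i ∈ F, ball i ((1 - τ) * r i),
    isOpen_biUnion fun _ _ => isOpen_ball, ?_, ?_⟩
  · have hm : ∀ i ∈ F, Measurable fun x => ‖w x‖ₑ ^ q * ‖fderiv ℝ (η i) x‖ₑ ^ q := fun i _ =>
      (hwm.enorm.pow_const q).mul ((measurable_fderiv ℝ (η i)).enorm.pow_const q)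
    calc _ ≤ ∫⁻ x, ∑ i ∈ F, ‖w x‖ₑ ^ q * ‖fderiv ℝ (η i) x‖ₑ ^ q := by
          refine lintegral_mono fun x => ?_
          rw [← Finset.mul_sum]
          exact mul_le_mul_right (hζd x) _
      _ = ∑ i ∈ F, ∫⁻ x, ‖w x‖ₑ ^ q * ‖fderiv ℝ (η i) x‖ₑ ^ q := lintegral_finsetSum _ hm
      _ ≤ ∑ i ∈ F, A * (κ * (2 ^ n * V)) ^ (q / s) * volume (closedBall i (r i)) :=
          Finset.sum_le_sum fun i hi => (hη i hi).2.2.2.2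
      _ ≤ A * (κ * (2 ^ n * V)) ^ (q / s) * W := by
          rw [← Finset.mul_sum]
          exact mul_le_mul_right hsumW _
      _ ≤ δ := hκ
  · calc _ ≤ volume (⋃ i ∈ F, closedBall i (r i) ∩ {x | w x ≠ 0}) := by
          refine measure_mono fun x hx => ?_
          obtain ⟨i, hi, hxi⟩ := hζ1 x hx.1
          exact mem_iUnion₂.2 ⟨i, hi, hxi, hx.2⟩
      _ ≤ ∑ i ∈ F, volume (closedBall i (r i) ∩ {x | w x ≠ 0}) := measure_biUnion_finset_le _ _
      _ ≤ ∑ i ∈ F, κ * volume (closedBall i (r i)) :=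
          Finset.sum_le_sum fun i hi => (hFr i hi).2.2.2.1
      _ ≤ κ * W := by
          rw [← Finset.mul_sum]
          exact mul_le_mul_right hsumW _
      _ ≤ δ := hκδ
  · intro x hx
    obtain ⟨i, hi, hxi⟩ := mem_iUnion₂.1 hx
    exact hζ0 i hi x ((hη i hi).2.2.1 x (mem_ball.1 hxi).le)
  · rw [← hZ]
    calc _ ≤ volume (Z \ ⋃ x ∈ F, closedBall x (r x)) +
          volume (⋃ i ∈ F, closedBall i (r i) \ ball i ((1 - τ) * r i)) := by
          refine le_trans (measure_mono fun x hx => ?_) (measure_union_le _ _)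
          by_cases hxF : x ∈ ⋃ x ∈ F, closedBall x (r x)
          · obtain ⟨i, hi, hxi⟩ := mem_iUnion₂.1 hxF
            exact Or.inr (mem_iUnion₂.2 ⟨i, hi, hxi, fun hb => hx.2 (mem_iUnion₂.2 ⟨i, hi, hb⟩)⟩)
          · exact Or.inl ⟨hx.1, hxF⟩
      _ ≤ δ / 2 + ∑ i ∈ F, volume (closedBall i (r i) \ ball i ((1 - τ) * r i)) :=
          add_le_add hFc (measure_biUnion_finset_le _ _)
      _ ≤ δ / 2 + ∑ i ∈ F, ENNReal.ofReal (1 - (1 - τ) ^ n) * volume (closedBall i (r i)) := by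
          refine add_le_add le_rfl (Finset.sum_le_sum fun i hi => ?_)
          have hr0 : 0 < r i := (hFr i hi).1
          have h1τ : 0 ≤ 1 - τ := by linarith
          have hle : (1 - τ) * r i ≤ r i := by nlinarith
          rw [measure_sdiff (ball_subset_closedBall.trans (closedBall_subset_closedBall hle))
            measurableSet_ball.nullMeasurableSet measure_ball_lt_top.ne, hvol _ _ hr0.le,
            hvolb _ _ (by positivity), ← ENNReal.sub_mul (fun _ _ => hVt),
            ← ENNReal.ofReal_sub _ (by positivity), ← mul_assoc,
            ← ENNReal.ofReal_mul (by
              have : (1 - τ) ^ n ≤ 1 := pow_le_one₀ h1τ (by linarith)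
              linarith)]
          refine le_of_eq ?_
          congr 2
          rw [mul_pow]
          ring
      _ ≤ δ / 2 + ENNReal.ofReal (1 - (1 - τ) ^ n) * W := by
          rw [← Finset.mul_sum]
          exact add_le_add le_rfl (mul_le_mul_right hsumW _)
      _ ≤ δ / 2 + δ / 2 := add_le_add le_rfl hτ
      _ = δ := ENNReal.add_halves δ

end smallCutoff
/-! ### Measurability and basic properties of quasi-minimizers -/

/-- Superposition of a Carathéodory function with a measurable map is measurable. -/
lemma aemeasurable_caratheodory {α X : Type*} [MeasurableSpace α] [TopologicalSpace X]
    {ν : Measure α} {f : α → X → ℝ} (hf : ∀ z, AEMeasurable (fun x => f x z) ν)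
    (hc : ∀ᵐ x ∂ν, Continuous fun z => f x z) {v : α → X} (hv : StronglyMeasurable v) :
    AEMeasurable (fun x => f x (v x)) ν := by
  refine aemeasurable_of_tendsto_metrizable_ae Filter.atTop (f := fun j x => f x (hv.approx j x))
    (fun j => ?_) ?_
  · have heq : (fun x => f x (hv.approx j x)) = fun x => ∑ z ∈ (hv.approx j).range,
        ((hv.approx j) ⁻¹' {z}).indicator (fun x => f x z) x := by
      classical
      funext x
      rw [Finset.sum_eq_single (hv.approx j x)]
      · rw [indicator_of_mem (by simp)]
      · intro z _ hz
        exact indicator_of_notMem (fun h => hz h.symm) _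
      · exact fun h => absurd ((hv.approx j).mem_range_self x) h
    rw [heq]
    exact Finset.aemeasurable_fun_sum _ fun z _ =>
      (hf z).indicator ((hv.approx j).measurableSet_fiber z)
  · filter_upwards [hc] with x hx
    exact (hx.tendsto _).comp (hv.tendsto_approx x)

section quasiminimizer

variable {n : ℕ} {Ω : Set (EuclideanSpace ℝ (Fin n))}
  {f : EuclideanSpace ℝ (Fin n) → EuclideanSpace ℝ (Fin n) → ℝ} {Q : ℝ}
  {u v : EuclideanSpace ℝ (Fin n) → ℝ}
  {du dv : EuclideanSpace ℝ (Fin n) → EuclideanSpace ℝ (Fin n)}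

lemma MeasureTheory.LocallyIntegrableOn.congr_ae_restrict {α F : Type*} [MeasurableSpace α]
    [TopologicalSpace α] [NormedAddCommGroup F] {ν : Measure α} {s : Set α} {a b : α → F}
    (ha : LocallyIntegrableOn a s ν) (hab : ∀ᵐ x ∂ν.restrict s, a x = b x) :
    LocallyIntegrableOn b s ν := by
  intro x hx
  obtain ⟨t, ht, hat⟩ := ha x hx
  exact ⟨t ∩ s, Filter.inter_mem ht self_mem_nhdsWithin,
    (hat.mono_set inter_subset_left).congr
      (ae_mono (Measure.restrict_mono inter_subset_right le_rfl) hab)⟩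

lemma IsQMinimizer.congr_ae (h : IsQMinimizer n Ω f Q u du)
    (huv : ∀ᵐ x ∂volume.restrict Ω, u x = v x) (hduv : ∀ᵐ x ∂volume.restrict Ω, du x = dv x) :
    IsQMinimizer n Ω f Q v dv := by
  obtain ⟨h1, h2, h3, h4⟩ := h
  refine ⟨h1.congr_ae huv hduv, h2.congr_ae_restrict huv, h3.congr_ae_restrict hduv,
    fun φ dφ hφ hφi hdφi hc hs => ?_⟩
  have hS : ∀ᵐ x ∂volume.restrict (tsupport φ), du x = dv x :=
    ae_mono (Measure.restrict_mono hs le_rfl) hduv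
  have e1 : (fun x => f x (du x)) =ᵐ[volume.restrict (tsupport φ)] fun x => f x (dv x) :=
    hS.mono fun x hx => by simp only [hx]
  have e2 : (fun x => f x (du x + dφ x)) =ᵐ[volume.restrict (tsupport φ)]
      fun x => f x (dv x + dφ x) := hS.mono fun x hx => by simp only [hx]
  obtain ⟨h5, h6⟩ := h4 φ dφ hφ hφi hdφi hc hs
  refine ⟨h5.congr e1, fun h7 => ?_⟩
  rw [← integral_congr_ae e1, ← integral_congr_ae e2]
  exact h6 (h7.congr e2.symm)

/-- The energy density of a quasi-minimizer is integrable on closed balls. -/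
lemma IsQMinimizer.integrableOn_closedBall (h : IsQMinimizer n Ω f Q u du) {R : ℝ} (hR : 0 < R)
    (hRΩ : closedBall 0 R ⊆ Ω) : IntegrableOn (fun x => f x (du x)) (closedBall 0 R) := by
  let b : ContDiffBump (0 : EuclideanSpace ℝ (Fin n)) := ⟨R / 2, R, half_pos hR, half_lt_self hR⟩
  have hb : ContDiff ℝ 1 b := b.contDiff
  have hw : IsWeakGradOn n univ b (gradient b) := by
    intro φ hφ hc _ i
    rw [setIntegral_univ, setIntegral_univ,
      integral_mul_fderiv_single_eq hb (hφ.of_le (by exact_mod_cast le_top)) hc i]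
    congr 2
    ext x
    rw [← inner_gradient_left, EuclideanSpace.inner_single_right]
    simp
  have hg : Continuous (gradient b) :=
    (InnerProductSpace.toDual ℝ _).symm.continuous.comp (hb.continuous_fderiv one_ne_zero)
  have hgc : HasCompactSupport (gradient b) :=
    (b.hasCompactSupport.fderiv ℝ).comp_left (map_zero _)
  have := (h.2.2.2 b (gradient b) (hw.mono (subset_univ _))
    (hb.continuous.integrable_of_hasCompactSupport b.hasCompactSupport).integrableOn
    (hg.integrable_of_hasCompactSupport hgc).integrableOn b.hasCompactSupport
    (b.tsupport_eq ▸ hRΩ)).1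
  rwa [b.tsupport_eq] at this

/-- Quasi-minimality in terms of a pointwise upper bound of the competitor's energy density. -/
lemma IsQMinimizer.setLIntegral_le (h : IsQMinimizer n Ω f Q u du) (hQ : 1 ≤ Q)
    {G φ : EuclideanSpace ℝ (Fin n) → ℝ} {dφ : EuclideanSpace ℝ (Fin n) → EuclideanSpace ℝ (Fin n)}
    (hφ : IsWeakGradOn n Ω φ dφ) (hφi : IntegrableOn φ Ω) (hdφi : IntegrableOn dφ Ω)
    (hc : IsCompact (tsupport φ)) (hs : tsupport φ ⊆ Ω) (hG : IntegrableOn G (tsupport φ))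
    (hG0 : ∀ᵐ x ∂volume.restrict (tsupport φ), 0 ≤ G x)
    (hm : AEMeasurable (fun x => f x (du x + dφ x)) (volume.restrict (tsupport φ)))
    (h0 : ∀ᵐ x ∂volume.restrict (tsupport φ), 0 ≤ f x (du x) + G x)
    (h1 : ∀ᵐ x ∂volume.restrict (tsupport φ), 0 ≤ f x (du x + dφ x) + G x)
    {E : EuclideanSpace ℝ (Fin n) → ℝ≥0∞}
    (hE : ∀ᵐ x ∂volume.restrict (tsupport φ), ENNReal.ofReal (f x (du x + dφ x) + G x) ≤ E x) :
    ∫⁻ x in tsupport φ, ENNReal.ofReal (f x (du x) + G x) ≤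
      ENNReal.ofReal Q * ∫⁻ x in tsupport φ, E x := by
  obtain ⟨h2, h3⟩ := h.2.2.2 φ dφ hφ hφi hdφi hc hs
  by_cases htop : ∫⁻ x in tsupport φ, E x = ∞
  · rw [htop, ENNReal.mul_top (ENNReal.ofReal_pos.2 (by linarith)).ne']
    exact le_top
  have h4 : IntegrableOn (fun x => f x (du x + dφ x) + G x) (tsupport φ) := by
    refine ⟨(hm.aestronglyMeasurable.add hG.aestronglyMeasurable), ?_⟩
    rw [hasFiniteIntegral_iff_ofReal h1]
    exact (lintegral_mono_ae hE).trans_lt (lt_top_iff_ne_top.2 htop)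
  have h5 : IntegrableOn (fun x => f x (du x + dφ x)) (tsupport φ) := by
    have := h4.sub hG
    exact this.congr (Filter.Eventually.of_forall fun x => by simp)
  have h6 : (∫ x in tsupport φ, f x (du x) + G x) ≤
      Q * ∫ x in tsupport φ, f x (du x + dφ x) + G x := by
    rw [integral_add h2 hG, integral_add h5 hG]
    have := integral_nonneg_of_ae hG0
    nlinarith [h3 h5]
  have h7 : IntegrableOn (fun x => f x (du x) + G x) (tsupport φ) := h2.add hG
  rw [← ofReal_integral_eq_lintegral_ofReal h7 h0]
  refine (ENNReal.ofReal_le_ofReal h6).trans ?_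
  rw [ENNReal.ofReal_mul (by linarith), ofReal_integral_eq_lintegral_ofReal h4 h1]
  exact mul_le_mul_right (lintegral_mono_ae hE) _

end quasiminimizer
/-! ### Iteration lemma -/

/-- The hole-filling iteration lemma. -/
lemma exists_iteration_const {θ γ : ℝ} (hθ0 : 0 < θ) (hθ1 : θ < 1) (hγ : 0 < γ) :
    ∃ c : ℝ, 0 < c ∧ ∀ (Z : ℝ → ℝ) (ρ σ A B M : ℝ), ρ < σ → 0 ≤ A → 0 ≤ B →
      (∀ t, ρ ≤ t → t < σ → Z t ≤ M) →
      (∀ t τ, ρ ≤ t → t < τ → τ < σ → Z t ≤ θ * Z τ + (A + B * (τ - t) ^ (-γ))) →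
      Z ρ ≤ c * (A + B * (σ - ρ) ^ (-γ)) := by
  obtain ⟨θ', hθ', hθ'1⟩ := exists_between hθ1
  have hθ'0 : 0 < θ' := hθ0.trans hθ'
  obtain ⟨l, hl⟩ : ∃ l, l = (θ / θ') ^ (1 / γ) := ⟨_, rfl⟩
  have hl0 : 0 < l := hl ▸ Real.rpow_pos_of_pos (div_pos hθ0 hθ'0) _
  have hl1 : l < 1 := hl ▸ Real.rpow_lt_one (div_pos hθ0 hθ'0).le ((div_lt_one hθ'0).2 hθ')
    (by positivity)
  have hlγ : θ * l ^ (-γ) = θ' := by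
    rw [hl, ← Real.rpow_mul (div_pos hθ0 hθ'0).le]
    rw [show 1 / γ * -γ = -1 by field_simp, Real.rpow_neg_one]
    field_simp
  have hl1' : 0 < 1 - l := by linarith
  obtain ⟨m, hm⟩ : ∃ m, m = (1 - l) ^ (-γ) := ⟨_, rfl⟩
  have hm1 : 1 ≤ m := hm ▸ Real.one_le_rpow_of_pos_of_le_one_of_nonpos hl1' (by linarith)
    (by linarith)
  have hd : 0 < 1 - θ' := by linarith
  obtain ⟨c, hc⟩ : ∃ c, c = m / (1 - θ') := ⟨_, rfl⟩
  have hc0 : 0 < c := hc ▸ div_pos (by linarith) hd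
  have hcm : θ' * c + m = c := by rw [hc]; field_simp; ring
  refine ⟨c, hc0, fun Z ρ σ A B M hρσ hA hB hM hZ => ?_⟩
  have key : ∀ i : ℕ, ∀ t, ρ ≤ t → t < σ →
      Z t ≤ θ ^ i * M + c * (A + B * (σ - t) ^ (-γ)) := by
    intro i
    induction i with
    | zero =>
      intro t h1 h2
      have : 0 ≤ (σ - t) ^ (-γ) := Real.rpow_nonneg (by linarith) _
      have := hM t h1 h2
      have : 0 ≤ c * (A + B * (σ - t) ^ (-γ)) := by positivity
      simpa using by linarith
    | succ i ih =>
      intro t h1 h2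
      have hd' : 0 < σ - t := by linarith
      have h3 := hZ t (t + (1 - l) * (σ - t)) h1 (by nlinarith) (by nlinarith)
      have h4 := ih (t + (1 - l) * (σ - t)) (by nlinarith) (by nlinarith)
      rw [show t + (1 - l) * (σ - t) - t = (1 - l) * (σ - t) by ring,
        Real.mul_rpow hl1'.le hd'.le, ← hm] at h3
      rw [show σ - (t + (1 - l) * (σ - t)) = l * (σ - t) by ring,
        Real.mul_rpow hl0.le hd'.le] at h4
      obtain ⟨D, hD⟩ : ∃ D, D = (σ - t) ^ (-γ) := ⟨_, rfl⟩
      have hD0 : 0 ≤ D := hD ▸ Real.rpow_nonneg hd'.le _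
      rw [← hD] at h3 h4 ⊢
      have h5 := mul_le_mul_of_nonneg_left h4 hθ0.le
      have h6 : θ * (θ ^ i * M + c * (A + B * (l ^ (-γ) * D))) =
          θ ^ (i + 1) * M + (θ * c * A + (θ * l ^ (-γ)) * c * (B * D)) := by ring
      rw [h6, hlγ] at h5
      have h7 : θ * c * A + A ≤ c * A := by
        have : θ * c + 1 ≤ c := by nlinarith
        nlinarith
      have h8 : θ' * c * (B * D) + m * (B * D) = c * (B * D) := by rw [← add_mul, hcm]
      nlinarith
  have hlim : Filter.Tendsto (fun i : ℕ => θ ^ i * M + c * (A + B * (σ - ρ) ^ (-γ))) Filter.atTop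
      (𝓝 (0 * M + c * (A + B * (σ - ρ) ^ (-γ)))) :=
    ((tendsto_pow_atTop_nhds_zero_of_lt_one hθ0.le hθ1).mul_const M).add_const _
  rw [zero_mul, zero_add] at hlim
  exact ge_of_tendsto' hlim fun i => key i ρ le_rfl hρσ
/-! ### Competitors and cutoff functions -/

section competitor

variable {n : ℕ} {q : ℝ}

/-- Convexity and the upper growth bound control the energy density of a competitor. -/
lemma ConvexOn.competitor_le {F : EuclideanSpace ℝ (Fin n) → ℝ} (hF : ConvexOn ℝ univ F)
    {L G : ℝ} (hL : 0 ≤ L) (hG : 0 ≤ G) (hq : 1 < q) (hup : ∀ z, F z ≤ L * ‖z‖ ^ q + G)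
    {η : ℝ} (hη0 : 0 ≤ η) (hη1 : η ≤ 1) (w : ℝ) (a b : EuclideanSpace ℝ (Fin n)) :
    F (a - (η ^ q • a + w • ((q * η ^ (q - 1)) • b))) + G ≤
      (1 - η ^ q) * (F a + G) + (2 * G + L * q ^ q * (|w| ^ q * ‖b‖ ^ q)) := by
  have hq0 : 0 < q := by linarith
  have hT1 : η ^ q ≤ 1 := Real.rpow_le_one hη0 hη1 hq0.le
  have hlast : 0 ≤ L * q ^ q * (|w| ^ q * ‖b‖ ^ q) := by positivity
  rcases hη0.eq_or_lt with h0 | h0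
  · rw [← h0, Real.zero_rpow hq0.ne', Real.zero_rpow (by linarith)]
    simp only [zero_smul, mul_zero, smul_zero, add_zero, sub_zero, one_mul]
    linarith
  · obtain ⟨z, hz⟩ : ∃ z, z = -((w * q / η) • b) := ⟨_, rfl⟩
    have hqη : η ^ q = η ^ (q - 1) * η := by
      rw [← Real.rpow_add_one h0.ne']; ring_nf
    have hd : a - (η ^ q • a + w • ((q * η ^ (q - 1)) • b)) = (1 - η ^ q) • a + η ^ q • z := by
      rw [hz, smul_neg, smul_smul, smul_smul, sub_smul, one_smul,
        show η ^ q * (w * q / η) = w * (q * η ^ (q - 1)) by rw [hqη]; field_simp]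
      abel
    have hcv := hF.2 (mem_univ a) (mem_univ z) (sub_nonneg.2 hT1) (Real.rpow_nonneg hη0 q)
      (by ring)
    rw [← hd, smul_eq_mul, smul_eq_mul] at hcv
    have hnz : η ^ q * ‖z‖ ^ q = q ^ q * (|w| ^ q * ‖b‖ ^ q) := by
      rw [hz, norm_neg, norm_smul, Real.norm_eq_abs, abs_div, abs_mul, abs_of_pos h0,
        abs_of_pos hq0, Real.mul_rpow (by positivity) (norm_nonneg _),
        Real.div_rpow (by positivity) hη0, Real.mul_rpow (abs_nonneg _) hq0.le]
      have := (Real.rpow_pos_of_pos h0 q).ne'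
      field_simp
    have hz2 := mul_le_mul_of_nonneg_left (hup z) (Real.rpow_nonneg hη0 q)
    have : η ^ q * (L * ‖z‖ ^ q + G) = L * q ^ q * (|w| ^ q * ‖b‖ ^ q) + η ^ q * G := by
      rw [mul_assoc L, ← hnz]; ring
    rw [this] at hz2
    nlinarith [mul_le_mul_of_nonneg_right hT1 hG]

lemma LipschitzWith.rpow_const_of_mem_Icc {η : EuclideanSpace ℝ (Fin n) → ℝ} {D : ℝ≥0}
    (hη : LipschitzWith D η) (hη1 : ∀ x, 0 ≤ η x ∧ η x ≤ 1) (hq : 1 ≤ q) :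
    ∃ D', LipschitzWith D' fun x => η x ^ q := by
  refine ⟨q.toNNReal * D, ?_⟩
  have h1 : LipschitzOnWith q.toNNReal (fun t : ℝ => t ^ q) (Icc 0 1) := by
    refine (convex_Icc 0 1).lipschitzOnWith_of_nnnorm_hasDerivWithin_le
      (f' := fun t => q * t ^ (q - 1))
      (fun t _ => (Real.hasDerivAt_rpow_const (Or.inr hq)).hasDerivWithinAt) fun t ht => ?_
    rw [← NNReal.coe_le_coe, coe_nnnorm, Real.coe_toNNReal _ (by linarith), Real.norm_eq_abs,
      abs_of_nonneg (mul_nonneg (by linarith) (Real.rpow_nonneg ht.1 _))]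
    exact mul_le_of_le_one_right (by linarith) (Real.rpow_le_one ht.1 ht.2 (by linarith))
  rw [← lipschitzOnWith_univ] at hη ⊢
  exact h1.comp hη fun x _ => hη1 x

lemma LipschitzWith.ae_gradient_rpow_const {η : EuclideanSpace ℝ (Fin n) → ℝ} {D : ℝ≥0}
    (hη : LipschitzWith D η) (hq : 1 ≤ q) :
    ∀ᵐ x, gradient (fun x => η x ^ q) x = (q * η x ^ (q - 1)) • gradient η x := by
  filter_upwards [hη.ae_differentiableAt (μ := volume)] with x hx
  have := hx.hasFDerivAt.rpow_const (p := q) (Or.inr hq)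
  rw [gradient, this.fderiv, map_smul]
  rfl

lemma lintegral_mul_fderiv_mul_le {w η ζ : EuclideanSpace ℝ (Fin n) → ℝ} {D D' : ℝ≥0}
    (hw : Measurable w) (hη : LipschitzWith D η) (hη1 : ∀ x, 0 ≤ η x ∧ η x ≤ 1)
    (hζ : LipschitzWith D' ζ) (hζ1 : ∀ x, 0 ≤ ζ x ∧ ζ x ≤ 1) (hq : 1 ≤ q) :
    ∫⁻ x, ‖w x‖ₑ ^ q * ‖fderiv ℝ (fun x => η x * ζ x) x‖ₑ ^ q ≤
      2 ^ (q - 1) * ((∫⁻ x, ‖w x‖ₑ ^ q * ‖fderiv ℝ η x‖ₑ ^ q) +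
        ∫⁻ x, ‖w x‖ₑ ^ q * ‖fderiv ℝ ζ x‖ₑ ^ q) := by
  have hm : Measurable fun x => ‖w x‖ₑ ^ q * ‖fderiv ℝ η x‖ₑ ^ q :=
    (hw.enorm.pow_const q).mul ((measurable_fderiv ℝ η).enorm.pow_const q)
  rw [← lintegral_add_left hm, ← lintegral_const_mul' _ _ (by
    exact ENNReal.rpow_ne_top_of_nonneg (by linarith) (by norm_num))]
  refine lintegral_mono_ae ?_
  filter_upwards [hη.ae_differentiableAt (μ := volume), hζ.ae_differentiableAt (μ := volume)]
    with x hx hx'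
  have he : ∀ t : ℝ, 0 ≤ t ∧ t ≤ 1 → ‖t‖ₑ ≤ 1 := fun t ht => by
    rw [Real.enorm_eq_ofReal ht.1]
    exact ENNReal.ofReal_le_one.2 ht.2
  have h1 : ‖fderiv ℝ (fun x => η x * ζ x) x‖ₑ ≤ ‖fderiv ℝ η x‖ₑ + ‖fderiv ℝ ζ x‖ₑ := by
    rw [fderiv_fun_mul hx hx', add_comm ‖fderiv ℝ η x‖ₑ]
    refine (enorm_add_le (η x • fderiv ℝ ζ x) (ζ x • fderiv ℝ η x)).trans ?_
    rw [enorm_smul, enorm_smul]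
    exact add_le_add (mul_le_of_le_one_left' (he _ (hη1 x)))
      (mul_le_of_le_one_left' (he _ (hζ1 x)))
  calc ‖w x‖ₑ ^ q * ‖fderiv ℝ (fun x => η x * ζ x) x‖ₑ ^ q
      ≤ ‖w x‖ₑ ^ q * (2 ^ (q - 1) * (‖fderiv ℝ η x‖ₑ ^ q + ‖fderiv ℝ ζ x‖ₑ ^ q)) := by
        refine mul_le_mul_right ((ENNReal.rpow_le_rpow h1 (by linarith)).trans ?_) _
        exact ENNReal.rpow_add_le_mul_rpow_add_rpow _ _ hq
    _ = _ := by ring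

end competitor
/-! ### The energy estimate -/

section energy

variable {n : ℕ} {q : ℝ} {Ω : Set (EuclideanSpace ℝ (Fin n))}
  {f : EuclideanSpace ℝ (Fin n) → EuclideanSpace ℝ (Fin n) → ℝ} {Q L : ℝ}
  {u G : EuclideanSpace ℝ (Fin n) → ℝ} {du : EuclideanSpace ℝ (Fin n) → EuclideanSpace ℝ (Fin n)}

lemma measurable_gradient (η : EuclideanSpace ℝ (Fin n) → ℝ) : Measurable (gradient η) :=
  (InnerProductSpace.toDual ℝ _).symm.continuous.measurable.comp (measurable_fderiv ℝ η)

lemma enorm_gradient (η : EuclideanSpace ℝ (Fin n) → ℝ) (x : EuclideanSpace ℝ (Fin n)) :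
    ‖gradient η x‖ₑ = ‖fderiv ℝ η x‖ₑ := by
  rw [← ofReal_norm, ← ofReal_norm, gradient, LinearIsometryEquiv.norm_map]

/-- A product of a Lipschitz function supported in `O` with a function which is weakly
differentiable in `O` is a globally integrable function with integrable gradient. -/
lemma IsWeakGradOn.integrable_mul_lipschitz {O : Set (EuclideanSpace ℝ (Fin n))}
    {w Θ : EuclideanSpace ℝ (Fin n) → ℝ} {dw : EuclideanSpace ℝ (Fin n) → EuclideanSpace ℝ (Fin n)}
    {D : ℝ≥0} (hw : IntegrableOn w O) (hdw : IntegrableOn dw O) (hΘ : LipschitzWith D Θ)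
    (hΘ1 : ∀ x, ‖Θ x‖ ≤ 1) (hΘO : tsupport Θ ⊆ O) :
    Integrable (fun x => Θ x * w x) ∧
      Integrable (fun x => Θ x • dw x + w x • gradient Θ x) := by
  have hz : ∀ x, x ∉ O → Θ x = 0 := fun x hx => image_eq_zero_of_notMem_tsupport
    fun h => hx (hΘO h)
  have hzg : ∀ x, x ∉ O → gradient Θ x = 0 := fun x hx => by
    rw [gradient, image_eq_zero_of_notMem_tsupport
      fun h => hx (hΘO (tsupport_fderiv_subset ℝ h)), map_zero]
  have hg : ∀ x, ‖gradient Θ x‖ ≤ D := fun x => by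
    rw [gradient, LinearIsometryEquiv.norm_map]
    exact norm_fderiv_le_of_lipschitz ℝ hΘ
  have hΘm : AEStronglyMeasurable Θ (volume.restrict O) := hΘ.continuous.aestronglyMeasurable
  constructor
  · refine (integrableOn_iff_integrable_of_support_subset fun x hx => ?_).1
      (Integrable.bdd_mul (c := 1) hw hΘm (Filter.Eventually.of_forall hΘ1))
    by_contra h
    exact hx (by simp [hz x h])
  · have h1 : IntegrableOn (fun x => Θ x • dw x) O :=
      Integrable.bdd_smul hdw 1 hΘm (Filter.Eventually.of_forall hΘ1)
    have h2 : IntegrableOn (fun x => w x • gradient Θ x) O :=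
      Integrable.smul_bdd hw D (measurable_gradient Θ).aestronglyMeasurable
        (Filter.Eventually.of_forall hg)
    refine (integrableOn_iff_integrable_of_support_subset fun x hx => ?_).1 (h1.add h2)
    by_contra h
    exact hx (by simp [hz x h, hzg x h])

/-- Energy comparison of a quasi-minimizer with the competitor obtained from a cutoff function
`η * ζ`. -/
lemma IsQMinimizer.energy_step (h : IsQMinimizer n Ω f Q u du) (hQ : 1 ≤ Q)
    (hu : Measurable u) (hdu : Measurable du)
    (hGi : IntegrableOn G Ω) (hG0 : ∀ᵐ x ∂volume.restrict Ω, 0 ≤ G x)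
    (hfm : ∀ z, AEMeasurable (fun x => f x z) (volume.restrict Ω))
    (hfc : ∀ᵐ x ∂volume.restrict Ω, Continuous fun z => f x z)
    (hfx : ∀ᵐ x ∂volume.restrict Ω, ConvexOn ℝ univ fun z => f x z)
    (hf0 : ∀ᵐ x ∂volume.restrict Ω, ∀ z, 0 ≤ f x z + G x)
    (hL : 0 ≤ L) (hq : 1 < q) (hup : ∀ᵐ x ∂volume.restrict Ω, ∀ z, f x z ≤ L * ‖z‖ ^ q + G x)
    {k R : ℝ} (hR : 1 < R) (hRΩ : ball 0 R ⊆ Ω)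
    {w : EuclideanSpace ℝ (Fin n) → ℝ} {dw : EuclideanSpace ℝ (Fin n) → EuclideanSpace ℝ (Fin n)}
    (hwe : w = fun x => max (u x - k) 0) (hdwe : dw = {x | k < u x}.indicator du)
    (hw : IsWeakGradOn n (ball 0 R) w dw) (hwi : IntegrableOn w (ball 0 R))
    (hdwi : IntegrableOn dw (ball 0 R)) {t τ : ℝ} (htτ : t < τ) (hτ : τ ≤ 1)
    {η ζ : EuclideanSpace ℝ (Fin n) → ℝ} {D D' : ℝ≥0} (hη : LipschitzWith D η)
    (hη1 : ∀ x, 0 ≤ η x ∧ η x ≤ 1) (hηt : ∀ x, ‖x‖ ≤ t → η x = 1)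
    (hητ : ∃ σ' < τ, ∀ x, σ' ≤ ‖x‖ → η x = 0) (hζ : LipschitzWith D' ζ)
    (hζ1 : ∀ x, 0 ≤ ζ x ∧ ζ x ≤ 1) {δ e : ℝ≥0∞}
    (hζδ : volume ({x | ζ x < 1} ∩ {x | w x ≠ 0}) ≤ δ)
    (hU : ∃ U, IsOpen U ∧ (∀ x ∈ U, ζ x = 0) ∧ volume ((ball 0 1 ∩ {x | w x = 0}) \ U) ≤ δ)
    (he : ∀ s ⊆ ball 0 1, volume s ≤ δ → ∫⁻ x in s, ENNReal.ofReal (f x (du x) + G x) ≤ e) :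
    ∫⁻ x in ball 0 t ∩ {x | k < u x}, ENNReal.ofReal (f x (du x) + G x) ≤
      ENNReal.ofReal Q * ((∫⁻ x in (ball 0 τ ∩ {x | k < u x}) \ (ball 0 t ∩ {x | k < u x}),
          ENNReal.ofReal (f x (du x) + G x)) + e + e +
        2 * (∫⁻ x in ball 0 τ ∩ {x | k < u x}, ENNReal.ofReal (G x)) +
        ENNReal.ofReal (L * q ^ q) *
          ∫⁻ x, ‖w x‖ₑ ^ q * ‖fderiv ℝ (fun x => η x * ζ x) x‖ₑ ^ q) + e := by
  obtain ⟨σ', hσ', hησ⟩ := hητ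
  obtain ⟨U, hUo, hU0, hUδ⟩ := hU
  have hq0 : 0 < q := by linarith
  obtain ⟨H, hH⟩ : ∃ H : EuclideanSpace ℝ (Fin n) → ℝ≥0∞,
      H = fun x => ENNReal.ofReal (f x (du x) + G x) := ⟨_, rfl⟩
  have hHx : ∀ x, ENNReal.ofReal (f x (du x) + G x) = H x := fun x => by rw [hH]
  simp only [hHx] at he ⊢
  obtain ⟨A, hA⟩ : ∃ A : ℝ → Set (EuclideanSpace ℝ (Fin n)),
      A = fun r => ball 0 r ∩ {x | k < u x} := ⟨_, rfl⟩
  have hAx : ∀ r, ball 0 r ∩ {x | k < u x} = A r := fun r => by rw [hA]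
  simp only [hAx]
  have hAm : ∀ r, MeasurableSet (A r) := fun r => by
    rw [hA]; exact measurableSet_ball.inter (measurableSet_lt measurable_const hu)
  have hwm : Measurable w := by rw [hwe]; exact (hu.sub_const k).max measurable_const
  have hw0 : ∀ x, w x ≠ 0 ↔ k < u x := fun x => by
    rw [hwe]
    refine ⟨fun h' => ?_, fun h' => ?_⟩
    · by_contra h''
      exact h' (max_eq_right (by linarith))
    · simp only [ne_eq]
      rw [max_eq_left (by linarith)]
      linarith
  have hdw1 : ∀ x, w x ≠ 0 → dw x = du x := fun x hx => by
    rw [hdwe]; exact indicator_of_mem (show x ∈ {x | k < u x} from (hw0 x).1 hx) _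
  have hdw0 : ∀ x, w x = 0 → dw x = 0 := fun x hx => by
    rw [hdwe]
    exact indicator_of_notMem (show x ∉ {x | k < u x} from fun h' => (hw0 x).2 h' hx) _
  obtain ⟨χ, hχ⟩ : ∃ χ : EuclideanSpace ℝ (Fin n) → ℝ, χ = fun x => η x * ζ x := ⟨_, rfl⟩
  have hχ1 : ∀ x, 0 ≤ χ x ∧ χ x ≤ 1 := fun x => by
    rw [hχ]
    exact ⟨mul_nonneg (hη1 x).1 (hζ1 x).1, mul_le_one₀ (hη1 x).2 (hζ1 x).1 (hζ1 x).2⟩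
  obtain ⟨Dχ, hχL⟩ : ∃ D, LipschitzWith D χ := by
    refine ⟨D + D', LipschitzWith.of_dist_le_mul fun x y => ?_⟩
    have h1 := hη.dist_le_mul x y
    have h2 := hζ.dist_le_mul x y
    rw [Real.dist_eq] at h1 h2 ⊢
    have h3 : χ x - χ y = η x * (ζ x - ζ y) + ζ y * (η x - η y) := by rw [hχ]; ring
    rw [h3]
    refine (abs_add_le _ _).trans ?_
    rw [abs_mul, abs_mul, abs_of_nonneg (hη1 x).1, abs_of_nonneg (hζ1 y).1]
    push_cast
    nlinarith [abs_nonneg (ζ x - ζ y), abs_nonneg (η x - η y), (hη1 x).2, (hζ1 y).2]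
  obtain ⟨DΘ, hΘL⟩ := hχL.rpow_const_of_mem_Icc hχ1 hq.le
  obtain ⟨T, hT⟩ : ∃ T : EuclideanSpace ℝ (Fin n) → ℝ, T = fun x => -(χ x ^ q) := ⟨_, rfl⟩
  have hTL : LipschitzWith DΘ T := by rw [hT]; exact hΘL.neg
  have hT1 : ∀ x, ‖T x‖ ≤ 1 := fun x => by
    rw [hT]
    simp only [norm_neg, Real.norm_eq_abs]
    rw [abs_of_nonneg (Real.rpow_nonneg (hχ1 x).1 _)]
    exact Real.rpow_le_one (hχ1 x).1 (hχ1 x).2 hq0.le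
  have hT0 : ∀ x, χ x = 0 → T x = 0 := fun x hx => by
    rw [hT]; simp only [hx, Real.zero_rpow hq0.ne', neg_zero]
  have hTg : ∀ᵐ x, gradient T x = -((q * χ x ^ (q - 1)) • gradient χ x) := by
    filter_upwards [hχL.ae_gradient_rpow_const hq.le] with x hx
    rw [← hx, hT, gradient, gradient, ← map_neg]
    congr 1
    exact fderiv_fun_neg
  have hsupp : tsupport T ⊆ closedBall 0 σ' := by
    refine closure_minimal (fun x hx => ?_) isClosed_closedBall
    by_contra h'
    rw [mem_closedBall, dist_zero_right, not_le] at h'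
    exact hx (hT0 x (by rw [hχ]; simp only [hησ x h'.le, zero_mul]))
  have hTc : HasCompactSupport T :=
    (isCompact_closedBall _ _).of_isClosed_subset (isClosed_tsupport _) hsupp
  have hTR : tsupport T ⊆ ball 0 R := hsupp.trans (closedBall_subset_ball (by linarith))
  obtain ⟨hφi, hdφi⟩ := IsWeakGradOn.integrable_mul_lipschitz hwi hdwi hTL hT1 hTR
  have hφ := hw.mul_lipschitz isOpen_ball hwi hdwi hTL hT1 hTc hTR Ω
  obtain ⟨φ, hφe⟩ : ∃ φ : EuclideanSpace ℝ (Fin n) → ℝ, φ = fun x => T x * w x := ⟨_, rfl⟩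
  obtain ⟨dφ, hdφe⟩ : ∃ dφ : EuclideanSpace ℝ (Fin n) → EuclideanSpace ℝ (Fin n),
    dφ = fun x => T x • dw x + w x • gradient T x := ⟨_, rfl⟩
  rw [← hφe] at hφ hφi
  rw [← hdφe] at hφ hdφi
  obtain ⟨S, hS⟩ : ∃ S, S = tsupport φ := ⟨_, rfl⟩
  have hST : S ⊆ tsupport T := by
    rw [hS]
    refine closure_mono fun x hx h' => hx ?_
    rw [hφe]; simp only [h', zero_mul]
  have hSτ : S ⊆ ball 0 τ := (hST.trans hsupp).trans (closedBall_subset_ball hσ')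
  have hS1 : S ⊆ ball 0 1 := hSτ.trans (ball_subset_ball hτ)
  have hSΩ : S ⊆ Ω := hS1.trans ((ball_subset_ball hR.le).trans hRΩ)
  have hSU : ∀ x ∈ S, x ∉ U := by
    intro x hx hxU
    rw [hS] at hx
    obtain ⟨y, hyU, hy⟩ := mem_closure_iff.1 hx U hUo hxU
    refine hy ?_
    rw [hφe]
    simp only [hT0 y (by rw [hχ]; simp only [hU0 y hyU, mul_zero]), zero_mul]
  have hSc : IsCompact S := by
    rw [hS]
    exact hTc.isCompact.of_isClosed_subset (isClosed_tsupport _) (hS ▸ hST)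
  have hSm : MeasurableSet S := hSc.measurableSet
  have hle : volume.restrict S ≤ volume.restrict Ω := Measure.restrict_mono hSΩ le_rfl
  have hdφm : Measurable dφ := by
    rw [hdφe]
    have hdwm : Measurable dw := by
      rw [hdwe]; exact hdu.indicator (measurableSet_lt measurable_const hu)
    exact (hTL.continuous.measurable.smul hdwm).add (hwm.smul (measurable_gradient T))
  have hHm : AEMeasurable H (volume.restrict S) := by
    rw [hH]
    exact ((aemeasurable_caratheodory (fun z => (hfm z).mono_measure hle) (ae_mono hle hfc)
      hdu.stronglyMeasurable).add (hGi.mono_set hSΩ).aemeasurable).ennreal_ofReal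
  have hGm : AEMeasurable (fun x => 2 * ENNReal.ofReal (G x)) (volume.restrict S) :=
    (hGi.mono_set hSΩ).aemeasurable.ennreal_ofReal.const_mul _
  obtain ⟨Z, hZ⟩ : ∃ Z, Z = {x | ζ x < 1} ∩ {x | w x ≠ 0} ∩ ball 0 1 := ⟨_, rfl⟩
  have hw0m : MeasurableSet {x | w x = 0} := hwm (measurableSet_singleton 0)
  have hZm : MeasurableSet Z := by
    rw [hZ]
    exact ((measurableSet_lt hζ.continuous.measurable measurable_const).inter
      hw0m.compl).inter measurableSet_ball
  have hZe : ∫⁻ x in Z, H x ≤ e := he Z (by rw [hZ]; exact inter_subset_right)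
    (le_trans (measure_mono (by rw [hZ]; exact inter_subset_left)) hζδ)
  obtain ⟨N, hN⟩ : ∃ N, N = S ∩ {x | w x = 0} := ⟨_, rfl⟩
  have hNm : MeasurableSet N := by rw [hN]; exact hSm.inter hw0m
  have hNe : ∫⁻ x in N, H x ≤ e := by
    refine he N (by rw [hN]; exact inter_subset_left.trans hS1) (le_trans (measure_mono ?_) hUδ)
    rw [hN]
    exact fun x hx => ⟨⟨hS1 hx.1, hx.2⟩, hSU x hx.1⟩
  have hcm : Measurable fun x => ENNReal.ofReal (L * q ^ q) *
      (‖w x‖ₑ ^ q * ‖fderiv ℝ χ x‖ₑ ^ q) :=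
    ((hwm.enorm.pow_const q).mul ((measurable_fderiv ℝ χ).enorm.pow_const q)).const_mul _
  have hf0S : ∀ᵐ x ∂volume.restrict S, ∀ z, 0 ≤ f x z + G x := ae_mono hle hf0
  have key := h.setLIntegral_le hQ hφ hφi.integrableOn hdφi.integrableOn (hS ▸ hSc) (hS ▸ hSΩ)
    (hGi.mono_set (hS ▸ hSΩ)) (hS ▸ ae_mono hle hG0)
    (hS ▸ aemeasurable_caratheodory (fun z => (hfm z).mono_measure hle) (ae_mono hle hfc)
      (hdu.add hdφm).stronglyMeasurable)
    (hS ▸ hf0S.mono fun x hx => hx _) (hS ▸ hf0S.mono fun x hx => hx _)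
    (E := fun x => (A τ \ A t).indicator H x + Z.indicator H x + N.indicator H x +
      (A τ).indicator (fun x => 2 * ENNReal.ofReal (G x)) x +
      ENNReal.ofReal (L * q ^ q) * (‖w x‖ₑ ^ q * ‖fderiv ℝ χ x‖ₑ ^ q)) (by
    rw [← hS]
    filter_upwards [ae_mono hle hfx, ae_mono hle hf0, ae_mono hle hup, ae_mono hle hG0,
      ae_restrict_of_ae hTg, ae_restrict_mem hSm] with x hx1 hx2 hx3 hx4 hx5 hxS
    by_cases hx0 : w x = 0
    · have : dφ x = 0 := by rw [hdφe]; simp only [hx0, hdw0 x hx0, smul_zero, zero_smul, add_zero]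
      rw [this, add_zero, hHx, indicator_of_mem (show x ∈ N by rw [hN]; exact ⟨hxS, hx0⟩)]
      refine le_add_right (le_add_right le_add_self)
    · have hxA : x ∈ A τ := by rw [hA]; exact ⟨hSτ hxS, (hw0 x).1 hx0⟩
      have hdx : du x + dφ x = du x - (χ x ^ q • du x +
          w x • ((q * χ x ^ (q - 1)) • gradient χ x)) := by
        rw [hdφe]
        simp only [hx5, hdw1 x hx0]
        rw [show T x = -(χ x ^ q) by rw [hT], neg_smul, smul_neg]
        abel
      have h1 := hx1.competitor_le hL hx4 hq hx3 (hχ1 x).1 (hχ1 x).2 (w x) (du x) (gradient χ x)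
      rw [← hdx] at h1
      have h2 : ENNReal.ofReal (2 * G x + L * q ^ q * (|w x| ^ q * ‖gradient χ x‖ ^ q)) =
          2 * ENNReal.ofReal (G x) +
            ENNReal.ofReal (L * q ^ q) * (‖w x‖ₑ ^ q * ‖fderiv ℝ χ x‖ₑ ^ q) := by
        rw [ENNReal.ofReal_add (by positivity) (by positivity), ENNReal.ofReal_mul (by norm_num),
          ENNReal.ofReal_mul (p := L * q ^ q) (by positivity), ENNReal.ofReal_mul (p := |w x| ^ q)
            (by positivity),
          ← ENNReal.ofReal_rpow_of_nonneg (abs_nonneg _) hq0.le,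
          ← ENNReal.ofReal_rpow_of_nonneg (norm_nonneg _) hq0.le, ofReal_norm, enorm_gradient,
          ← Real.norm_eq_abs, ofReal_norm, ENNReal.ofReal_ofNat]
      refine (ENNReal.ofReal_le_ofReal h1).trans ?_
      have h3 : 0 ≤ 1 - χ x ^ q := sub_nonneg.2 (Real.rpow_le_one (hχ1 x).1 (hχ1 x).2 hq0.le)
      rw [ENNReal.ofReal_add (mul_nonneg h3 (hx2 _)) (by positivity), h2, ← add_assoc,
        indicator_of_mem hxA]
      refine add_le_add_left (add_le_add_left ?_ _) _
      refine le_add_right ?_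
      by_cases hxt : x ∈ A t
      · have hηx : η x = 1 := by
          rw [hA] at hxt
          exact hηt x (by simpa using (mem_ball_zero_iff.1 hxt.1).le)
        by_cases hζx : ζ x < 1
        · rw [indicator_of_mem (show x ∈ Z by rw [hZ]; exact ⟨⟨hζx, hx0⟩, hS1 hxS⟩)]
          refine le_add_left ?_
          rw [← hHx]
          refine ENNReal.ofReal_le_ofReal (mul_le_of_le_one_left (hx2 _) ?_)
          linarith [Real.rpow_nonneg (hχ1 x).1 q]
        · have hχx : χ x = 1 := by
            rw [hχ]; simp only [hηx, one_mul]; exact le_antisymm (hζ1 x).2 (not_lt.1 hζx)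
          rw [hχx, Real.one_rpow, sub_self, zero_mul, ENNReal.ofReal_zero]
          exact zero_le
      · rw [indicator_of_mem (show x ∈ A τ \ A t from ⟨hxA, hxt⟩)]
        refine le_add_right ?_
        rw [← hHx]
        refine ENNReal.ofReal_le_ofReal (mul_le_of_le_one_left (hx2 _) ?_)
        linarith [Real.rpow_nonneg (hχ1 x).1 q])
  rw [← hS] at key
  simp only [hHx] at key
  have hsub : A t ⊆ S ∪ Z := by
    intro x hx
    rw [hA] at hx
    have hxt : ‖x‖ < t := mem_ball_zero_iff.1 hx.1
    have hx0 := (hw0 x).2 hx.2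
    by_cases hζx : ζ x < 1
    · right
      rw [hZ]
      exact ⟨⟨hζx, hx0⟩, mem_ball_zero_iff.2 (by linarith)⟩
    · left
      rw [hS]
      refine subset_tsupport _ ?_
      have hχx : χ x = 1 := by
        rw [hχ]; simp only [hηt x hxt.le, one_mul]; exact le_antisymm (hζ1 x).2 (not_lt.1 hζx)
      rw [Function.mem_support, hφe, hT]
      simp only [hχx, Real.one_rpow]
      simpa using hx0
  calc ∫⁻ x in A t, H x ≤ ∫⁻ x in S ∪ Z, H x := lintegral_mono_set hsub
    _ ≤ (∫⁻ x in S, H x) + ∫⁻ x in Z, H x := lintegral_union_le _ _ _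
    _ ≤ _ := by
      refine add_le_add (key.trans (mul_le_mul_right ?_ _)) hZe
      rw [lintegral_add_right _ hcm, lintegral_add_right' _ (hGm.indicator (hAm τ)),
        lintegral_add_right' _ (hHm.indicator hNm), lintegral_add_right' _ (hHm.indicator hZm),
        lintegral_const_mul' _ _ ENNReal.ofReal_ne_top, hχ]
      have hind : ∀ (B : Set (EuclideanSpace ℝ (Fin n))) (K : EuclideanSpace ℝ (Fin n) → ℝ≥0∞),
          MeasurableSet B → ∫⁻ x in S, B.indicator K x ≤ ∫⁻ x in B, K x := fun B K hB => by
        rw [← lintegral_indicator hB]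
        exact setLIntegral_le_lintegral _ _
      refine add_le_add (add_le_add (add_le_add (add_le_add ?_ ?_) ?_) ?_) ?_
      · exact hind _ _ ((hAm τ).diff (hAm t))
      · exact (hind _ _ hZm).trans hZe
      · exact (hind _ _ hNm).trans hNe
      · refine (hind _ _ (hAm τ)).trans ?_
        rw [lintegral_const_mul' _ _ (by norm_num)]
      · exact mul_le_mul_right (setLIntegral_le_lintegral _ _) _

/-- Energy estimate of hole-filling type for a quasi-minimizer and a cutoff function `η`. -/
lemma IsQMinimizer.energy_hole (hn : 2 ≤ n) {s : ℝ} (hs : 1 ≤ s)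
    (hsn : s < (n : ℝ) - 1 ∨ n = 2 ∧ s = 1) (hsq : 1 / s - 1 / ((n : ℝ) - 1) ≤ 1 / q)
    (h : IsQMinimizer n Ω f Q u du) (hQ : 1 ≤ Q) (hu : Measurable u) (hdu : Measurable du)
    (hGi : IntegrableOn G Ω) (hG0 : ∀ᵐ x ∂volume.restrict Ω, 0 ≤ G x)
    (hfm : ∀ z, AEMeasurable (fun x => f x z) (volume.restrict Ω))
    (hfc : ∀ᵐ x ∂volume.restrict Ω, Continuous fun z => f x z)
    (hfx : ∀ᵐ x ∂volume.restrict Ω, ConvexOn ℝ univ fun z => f x z)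
    (hf0 : ∀ᵐ x ∂volume.restrict Ω, ∀ z, 0 ≤ f x z + G x)
    (hL : 0 ≤ L) (hq : 1 < q) (hup : ∀ᵐ x ∂volume.restrict Ω, ∀ z, f x z ≤ L * ‖z‖ ^ q + G x)
    {k R : ℝ} (hR : 1 < R) (hRΩ : ball 0 R ⊆ Ω)
    {w : EuclideanSpace ℝ (Fin n) → ℝ} {dw : EuclideanSpace ℝ (Fin n) → EuclideanSpace ℝ (Fin n)}
    (hwe : w = fun x => max (u x - k) 0) (hdwe : dw = {x | k < u x}.indicator du)
    (hw : IsWeakGradOn n (ball 0 R) w dw) (hwi : IntegrableOn w (ball 0 R))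
    (hdwi : IntegrableOn dw (ball 0 R)) (hfin : ∫⁻ x in ball 0 R, ‖dw x‖ₑ ^ s ≠ ∞)
    (hHfin : ∫⁻ x in ball 0 1, ENNReal.ofReal (f x (du x) + G x) ≠ ∞)
    {t τ : ℝ} (htτ : t < τ) (hτ : τ ≤ 1)
    {η : EuclideanSpace ℝ (Fin n) → ℝ} {D : ℝ≥0} (hη : LipschitzWith D η)
    (hη1 : ∀ x, 0 ≤ η x ∧ η x ≤ 1) (hηt : ∀ x, ‖x‖ ≤ t → η x = 1)
    (hητ : ∃ σ' < τ, ∀ x, σ' ≤ ‖x‖ → η x = 0) :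
    (∫⁻ x in ball 0 t ∩ {x | k < u x}, ENNReal.ofReal (f x (du x) + G x)) +
      ENNReal.ofReal Q * (∫⁻ x in ball 0 t ∩ {x | k < u x}, ENNReal.ofReal (f x (du x) + G x)) ≤
      ENNReal.ofReal Q * (∫⁻ x in ball 0 τ ∩ {x | k < u x}, ENNReal.ofReal (f x (du x) + G x)) +
        ENNReal.ofReal Q * (2 * (∫⁻ x in ball 0 τ ∩ {x | k < u x}, ENNReal.ofReal (G x)) +
        ENNReal.ofReal (L * q ^ q) * (2 ^ (q - 1) *
          ∫⁻ x, ‖w x‖ₑ ^ q * ‖fderiv ℝ η x‖ₑ ^ q)) := by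
  have hkm : MeasurableSet {x | k < u x} := measurableSet_lt measurable_const hu
  have hwm : Measurable w := by rw [hwe]; exact (hu.sub_const k).max measurable_const
  have hdwm : Measurable dw := by rw [hdwe]; exact hdu.indicator hkm
  have hdw0 : ∀ x, w x = 0 → dw x = 0 := fun x hx => by
    rw [hdwe]
    refine indicator_of_notMem (show x ∉ {x | k < u x} from fun h' => ?_) _
    rw [hwe] at hx
    have : u x - k ≤ 0 := by simpa using hx
    have : k < u x := h'
    linarith
  obtain ⟨I, hI⟩ : ∃ I, I = ∫⁻ x in (ball 0 τ ∩ {x | k < u x}) \ (ball 0 t ∩ {x | k < u x}),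
    ENNReal.ofReal (f x (du x) + G x) := ⟨_, rfl⟩
  obtain ⟨J, hJ⟩ : ∃ J, J = 2 * ∫⁻ x in ball 0 τ ∩ {x | k < u x}, ENNReal.ofReal (G x) := ⟨_, rfl⟩
  obtain ⟨P, hP⟩ : ∃ P, P = ∫⁻ x, ‖w x‖ₑ ^ q * ‖fderiv ℝ η x‖ₑ ^ q := ⟨_, rfl⟩
  have h2q : (2 : ℝ≥0∞) ^ (q - 1) ≠ ∞ := ENNReal.rpow_ne_top_of_nonneg (by linarith) (by norm_num)
  have step : ∀ ε : ℝ≥0∞, 0 < ε →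
      ∫⁻ x in ball 0 t ∩ {x | k < u x}, ENNReal.ofReal (f x (du x) + G x) ≤
        ENNReal.ofReal Q * (I + ε + ε + J +
          ENNReal.ofReal (L * q ^ q) * (2 ^ (q - 1) * (P + ε))) + ε := by
    intro ε hε
    obtain ⟨δ₀, hδ₀, hδ₀'⟩ := exists_pos_setLIntegral_lt_of_measure_lt hHfin hε.ne'
    obtain ⟨δ, hδ, hδ'⟩ := exists_between (lt_min hδ₀ hε)
    have he : ∀ s ⊆ ball (0 : EuclideanSpace ℝ (Fin n)) 1, volume s ≤ δ →
        ∫⁻ x in s, ENNReal.ofReal (f x (du x) + G x) ≤ ε := by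
      intro s hs1 hsδ
      have := hδ₀' s ((Measure.restrict_apply_le _ _).trans_lt
        (hsδ.trans_lt (hδ'.trans_le (min_le_left _ _))))
      rw [Measure.restrict_restrict_of_subset hs1] at this
      exact this.le
    obtain ⟨ζ, ⟨D', hζ⟩, hζ1, hζc, hζδ, hU⟩ := exists_small_cutoff hn hs (by linarith) hsn hsq hR
      hw hwi hdwi hwm hdwm hfin hdw0 hδ.ne'
    have h1 := h.energy_step hQ hu hdu hGi hG0 hfm hfc hfx hf0 hL hq hup hR hRΩ hwe hdwe hw hwi
      hdwi htτ hτ hη hη1 hηt hητ hζ hζ1 hζδ hU he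
    rw [← hI, ← hJ] at h1
    refine h1.trans (add_le_add_left (mul_le_mul_right (add_le_add_right
      (mul_le_mul_right ?_ _) _) _) _)
    refine (lintegral_mul_fderiv_mul_le hwm hη hη1 hζ hζ1 hq.le).trans ?_
    rw [← hP]
    exact mul_le_mul_right (add_le_add_right (hζc.trans (hδ'.le.trans (min_le_right _ _))) _) _
  have hlim : ∫⁻ x in ball 0 t ∩ {x | k < u x}, ENNReal.ofReal (f x (du x) + G x) ≤
      ENNReal.ofReal Q * (I + J + ENNReal.ofReal (L * q ^ q) * (2 ^ (q - 1) * P)) := by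
    have hcont : Continuous fun ε : ℝ≥0∞ => ENNReal.ofReal Q * (I + ε + ε + J +
        ENNReal.ofReal (L * q ^ q) * (2 ^ (q - 1) * (P + ε))) + ε :=
      ((ENNReal.continuous_const_mul ENNReal.ofReal_ne_top).comp
        ((((continuous_const.add continuous_id).add continuous_id).add continuous_const).add
          ((ENNReal.continuous_const_mul ENNReal.ofReal_ne_top).comp
            ((ENNReal.continuous_const_mul h2q).comp
              (continuous_const.add continuous_id))))).add continuous_id
    have ht := (hcont.tendsto 0).mono_left (nhdsWithin_le_nhds (s := Ioi 0))
    simp only [add_zero] at ht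
    exact ge_of_tendsto ht (by filter_upwards [self_mem_nhdsWithin] with ε hε using step ε hε)
  have hsplit : (∫⁻ x in ball 0 t ∩ {x | k < u x}, ENNReal.ofReal (f x (du x) + G x)) + I =
      ∫⁻ x in ball 0 τ ∩ {x | k < u x}, ENNReal.ofReal (f x (du x) + G x) := by
    have h1 := lintegral_inter_add_sdiff (μ := volume)
      (fun x => ENNReal.ofReal (f x (du x) + G x)) (ball 0 τ ∩ {x | k < u x})
      (measurableSet_ball.inter hkm : MeasurableSet (ball 0 t ∩ {x | k < u x}))
    rwa [inter_eq_right.2 (inter_subset_inter_left _ (ball_subset_ball htτ.le)), ← hI] at h1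
  rw [← hsplit, ← hJ, ← hP]
  refine (add_le_add_left hlim _).trans (le_of_eq ?_)
  ring

end energy
/-! ### The Caccioppoli inequality -/

section caccioppoli

variable {n : ℕ} {p q Q : ℝ}

/-- The Caccioppoli inequality in terms of `W^{1,s}` norms, where `s` is the exponent for which
`W^{1,s}` on spheres embeds into `L^q`. -/
lemma IsQMinimizer.exists_energy_le (hn : 2 ≤ n) {s : ℝ} (hs : 1 ≤ s) (hq : 1 < q) (hQ : 1 ≤ Q)
    (hsn : s < (n : ℝ) - 1 ∨ n = 2 ∧ s = 1) (hsq : 1 / s - 1 / ((n : ℝ) - 1) ≤ 1 / q) :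
    ∃ c : ℝ, 0 < c ∧ ∀ (Ω : Set (EuclideanSpace ℝ (Fin n)))
      (f : EuclideanSpace ℝ (Fin n) → EuclideanSpace ℝ (Fin n) → ℝ) (L : ℝ)
      (u G : EuclideanSpace ℝ (Fin n) → ℝ) (du : EuclideanSpace ℝ (Fin n) → EuclideanSpace ℝ (Fin n))
      (k R : ℝ) (w : EuclideanSpace ℝ (Fin n) → ℝ)
      (dw : EuclideanSpace ℝ (Fin n) → EuclideanSpace ℝ (Fin n)),
      IsQMinimizer n Ω f Q u du → Measurable u → Measurable du →
      IntegrableOn G Ω → (∀ᵐ x ∂volume.restrict Ω, 0 ≤ G x) →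
      (∀ z, AEMeasurable (fun x => f x z) (volume.restrict Ω)) →
      (∀ᵐ x ∂volume.restrict Ω, Continuous fun z => f x z) →
      (∀ᵐ x ∂volume.restrict Ω, ConvexOn ℝ univ fun z => f x z) →
      (∀ᵐ x ∂volume.restrict Ω, ∀ z, 0 ≤ f x z + G x) → 0 ≤ L →
      (∀ᵐ x ∂volume.restrict Ω, ∀ z, f x z ≤ L * ‖z‖ ^ q + G x) →
      1 < R → ball 0 R ⊆ Ω → (w = fun x => max (u x - k) 0) → dw = {x | k < u x}.indicator du →
      IsWeakGradOn n (ball 0 R) w dw → IntegrableOn w (ball 0 R) → IntegrableOn dw (ball 0 R) →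
      ∫⁻ x in ball 0 R, ‖dw x‖ₑ ^ s ≠ ∞ → ∫⁻ x in ball 0 1, ‖w x‖ₑ ^ s ≠ ∞ →
      ∫⁻ x in ball 0 1, ENNReal.ofReal (f x (du x) + G x) ≠ ∞ →
      ∀ ρ σ : ℝ, 1 / 2 ≤ ρ → ρ < σ → σ ≤ 1 →
        (∫⁻ x in ball 0 ρ ∩ {x | k < u x}, ENNReal.ofReal (f x (du x) + G x)).toReal ≤
          c * ((∫⁻ x in ball 0 σ ∩ {x | k < u x}, ENNReal.ofReal (G x)).toReal +
            L * (σ - ρ) ^ (-(q - 1 + q / s)) *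
              ((∫⁻ x in ball 0 σ, ‖w x‖ₑ ^ s) + ∫⁻ x in ball 0 σ, ‖dw x‖ₑ ^ s).toReal
                ^ (q / s)) := by
  have hs0 : 0 < s := by linarith
  have hq0 : 0 < q := by linarith
  have hγ : 0 < q - 1 + q / s := by have := div_pos hq0 hs0; linarith
  obtain ⟨C, hC⟩ := exists_cutoff hn hs hq0 hsn hsq
  obtain ⟨c₀, hc₀, hit⟩ := exists_iteration_const (θ := Q / (Q + 1)) (γ := q - 1 + q / s)
    (by positivity) ((div_lt_one (by linarith)).2 (by linarith)) hγ
  obtain ⟨b, hb⟩ : ∃ b : ℝ, b = q ^ q * 2 ^ (q - 1) * C := ⟨_, rfl⟩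
  have hb0 : 0 ≤ b := by rw [hb]; positivity
  refine ⟨c₀ * (2 + b), by positivity, ?_⟩
  intro Ω f L u G du k R w dw h hu hdu hGi hG0 hfm hfc hfx hf0 hL hup hR hRΩ hwe hdwe hw hwi hdwi
    hfin hwfin hHfin ρ σ hρ hρσ hσ
  have hwm : Measurable w := by rw [hwe]; exact (hu.sub_const k).max measurable_const
  have hsub : ∀ {r}, r ≤ (1 : ℝ) → ball (0 : EuclideanSpace ℝ (Fin n)) r ⊆ ball 0 R := fun hr =>
    ball_subset_ball (by linarith)
  obtain ⟨M, hM⟩ : ∃ M : ℝ → ℝ≥0∞,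
    M = fun r => (∫⁻ x in ball 0 r, ‖w x‖ₑ ^ s) + ∫⁻ x in ball 0 r, ‖dw x‖ₑ ^ s := ⟨_, rfl⟩
  have hMx : ∀ r, (∫⁻ x in ball 0 r, ‖w x‖ₑ ^ s) + ∫⁻ x in ball 0 r, ‖dw x‖ₑ ^ s = M r :=
    fun r => by rw [hM]
  have hMfin : ∀ {r}, r ≤ 1 → M r ≠ ∞ := fun {r} hr => by
    rw [hM]
    refine ENNReal.add_ne_top.2 ⟨?_, ?_⟩
    · exact ne_top_of_le_ne_top hwfin (lintegral_mono_set (ball_subset_ball hr))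
    · exact ne_top_of_le_ne_top hfin (lintegral_mono_set (hsub hr))
  have hMmono : ∀ {r r'}, r ≤ r' → M r ≤ M r' := fun hr => by
    rw [hM]
    exact add_le_add (lintegral_mono_set (ball_subset_ball hr))
      (lintegral_mono_set (ball_subset_ball hr))
  obtain ⟨Z, hZ⟩ : ∃ Z : ℝ → ℝ≥0∞, Z = fun r =>
    ∫⁻ x in ball 0 r ∩ {x | k < u x}, ENNReal.ofReal (f x (du x) + G x) := ⟨_, rfl⟩
  have hZx : ∀ r, ∫⁻ x in ball 0 r ∩ {x | k < u x}, ENNReal.ofReal (f x (du x) + G x) = Z r :=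
    fun r => by rw [hZ]
  have hZle : ∀ {r}, r ≤ 1 → Z r ≤ ∫⁻ x in ball 0 1, ENNReal.ofReal (f x (du x) + G x) :=
    fun hr => by
      rw [hZ]
      exact lintegral_mono_set (inter_subset_left.trans (ball_subset_ball hr))
  have hZfin : ∀ {r}, r ≤ 1 → Z r ≠ ∞ := fun hr => ne_top_of_le_ne_top hHfin (hZle hr)
  obtain ⟨J, hJ⟩ : ∃ J, J = ∫⁻ x in ball 0 σ ∩ {x | k < u x}, ENNReal.ofReal (G x) := ⟨_, rfl⟩
  have hJfin : J ≠ ∞ := by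
    have hsΩ : ball 0 σ ∩ {x | k < u x} ⊆ Ω := inter_subset_left.trans ((hsub hσ).trans hRΩ)
    have := (hGi.mono_set hsΩ).lintegral_lt_top
    rw [hJ]
    exact this.ne
  rw [hZx, hMx, ← hJ]
  obtain ⟨K, hK⟩ : ∃ K : ℝ≥0∞,
    K = ENNReal.ofReal (L * q ^ q) * (2 ^ (q - 1) * (C * M σ ^ (q / s))) := ⟨_, rfl⟩
  have hKr : K.toReal = L * b * (M σ).toReal ^ (q / s) := by
    rw [hK, ENNReal.toReal_mul, ENNReal.toReal_ofReal (by positivity), ENNReal.toReal_mul,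
      ENNReal.toReal_mul, ← ENNReal.toReal_rpow, ← ENNReal.toReal_rpow, ENNReal.coe_toReal,
      ENNReal.toReal_ofNat, hb]
    ring
  have hKfin : K ≠ ∞ := by
    rw [hK]
    exact ENNReal.mul_ne_top ENNReal.ofReal_ne_top (ENNReal.mul_ne_top
      (ENNReal.rpow_ne_top_of_nonneg (by linarith) (by norm_num)) (ENNReal.mul_ne_top
      ENNReal.coe_ne_top (ENNReal.rpow_ne_top_of_nonneg (by positivity) (hMfin hσ))))
  have hres := hit (fun r => (Z r).toReal) ρ σ (2 * J.toReal) K.toReal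
    (∫⁻ x in ball 0 1, ENNReal.ofReal (f x (du x) + G x)).toReal hρσ (by positivity)
    ENNReal.toReal_nonneg (fun t _ ht => ENNReal.toReal_mono hHfin (hZle (by linarith))) ?_
  · refine hres.trans ?_
    rw [hKr, mul_assoc c₀]
    refine mul_le_mul_of_nonneg_left ?_ hc₀.le
    have h1 : 0 ≤ L * (σ - ρ) ^ (-(q - 1 + q / s)) * (M σ).toReal ^ (q / s) :=
      mul_nonneg (mul_nonneg hL (Real.rpow_nonneg (by linarith) _)) (by positivity)
    have h2 : (0 : ℝ) ≤ J.toReal := ENNReal.toReal_nonneg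
    nlinarith [mul_nonneg hb0 h2]
  · intro t τ hρt htτ hτσ
    have hτ1 : τ ≤ 1 := by linarith
    have hd : 0 < τ - t := by linarith
    obtain ⟨η, ⟨D, hη⟩, hη1, hηt, hητ, hηc⟩ := hC w dw t τ (by linarith) htτ hτ1
      (hw.mono (hsub hτ1)) (hwi.mono_set (hsub hτ1)) (hdwi.mono_set (hsub hτ1)) hwm
      (by rw [hMx]; exact hMfin hτ1)
    rw [hMx] at hηc
    have h1 := h.energy_hole hn hs hsn hsq hQ hu hdu hGi hG0 hfm hfc hfx hf0 hL hq hup hR hRΩ hwe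
      hdwe hw hwi hdwi hfin hHfin htτ hτ1 hη hη1 hηt hητ
    rw [hZx, hZx] at h1
    have h2 : Z t + ENNReal.ofReal Q * Z t ≤ ENNReal.ofReal Q * Z τ + ENNReal.ofReal Q *
        (2 * J + K * ENNReal.ofReal ((τ - t) ^ (-(q - 1 + q / s)))) := by
      refine h1.trans (add_le_add_right (mul_le_mul_right (add_le_add (mul_le_mul_right ?_ _) ?_)
        _) _)
      · rw [hJ]
        exact lintegral_mono_set (inter_subset_inter_left _ (ball_subset_ball hτσ.le))
      · calc _ ≤ ENNReal.ofReal (L * q ^ q) * (2 ^ (q - 1) * (C *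
              ENNReal.ofReal ((τ - t) ^ (-(q - 1 + q / s))) * M σ ^ (q / s))) := by
              refine mul_le_mul_right (mul_le_mul_right (hηc.trans (mul_le_mul_right ?_ _)) _) _
              exact ENNReal.rpow_le_rpow (hMmono hτσ.le) (by positivity)
          _ = _ := by rw [hK]; ring
    have hQ0 : (0 : ℝ) ≤ Q := by linarith
    have hdγ : (0 : ℝ) ≤ (τ - t) ^ (-(q - 1 + q / s)) := Real.rpow_nonneg hd.le _
    have ht1 := hZfin (show t ≤ 1 by linarith)
    have hτ2 := hZfin hτ1
    have h2J : 2 * J ≠ ∞ := ENNReal.mul_ne_top (by norm_num) hJfin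
    have hKD : K * ENNReal.ofReal ((τ - t) ^ (-(q - 1 + q / s))) ≠ ∞ :=
      ENNReal.mul_ne_top hKfin ENNReal.ofReal_ne_top
    have hQZ : ∀ {y : ℝ≥0∞}, y ≠ ∞ → ENNReal.ofReal Q * y ≠ ∞ := fun hy =>
      ENNReal.mul_ne_top ENNReal.ofReal_ne_top hy
    have h3 := ENNReal.toReal_mono (ENNReal.add_ne_top.2 ⟨hQZ hτ2,
      hQZ (ENNReal.add_ne_top.2 ⟨h2J, hKD⟩)⟩) h2
    rw [ENNReal.toReal_add ht1 (hQZ ht1),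
      ENNReal.toReal_add (hQZ hτ2) (hQZ (ENNReal.add_ne_top.2 ⟨h2J, hKD⟩)),
      ENNReal.toReal_mul, ENNReal.toReal_mul, ENNReal.toReal_mul, ENNReal.toReal_add h2J hKD,
      ENNReal.toReal_mul, ENNReal.toReal_mul, ENNReal.toReal_ofReal hQ0,
      ENNReal.toReal_ofReal hdγ, ENNReal.toReal_ofNat] at h3
    have hX : 0 ≤ 2 * J.toReal + K.toReal * (τ - t) ^ (-(q - 1 + q / s)) := by positivity
    have h4 : (Z t).toReal ≤ Q / (Q + 1) * ((Z τ).toReal +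
        (2 * J.toReal + K.toReal * (τ - t) ^ (-(q - 1 + q / s)))) := by
      rw [div_mul_eq_mul_div, le_div_iff₀ (by linarith)]
      linarith
    refine h4.trans ?_
    rw [mul_add]
    exact add_le_add_right (mul_le_of_le_one_left hX
      ((div_le_one (by linarith)).2 (by linarith))) _

/-- Hölder's inequality for functions vanishing off `E`. -/
lemma setLIntegral_enorm_rpow_le {F : Type*} [NormedAddCommGroup F] [MeasurableSpace F]
    [OpensMeasurableSpace F] {a : EuclideanSpace ℝ (Fin n) → F} (ha : Measurable a)
    {B E : Set (EuclideanSpace ℝ (Fin n))} (hE : MeasurableSet E) (haE : ∀ x, x ∉ E → a x = 0)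
    {s : ℝ} (hs : 0 < s) (hsp : s ≤ p) :
    ∫⁻ x in B, ‖a x‖ₑ ^ s ≤ volume (B ∩ E) ^ (1 - s / p) *
      (∫⁻ x in B, ‖a x‖ₑ ^ p) ^ (s / p) := by
  have h1 : (fun x => ‖a x‖ₑ ^ s) = E.indicator fun x => ‖a x‖ₑ ^ s := by
    refine (indicator_eq_self.2 fun x hx => ?_).symm
    by_contra h
    exact hx (by simp [haE x h, hs])
  rw [h1, setLIntegral_indicator hE, inter_comm]
  refine (lintegral_rpow_le_measure_rpow_mul ha.enorm.aemeasurable hs hsp).trans ?_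
  rw [Measure.restrict_apply_univ]
  exact mul_le_mul_right (ENNReal.rpow_le_rpow (lintegral_mono_set inter_subset_left)
    (div_nonneg hs.le (hs.le.trans hsp))) _

lemma add_rpow_mul_le {v a b r m : ℝ} (hv : 0 ≤ v) (ha : 0 ≤ a) (hb : 0 ≤ b) {x y : ℝ}
    (hx0 : 0 ≤ x) (hy0 : 0 ≤ y) (hr : 0 ≤ r) (hm : 0 ≤ m)
    (hx : x ≤ v ^ (1 - r) * a ^ r) (hy : y ≤ v ^ (1 - r) * b ^ r) :
    (x + y) ^ m ≤ 2 ^ m * v ^ ((1 - r) * m) * (a + b) ^ (r * m) := by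
  have h1 : x + y ≤ 2 * (v ^ (1 - r) * (a + b) ^ r) := by
    have h2 : a ^ r ≤ (a + b) ^ r := Real.rpow_le_rpow ha (by linarith) hr
    have h3 : b ^ r ≤ (a + b) ^ r := Real.rpow_le_rpow hb (by linarith) hr
    have h4 : 0 ≤ v ^ (1 - r) := Real.rpow_nonneg hv _
    nlinarith [mul_le_mul_of_nonneg_left h2 h4, mul_le_mul_of_nonneg_left h3 h4]
  refine (Real.rpow_le_rpow (by positivity) h1 hm).trans (le_of_eq ?_)
  rw [Real.mul_rpow (by norm_num) (by positivity), Real.mul_rpow (by positivity) (by positivity),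
    ← Real.rpow_mul hv, ← Real.rpow_mul (by positivity), mul_assoc]

end caccioppoli

section main

variable {n : ℕ} {p q Q : ℝ}

lemma exists_one_lt_closedBall_subset {Ω : Set (EuclideanSpace ℝ (Fin n))} (hΩ : IsOpen Ω)
    (h : closedBall (0 : EuclideanSpace ℝ (Fin n)) 1 ⊆ Ω) :
    ∃ R : ℝ, 1 < R ∧ closedBall (0 : EuclideanSpace ℝ (Fin n)) R ⊆ Ω := by
  obtain ⟨δ, hδ, hs⟩ := (isCompact_closedBall _ _).exists_cthickening_subset_open hΩ h
  rw [cthickening_closedBall hδ.le zero_le_one] at hs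
  exact ⟨δ + 1, by linarith, hs⟩

/-- The Caccioppoli inequality for measurable representatives, with `s` the exponent for which
`W^{1,s}` on spheres embeds into `L^q`. -/
lemma IsQMinimizer.exists_caccioppoli_of_measurable (hn : 2 ≤ n) {s : ℝ} (hs : 1 ≤ s)
    (hsp : s ≤ p) (hq : 1 < q) (hQ : 1 ≤ Q) (hsn : s < (n : ℝ) - 1 ∨ n = 2 ∧ s = 1)
    (hsq : 1 / s - 1 / ((n : ℝ) - 1) ≤ 1 / q) :
    ∃ c : ℝ, 1 ≤ c ∧ ∀ (Ω : Set (EuclideanSpace ℝ (Fin n)))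
      (f : EuclideanSpace ℝ (Fin n) → EuclideanSpace ℝ (Fin n) → ℝ) (L : ℝ)
      (u G : EuclideanSpace ℝ (Fin n) → ℝ) (du : EuclideanSpace ℝ (Fin n) → EuclideanSpace ℝ (Fin n)),
      IsOpen Ω → closedBall 0 1 ⊆ Ω →
      IsQMinimizer n Ω f Q u du → Measurable u → Measurable du →
      IntegrableOn G Ω → (∀ᵐ x ∂volume.restrict Ω, 0 ≤ G x) →
      (∀ z, AEMeasurable (fun x => f x z) (volume.restrict Ω)) →
      (∀ᵐ x ∂volume.restrict Ω, Continuous fun z => f x z) →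
      (∀ᵐ x ∂volume.restrict Ω, ConvexOn ℝ univ fun z => f x z) → 0 ≤ L →
      (∀ᵐ x ∂volume.restrict Ω, ∀ z, ‖z‖ ^ p - G x ≤ f x z ∧ f x z ≤ L * ‖z‖ ^ q + G x) →
      ∀ k ρ σ : ℝ, 0 ≤ k → 1 / 2 ≤ ρ → ρ < σ → σ ≤ 1 →
        (∫ x in ball 0 ρ ∩ {x | k < u x}, ‖du x‖ ^ p) ≤
          c * ((∫ x in ball 0 σ ∩ {x | k < u x}, G x) +
            L * (volume (ball 0 σ ∩ {x | k < u x})).toReal ^ (q * (1 / s - 1 / p)) *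
              (σ - ρ) ^ (-(q - 1 + q / s)) *
              ((∫ x in ball 0 σ, max (u x - k) 0 ^ p) +
                ∫ x in ball 0 σ ∩ {x | k < u x}, ‖du x‖ ^ p) ^ (q / p)) := by
  have hs0 : 0 < s := by linarith
  have hp0 : 0 < p := by linarith
  have hq0 : 0 < q := by linarith
  obtain ⟨c, hc, H⟩ := IsQMinimizer.exists_energy_le (Q := Q) hn hs hq hQ hsn hsq
  have h2 : (1 : ℝ) ≤ 2 ^ (q / s) := Real.one_le_rpow (by norm_num) (by positivity)
  refine ⟨max 1 (c * 2 ^ (q / s)), le_max_left _ _, ?_⟩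
  intro Ω f L u G du hΩ hB h hu hdu hGi hG0 hfm hfc hfx hL hfb k ρ σ hk hρ hρσ hσ
  obtain ⟨R, hR, hRΩ⟩ := exists_one_lt_closedBall_subset hΩ hB
  have hbR : ball 0 R ⊆ closedBall (0 : EuclideanSpace ℝ (Fin n)) R := ball_subset_closedBall
  have hbΩ : ball 0 R ⊆ Ω := hbR.trans hRΩ
  have hball : ∀ {r : ℝ}, r ≤ 1 → ball (0 : EuclideanSpace ℝ (Fin n)) r ⊆ ball 0 R := fun hr =>
    ball_subset_ball (hr.trans hR.le)
  have hE : MeasurableSet {x | k < u x} := measurableSet_lt measurable_const hu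
  obtain ⟨w, hw⟩ : ∃ w : EuclideanSpace ℝ (Fin n) → ℝ, w = fun x => max (u x - k) 0 := ⟨_, rfl⟩
  obtain ⟨dw, hdw⟩ : ∃ dw : EuclideanSpace ℝ (Fin n) → EuclideanSpace ℝ (Fin n),
    dw = {x | k < u x}.indicator du := ⟨_, rfl⟩
  have hwm : Measurable w := by rw [hw]; exact (hu.sub_const k).max measurable_const
  have hdwm : Measurable dw := by rw [hdw]; exact hdu.indicator hE
  have hui : IntegrableOn u (ball 0 R) :=
    (h.2.1.integrableOn_compact_subset hRΩ (isCompact_closedBall _ _)).mono_set hbR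
  have hdui : IntegrableOn du (ball 0 R) :=
    (h.2.2.1.integrableOn_compact_subset hRΩ (isCompact_closedBall _ _)).mono_set hbR
  have hfi : IntegrableOn (fun x => f x (du x) + G x) (ball 0 R) :=
    ((h.integrableOn_closedBall (by linarith) hRΩ).mono_set hbR).add (hGi.mono_set hbΩ)
  have hfR : ∀ᵐ x ∂volume.restrict (ball 0 R), ∀ z, ‖z‖ ^ p ≤ f x z + G x :=
    (ae_restrict_of_ae_restrict_of_subset hbΩ hfb).mono fun x hx z => by linarith [(hx z).1]
  have hf0 : ∀ᵐ x ∂volume.restrict Ω, ∀ z, 0 ≤ f x z + G x := hfb.mono fun x hx z => by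
    have := Real.rpow_nonneg (norm_nonneg z) p
    linarith [(hx z).1]
  have hEfin : ∫⁻ x in ball 0 R, ENNReal.ofReal (f x (du x) + G x) ≠ ∞ :=
    hfi.lintegral_lt_top.ne
  have hdufin : ∫⁻ x in ball 0 R, ‖du x‖ₑ ^ p ≠ ∞ := by
    refine ne_top_of_le_ne_top hEfin (lintegral_mono_ae (hfR.mono fun x hx => ?_))
    rw [← ofReal_norm, ENNReal.ofReal_rpow_of_nonneg (norm_nonneg _) hp0.le]
    exact ENNReal.ofReal_le_ofReal (hx _)
  have hdwle : ∀ x, ‖dw x‖ₑ ≤ ‖du x‖ₑ := fun x => by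
    rw [hdw]; exact enorm_indicator_le_enorm_self _ _
  have hwi : IntegrableOn w (ball 0 R) := by
    have hc : IntegrableOn (fun _ => k) (ball (0 : EuclideanSpace ℝ (Fin n)) R) :=
      integrableOn_const measure_ball_lt_top.ne
    rw [hw]
    exact (hui.sub hc).pos_part
  have hdwi : IntegrableOn dw (ball 0 R) := by rw [hdw]; exact hdui.indicator hE
  have hweak : IsWeakGradOn n (ball 0 R) w dw := by
    rw [hw, hdw]
    exact (h.1.mono hbΩ).posPart isOpen_ball hui hdui hu hk
  have hdwp : ∀ {r : ℝ}, r ≤ R → ∫⁻ x in ball 0 r, ‖dw x‖ₑ ^ p ≠ ∞ := fun hr =>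
    ne_top_of_le_ne_top hdufin ((lintegral_mono_set (ball_subset_ball hr)).trans
      (lintegral_mono fun x => ENNReal.rpow_le_rpow (hdwle x) hp0.le))
  have hwp : ∀ {r : ℝ}, r ≤ 1 → ∫⁻ x in ball 0 r, ‖w x‖ₑ ^ p ≠ ∞ := fun hr =>
    ne_top_of_le_ne_top (hweak.lintegral_enorm_rpow_lt_top isOpen_ball
      (closedBall_subset_ball hR) hwi hdwi hwm (hs.trans hsp) (hdwp le_rfl).lt_top).ne
      (lintegral_mono_set ((ball_subset_ball hr).trans ball_subset_closedBall))
  have hsp1 : s / p ≤ 1 := (div_le_one hp0).2 hsp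
  have hvol : ∀ r : ℝ, ∀ A : Set (EuclideanSpace ℝ (Fin n)),
      volume (ball (0 : EuclideanSpace ℝ (Fin n)) r ∩ A) ≠ ∞ := fun r A =>
    ne_top_of_le_ne_top measure_ball_lt_top.ne (measure_mono inter_subset_left)
  have hw0 : ∀ x, x ∉ {x | k < u x} → w x = 0 := fun x hx => by
    rw [hw]; exact max_eq_right (by linarith [not_lt.1 (show ¬ k < u x from hx)])
  have hdw0 : ∀ x, x ∉ {x | k < u x} → dw x = 0 := fun x hx => by
    rw [hdw]; exact indicator_of_notMem hx _
  have hhold : ∀ {y : ℝ≥0∞} (r : ℝ), y ≠ ∞ →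
      volume (ball (0 : EuclideanSpace ℝ (Fin n)) r ∩ {x | k < u x}) ^ (1 - s / p) *
        y ^ (s / p) ≠ ∞ := fun r hy =>
    ENNReal.mul_ne_top (ENNReal.rpow_ne_top_of_nonneg (by linarith) (hvol r _))
      (ENNReal.rpow_ne_top_of_nonneg (by positivity) hy)
  have hws := fun r : ℝ =>
    setLIntegral_enorm_rpow_le (B := ball 0 r) hwm hE hw0 hs0 hsp
  have hdws := fun r : ℝ =>
    setLIntegral_enorm_rpow_le (B := ball 0 r) hdwm hE hdw0 hs0 hsp
  have hres := H Ω f L u G du k R w dw h hu hdu hGi hG0 hfm hfc hfx hf0 hL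
    (hfb.mono fun x hx z => (hx z).2) hR hbΩ hw hdw hweak hwi hdwi
    (ne_top_of_le_ne_top (hhold R (hdwp le_rfl)) (hdws R))
    (ne_top_of_le_ne_top (hhold 1 (hwp le_rfl)) (hws 1))
    (ne_top_of_le_ne_top hEfin (lintegral_mono_set (hball le_rfl))) ρ σ hρ hρσ hσ
  have hsubR : ∀ {r : ℝ}, r ≤ 1 → ball 0 r ∩ {x | k < u x} ⊆ ball 0 R := fun hr =>
    inter_subset_left.trans (hball hr)
  have hdue : ∀ r : ℝ, ∫ x in ball 0 r ∩ {x | k < u x}, ‖du x‖ ^ p =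
      (∫⁻ x in ball 0 r ∩ {x | k < u x}, ENNReal.ofReal (‖du x‖ ^ p)).toReal := fun r =>
    integral_eq_lintegral_of_nonneg_ae (.of_forall fun x => by positivity)
      (hdu.norm.pow_const p).aestronglyMeasurable
  have hlhs : (∫ x in ball 0 ρ ∩ {x | k < u x}, ‖du x‖ ^ p) ≤
      (∫⁻ x in ball 0 ρ ∩ {x | k < u x}, ENNReal.ofReal (f x (du x) + G x)).toReal := by
    rw [hdue]
    refine ENNReal.toReal_mono (ne_top_of_le_ne_top hEfin (lintegral_mono_set
      (hsubR (hρσ.le.trans hσ)))) (lintegral_mono_ae ?_)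
    exact (ae_restrict_of_ae_restrict_of_subset (hsubR (hρσ.le.trans hσ)) hfR).mono fun x hx =>
      ENNReal.ofReal_le_ofReal (hx _)
  have hGe : ∫ x in ball 0 σ ∩ {x | k < u x}, G x =
      (∫⁻ x in ball 0 σ ∩ {x | k < u x}, ENNReal.ofReal (G x)).toReal :=
    integral_eq_lintegral_of_nonneg_ae
      (ae_mono (Measure.restrict_mono ((hsubR hσ).trans hbΩ) le_rfl) hG0)
      (hGi.mono_set ((hsubR hσ).trans hbΩ)).aestronglyMeasurable
  have hae : ∫ x in ball 0 σ, max (u x - k) 0 ^ p = (∫⁻ x in ball 0 σ, ‖w x‖ₑ ^ p).toReal := by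
    rw [integral_eq_lintegral_of_nonneg_ae (.of_forall fun x => by positivity)
      (((hu.sub_const k).max measurable_const).pow_const p).aestronglyMeasurable]
    congr 1
    refine lintegral_congr fun x => ?_
    rw [hw, Real.enorm_eq_ofReal (le_max_right _ _),
      ENNReal.ofReal_rpow_of_nonneg (le_max_right _ _) hp0.le]
  have hbe : ∫ x in ball 0 σ ∩ {x | k < u x}, ‖du x‖ ^ p =
      (∫⁻ x in ball 0 σ, ‖dw x‖ₑ ^ p).toReal := by
    have h1 : (fun x => ‖dw x‖ₑ ^ p) =
        {x | k < u x}.indicator fun x => ENNReal.ofReal (‖du x‖ ^ p) := by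
      ext x
      by_cases hx : x ∈ {x | k < u x}
      · rw [hdw, indicator_of_mem hx, indicator_of_mem hx, ← ofReal_norm,
          ENNReal.ofReal_rpow_of_nonneg (norm_nonneg _) hp0.le]
      · rw [hdw0 x hx, indicator_of_notMem hx, enorm_zero, ENNReal.zero_rpow_of_pos hp0]
    rw [hdue, h1, setLIntegral_indicator hE, inter_comm]
  have htr : ∀ {x y : ℝ≥0∞}, y ≠ ∞ →
      x ≤ volume (ball (0 : EuclideanSpace ℝ (Fin n)) σ ∩ {x | k < u x}) ^ (1 - s / p) *
        y ^ (s / p) →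
      x.toReal ≤ (volume (ball (0 : EuclideanSpace ℝ (Fin n)) σ ∩ {x | k < u x})).toReal ^
        (1 - s / p) * y.toReal ^ (s / p) := fun hy hx => by
    have := ENNReal.toReal_mono (hhold σ hy) hx
    rwa [ENNReal.toReal_mul, ← ENNReal.toReal_rpow, ← ENNReal.toReal_rpow] at this
  have hwσ := hwp hσ
  have hdwσ := hdwp (hσ.trans hR.le)
  have hM := add_rpow_mul_le (m := q / s) ENNReal.toReal_nonneg ENNReal.toReal_nonneg
    ENNReal.toReal_nonneg ENNReal.toReal_nonneg ENNReal.toReal_nonneg (by positivity)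
    (by positivity) (htr hwσ (hws σ)) (htr hdwσ (hdws σ))
  rw [← ENNReal.toReal_add (ne_top_of_le_ne_top (hhold σ hwσ) (hws σ))
    (ne_top_of_le_ne_top (hhold σ hdwσ) (hdws σ)), ← hae, ← hbe,
    show (1 - s / p) * (q / s) = q * (1 / s - 1 / p) by field_simp,
    show s / p * (q / s) = q / p by field_simp] at hM
  rw [← hGe] at hres
  have hG1 : 0 ≤ ∫ x in ball 0 σ ∩ {x | k < u x}, G x := hGe ▸ ENNReal.toReal_nonneg
  have hD : 0 ≤ L * (σ - ρ) ^ (-(q - 1 + q / s)) :=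
    mul_nonneg hL (Real.rpow_nonneg (by linarith) _)
  refine hlhs.trans (hres.trans ((mul_le_mul_of_nonneg_left (add_le_add
    (le_mul_of_one_le_left hG1 h2) (mul_le_mul_of_nonneg_left hM hD)) hc.le).trans ?_))
  refine le_trans (le_of_eq ?_) (mul_le_mul_of_nonneg_right (le_max_right 1 (c * 2 ^ (q / s))) ?_)
  · ring
  · have h3 : 0 ≤ (∫ x in ball 0 σ, max (u x - k) 0 ^ p) +
        ∫ x in ball 0 σ ∩ {x | k < u x}, ‖du x‖ ^ p := by
      rw [hae, hbe]
      positivity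
    have h4 := Real.rpow_nonneg h3 (q / p)
    have h5 : 0 ≤ (σ - ρ) ^ (-(q - 1 + q / s)) := Real.rpow_nonneg (by linarith) _
    positivity

end main

/-- **Caccioppoli-type inequality (Step 1 of the proof of Theorem 3.2).**
For a `Q`-minimizer `u` (with weak gradient `du`) of `F[u,A] = ∫_A f(x,∇u)` under
`(p,q)`-growth with inhomogeneity `g`, `B₁ ⋐ Ω`, there is `c = c(n,p,q,Q) ≥ 1` such that
for all `k ≥ 0` and `1/2 ≤ ρ < σ ≤ 1`:
`‖∇(u−k)₊‖_{L^p(B_ρ)}^p ≤ c (ω(|A_{k,σ}|) + L |A_{k,σ}|^{qε} (σ−ρ)^{−γ} ‖(u−k)₊‖_{W^{1,p}(B_σ)}^q)`,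
where `A_{k,σ} = B_σ ∩ {u > k}`, `γ = q − 1 + q min{1/q + 1/(n−1), 1}` and
`ε = min{1/q + 1/(n−1), 1} − 1/p`. -/
theorem caccioppoli_inequality
    (n : ℕ) (hn : 2 ≤ n)
    (p q Q : ℝ) (hp : 1 ≤ p) (hpq : p < q) (hQ : 1 ≤ Q)
    (hε : 0 ≤ min (1 / q + 1 / ((n : ℝ) - 1)) 1 - 1 / p) :
    ∃ c : ℝ, 1 ≤ c ∧
      ∀ (Ω : Set (EuclideanSpace ℝ (Fin n))),
        IsOpen Ω → IsConnected Ω → Bornology.IsBounded Ω →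
        closedBall (0 : EuclideanSpace ℝ (Fin n)) 1 ⊆ Ω →
      ∀ L μ : ℝ, 1 ≤ L → 0 ≤ μ →
      ∀ g : EuclideanSpace ℝ (Fin n) → ℝ,
        (∀ᵐ x ∂volume.restrict Ω, 0 ≤ g x) →
        AEMeasurable g (volume.restrict Ω) →
        IntegrableOn (fun x => g x ^ (p / (p - 1))) Ω →
      ∀ f : EuclideanSpace ℝ (Fin n) → EuclideanSpace ℝ (Fin n) → ℝ,
        (∀ z : EuclideanSpace ℝ (Fin n),
          AEMeasurable (fun x => f x z) (volume.restrict Ω)) →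
        (∀ᵐ x ∂volume.restrict Ω, Continuous fun z => f x z) →
        (∀ᵐ x ∂volume.restrict Ω, ConvexOn ℝ univ fun z => f x z) →
        (∀ᵐ x ∂volume.restrict Ω, ∀ z : EuclideanSpace ℝ (Fin n),
          ‖z‖ ^ p - g x ^ (p / (p - 1)) ≤ f x z ∧
            f x z ≤ L * ‖z‖ ^ q + g x ^ (p / (p - 1))) →
        (∀ᵐ x ∂volume.restrict Ω, ∀ z : EuclideanSpace ℝ (Fin n),
          f x (2 • z) ≤ μ + L * f x z) →
      ∀ (u : EuclideanSpace ℝ (Fin n) → ℝ)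
        (du : EuclideanSpace ℝ (Fin n) → EuclideanSpace ℝ (Fin n)),
        IsQMinimizer n Ω f Q u du →
      ∀ k ρ σ : ℝ, 0 ≤ k → 1 / 2 ≤ ρ → ρ < σ → σ ≤ 1 →
        (∫ x in ball (0 : EuclideanSpace ℝ (Fin n)) ρ ∩ {x | k < u x}, ‖du x‖ ^ p)
          ≤ c * (omegaFn n p g
              (volume (ball (0 : EuclideanSpace ℝ (Fin n)) σ ∩ {x | k < u x})).toReal +
            L * (volume (ball (0 : EuclideanSpace ℝ (Fin n)) σ ∩ {x | k < u x})).toReal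
                ^ (q * (min (1 / q + 1 / ((n : ℝ) - 1)) 1 - 1 / p)) *
              (σ - ρ) ^ (-(q - 1 + q * min (1 / q + 1 / ((n : ℝ) - 1)) 1)) *
              ((∫ x in ball (0 : EuclideanSpace ℝ (Fin n)) σ, max (u x - k) 0 ^ p) +
                ∫ x in ball (0 : EuclideanSpace ℝ (Fin n)) σ ∩ {x | k < u x}, ‖du x‖ ^ p)
                ^ (q / p)) := by
  have hp0 : 0 < p := by linarith
  have hq : 1 < q := by linarith
  have hn1 : (1 : ℝ) ≤ (n : ℝ) - 1 := by
    have : (2 : ℝ) ≤ n := by exact_mod_cast hn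
    linarith
  obtain ⟨m, hm⟩ : ∃ m, m = min (1 / q + 1 / ((n : ℝ) - 1)) 1 := ⟨_, rfl⟩
  simp only [← hm] at hε ⊢
  have hm0 : 0 < m := by
    have : 0 < 1 / p := by positivity
    linarith
  have hm1 : m ≤ 1 := hm ▸ min_le_right _ _
  have hmq : m ≤ 1 / q + 1 / ((n : ℝ) - 1) := hm ▸ min_le_left _ _
  have hs : 1 ≤ 1 / m := (one_le_div hm0).2 hm1
  have hsp : 1 / m ≤ p := by
    rw [div_le_iff₀ hm0, ← div_le_iff₀' hp0]
    linarith
  have hsn : 1 / m < (n : ℝ) - 1 ∨ n = 2 ∧ 1 / m = 1 := by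
    rcases hn.eq_or_lt with h2 | h2
    · refine Or.inr ⟨h2.symm, ?_⟩
      have : m = 1 := by
        rw [hm, ← h2]
        refine min_eq_right ?_
        have : 0 ≤ 1 / q := by positivity
        norm_num
        linarith
      rw [this, one_div_one]
    · have h3 : (3 : ℝ) ≤ n := by exact_mod_cast h2
      refine Or.inl ?_
      rw [div_lt_iff₀ hm0, ← div_lt_iff₀' (by linarith), hm, lt_min_iff]
      refine ⟨lt_add_of_pos_left _ (by positivity), ?_⟩
      rw [div_lt_one (by linarith)]
      linarith
  obtain ⟨c, hc, H⟩ := IsQMinimizer.exists_caccioppoli_of_measurable (Q := Q) hn hs hsp hq hQ hsn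
    (by rw [one_div_one_div]; linarith)
  refine ⟨c, hc, ?_⟩
  intro Ω hΩ _ _ hB L μ hL _ g hg0 hgm hgi f hfm hfc hfx hfb _ u du h k ρ σ hk hρ hρσ hσ
  have hum := h.2.1.aestronglyMeasurable
  have hdum := h.2.2.1.aestronglyMeasurable
  have hball : ∀ {r : ℝ}, r ≤ 1 → ball 0 r ⊆ Ω := fun hr =>
    (ball_subset_ball hr).trans (ball_subset_closedBall.trans hB)
  have hr : ∀ {r : ℝ}, r ≤ 1 →
      (ball (0 : EuclideanSpace ℝ (Fin n)) r ∩ {x | k < u x} : Set _) =ᵐ[volume]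
        (ball (0 : EuclideanSpace ℝ (Fin n)) r ∩ {x | k < hum.mk u x} : Set _) := fun hr1 => by
    have h1 := (ae_restrict_iff' hΩ.measurableSet).1 hum.ae_eq_mk
    filter_upwards [h1] with x hx
    refine propext (and_congr_right fun hxr => ?_)
    show k < u x ↔ k < hum.mk u x
    rw [← hx (hball hr1 hxr)]
  have hdu : ∀ {r : ℝ}, r ≤ 1 → ∫ x in ball 0 r ∩ {x | k < u x}, ‖du x‖ ^ p =
      ∫ x in ball 0 r ∩ {x | k < hum.mk u x}, ‖hdum.mk du x‖ ^ p := fun hr1 => by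
    rw [← setIntegral_congr_set (hr hr1)]
    refine integral_congr_ae ?_
    filter_upwards [ae_mono (Measure.restrict_mono (inter_subset_left.trans (hball hr1)) le_rfl)
      hdum.ae_eq_mk] with x hx
    rw [hx]
  have hu : ∫ x in ball 0 σ, max (u x - k) 0 ^ p =
      ∫ x in ball 0 σ, max (hum.mk u x - k) 0 ^ p := by
    refine integral_congr_ae ?_
    filter_upwards [ae_mono (Measure.restrict_mono (hball hσ) le_rfl) hum.ae_eq_mk] with x hx
    rw [hx]
  have hres := H Ω f L (hum.mk u) (fun x => g x ^ (p / (p - 1))) (hdum.mk du) hΩ hB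
    (h.congr_ae hum.ae_eq_mk hdum.ae_eq_mk) hum.stronglyMeasurable_mk.measurable
    hdum.stronglyMeasurable_mk.measurable hgi (hg0.mono fun x hx => Real.rpow_nonneg hx _)
    hfm hfc hfx (by linarith) hfb k ρ σ hk hρ hρσ hσ
  have hω := setIntegral_le_omegaFn hp hB hg0 hgm hgi
    (A := ball 0 σ ∩ {x | k < hum.mk u x}) (inter_subset_left.trans (ball_subset_ball hσ))
  rw [hdu (by linarith), hdu hσ, hu, measure_congr (hr hσ)]
  rw [one_div_one_div, show q / (1 / m) = q * m by rw [div_div_eq_mul_div, div_one]] at hres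
  refine hres.trans (mul_le_mul_of_nonneg_left ?_ (by linarith))
  gcongr
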